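/- arXiv:1505.04652 — 3 statements merged into one kernel-verified Lean document; each statement's English description precedes it below -/
import Mathlib

section
/- Let k be an imaginary quadratic field. There is a constant c > 0 (depending on k) such that for every positive integer n, the n-th smallest odd rational prime that splits in k exists and is less than c·n·log(2n). -/
open NumberField

/-- A rational prime `p` *splits* in the number field `k` if `p O_k` is a product of
two distinct prime ideals of `O_k`. -/
def RatPrimeSplitsIn (k : IntermediateField ℚ ℂ) (p : ℕ) : Prop :=
  ∃ P Q : Ideal (𝓞 ↥k), P ≠ Q ∧ P.IsPrime ∧ Q.IsPrime ∧
    Ideal.span {(p : 𝓞 ↥k)} = P * Q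

section

open ArithmeticFunction Finset Filter Topology

/-- Dirichlet's test, quantitatively. -/
theorem abs_sum_Ico_mul_le_of_antitoneOn {f g : ℕ → ℝ} {C : ℝ} {m : ℕ}
    (hf : ∀ N, |∑ n ∈ range N, f n| ≤ C) (hg : AntitoneOn g (Set.Ici m))
    (hg₀ : ∀ n, m ≤ n → 0 ≤ g n) (N : ℕ) :
    |∑ n ∈ Ico m N, f n * g n| ≤ 2 * C * g m := by
  have hC : 0 ≤ C := (abs_nonneg _).trans (hf 0)
  rcases le_total N m with hN | hN
  · rw [Ico_eq_empty_of_le hN, sum_empty, abs_zero]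
    have := hg₀ m le_rfl
    positivity
  have hS : ∀ N, m ≤ N → |∑ n ∈ Ico m N, f n| ≤ 2 * C := fun N hN ↦ by
    rw [sum_Ico_eq_sub _ hN]
    linarith [abs_sub (∑ n ∈ range N, f n) (∑ n ∈ range m, f n), hf N, hf m]
  have key : |∑ n ∈ Ico m N, f n * g n - (∑ n ∈ Ico m N, f n) * g N| ≤
      2 * C * (g m - g N) := by
    induction N, hN using Nat.le_induction with
    | base => simp
    | succ N hN ih =>
      have hmono : g (N + 1) ≤ g N := hg hN (hN.trans N.le_succ) N.le_succ
      have h₁ := mul_le_mul_of_nonneg_right (hS (N + 1) (by omega)) (sub_nonneg.2 hmono)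
      rw [← abs_of_nonneg (sub_nonneg.2 hmono), ← abs_mul, abs_of_nonneg (sub_nonneg.2 hmono)] at h₁
      rw [sum_Ico_succ_top hN, sum_Ico_succ_top hN] at *
      have h₂ := abs_add_le (∑ n ∈ Ico m N, f n * g n - (∑ n ∈ Ico m N, f n) * g N)
        ((∑ n ∈ Ico m N, f n + f N) * (g N - g (N + 1)))
      calc _ = |∑ n ∈ Ico m N, f n * g n - (∑ n ∈ Ico m N, f n) * g N +
            (∑ n ∈ Ico m N, f n + f N) * (g N - g (N + 1))| := by congr 1; ring
        _ ≤ _ := by linarith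
  have h₁ := mul_le_mul_of_nonneg_right (hS N hN) (hg₀ N hN)
  rw [← abs_of_nonneg (hg₀ N hN), ← abs_mul, abs_of_nonneg (hg₀ N hN)] at h₁
  have h₂ := abs_add_le (∑ n ∈ Ico m N, f n * g n - (∑ n ∈ Ico m N, f n) * g N)
    ((∑ n ∈ Ico m N, f n) * g N)
  rw [sub_add_cancel] at h₂
  linarith

/-- If `f` has bounded partial sums then `∑ f n / n` converges, with an effective error term. -/
theorem exists_abs_sum_div_sub_le {f : ℕ → ℝ} {C : ℝ} (hf : ∀ N, |∑ n ∈ range N, f n| ≤ C) :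
    ∃ l : ℝ, ∀ N : ℕ, |∑ n ∈ Ioc 0 N, f n / n - l| ≤ 2 * C / (N + 1) := by
  have hC : 0 ≤ C := (abs_nonneg _).trans (hf 0)
  set B : ℕ → ℝ := fun N ↦ ∑ n ∈ Ioc 0 N, f n / n with hB
  have hBB : ∀ N M, N ≤ M → |B M - B N| ≤ 2 * C / (N + 1) := by
    intro N M h
    have h₁ : B M - B N = ∑ n ∈ Ico (N + 1) (M + 1), f n * (n : ℝ)⁻¹ := by
      rw [hB, sub_eq_iff_eq_add, add_comm]
      simp only [div_eq_mul_inv]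
      rw [show Ico (N + 1) (M + 1) = Ioc N M by ext; simp,
        sum_Ioc_consecutive _ (Nat.zero_le N) h]
    rw [h₁, div_eq_mul_inv]
    have := abs_sum_Ico_mul_le_of_antitoneOn (g := fun n ↦ (n : ℝ)⁻¹) (m := N + 1) hf
      (fun a ha b hb hab ↦ ?_) (fun n _ ↦ by positivity) (M + 1)
    · simpa using this
    · have : 0 < a := by simp at ha; omega
      change (b : ℝ)⁻¹ ≤ (a : ℝ)⁻¹
      gcongr
  have hlim : Tendsto (fun N : ℕ ↦ 2 * C / ((N : ℝ) + 1)) atTop (𝓝 0) :=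
    tendsto_const_nhds.div_atTop
      (tendsto_atTop_add_const_right _ _ tendsto_natCast_atTop_atTop)
  have hcau : CauchySeq B := by
    refine cauchySeq_of_le_tendsto_0' _ (fun n m hnm ↦ ?_) hlim
    rw [dist_comm, Real.dist_eq]
    exact hBB n m hnm
  obtain ⟨l, hl⟩ := cauchySeq_tendsto_of_complete hcau
  refine ⟨l, fun N ↦ ?_⟩
  rw [abs_sub_comm]
  exact le_of_tendsto (hl.sub_const (B N)).abs
    (eventually_atTop.2 ⟨N, fun M hM ↦ hBB N M hM⟩)

theorem exists_abs_sum_log_div_le {f : ℕ → ℝ} {C : ℝ} (hf : ∀ N, |∑ n ∈ range N, f n| ≤ C) :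
    ∃ K : ℝ, ∀ N : ℕ, |∑ n ∈ Ioc 0 N, f n / n * Real.log n| ≤ K := by
  have hC : 0 ≤ C := (abs_nonneg _).trans (hf 0)
  have h3 : ∀ N : ℕ, |∑ n ∈ Ioc 0 N, f n / n * Real.log n| =
      |∑ n ∈ range (N + 1), f n * (Real.log n / n)| := fun N ↦ by
    rw [range_eq_Ico, sum_eq_sum_Ico_succ_bot (Nat.succ_pos N)]
    simp only [CharP.cast_eq_zero, div_zero, mul_zero, zero_add]
    congr 1
    refine sum_congr (by ext; simp; omega) fun n _ ↦ by ring
  refine ⟨∑ n ∈ range 3, |f n * (Real.log n / n)| + 2 * C * (Real.log (3 : ℕ) / (3 : ℕ)),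
    fun N ↦ ?_⟩
  rw [h3]
  have h0 : 0 ≤ 2 * C * (Real.log (3 : ℕ) / (3 : ℕ)) :=
    mul_nonneg (by positivity) (div_nonneg (Real.log_natCast_nonneg 3) (by positivity))
  rcases le_total (N + 1) 3 with h | h
  · have h₁ : ∑ n ∈ range (N + 1), |f n * (Real.log n / n)| ≤
        ∑ n ∈ range 3, |f n * (Real.log n / n)| :=
      sum_le_sum_of_subset_of_nonneg (range_mono h) fun _ _ _ ↦ abs_nonneg _
    linarith [abs_sum_le_sum_abs (fun n : ℕ ↦ f n * (Real.log n / n)) (range (N + 1))]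
  · rw [← sum_range_add_sum_Ico _ h]
    have := abs_sum_Ico_mul_le_of_antitoneOn (g := fun n ↦ Real.log n / n) (m := 3) hf
      (fun a ha b hb hab ↦ Real.log_div_self_antitoneOn ?_ ?_ (by exact_mod_cast hab))
      (fun n _ ↦ div_nonneg (Real.log_natCast_nonneg n) (by positivity)) (N + 1)
    · linarith [abs_sum_le_sum_abs (fun n : ℕ ↦ f n * (Real.log n / n)) (range 3),
        abs_add_le (∑ n ∈ range 3, f n * (Real.log n / n))
          (∑ n ∈ Ico 3 (N + 1), f n * (Real.log n / n))]
    · have : (3 : ℝ) ≤ a := by exact_mod_cast ha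
      exact Real.exp_one_lt_three.le.trans this
    · have : (3 : ℝ) ≤ b := by exact_mod_cast hb
      exact Real.exp_one_lt_three.le.trans this

/-- Mertens' first theorem twisted by a completely multiplicative `f` with bounded partial sums,
under the assumption that `∑ f n / n` does not vanish. -/
theorem exists_abs_sum_mul_vonMangoldt_div_le {f : ℕ → ℝ} {C l : ℝ}
    (hmul : ∀ m n, f (m * n) = f m * f n) (hbd : ∀ n, |f n| ≤ 1) (hl : l ≠ 0) (hC : 0 ≤ C)
    (hlim : ∀ N : ℕ, |∑ n ∈ Ioc 0 N, f n / n - l| ≤ 2 * C / (N + 1))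
    (hlog : ∃ K : ℝ, ∀ N : ℕ, |∑ n ∈ Ioc 0 N, f n / n * Real.log n| ≤ K) :
    ∃ K : ℝ, ∀ N : ℕ, |∑ n ∈ Ioc 0 N, f n * Λ n / n| ≤ K := by
  obtain ⟨K, hK⟩ := hlog
  let g : ArithmeticFunction ℝ := ⟨fun n ↦ f n / n, by simp⟩
  let h : ArithmeticFunction ℝ := ⟨fun n ↦ f n * Λ n / n, by simp⟩
  have hgh : ∀ n, (h * g) n = f n / n * Real.log n := by
    intro n
    rw [ArithmeticFunction.mul_apply, ← vonMangoldt_sum, mul_sum,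
      Nat.sum_divisorsAntidiagonal (f := fun i j ↦ h i * g j)]
    refine sum_congr rfl fun d hd ↦ ?_
    obtain ⟨e, rfl⟩ := Nat.dvd_of_mem_divisors hd
    have hd0 : 0 < d := Nat.pos_of_mem_divisors hd
    simp only [coe_mk, g, h, Nat.mul_div_cancel_left e hd0, hmul,
      Nat.cast_mul]
    rw [div_mul_div_comm]
    ring
  refine ⟨(K + 2 * C * (Real.log 4 + 4)) / |l|, fun N ↦ ?_⟩
  rw [le_div_iff₀ (abs_pos.2 hl), ← abs_mul]
  have hsum := sum_Ioc_mul_eq_sum_sum h g N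
  simp only [hgh] at hsum
  have hdiff : |(∑ n ∈ Ioc 0 N, f n * Λ n / n) * l - ∑ n ∈ Ioc 0 N, f n / n * Real.log n| ≤
      2 * C * (Real.log 4 + 4) := by
    rw [hsum, sum_mul, ← sum_sub_distrib]
    rcases Nat.eq_zero_or_pos N with rfl | hN
    · have : 0 ≤ Real.log 4 := Real.log_nonneg (by norm_num)
      simp
      positivity
    have hN' : (0 : ℝ) < N := by exact_mod_cast hN
    have hψ := Chebyshev.psi_le_const_mul_self hN'.le
    rw [Chebyshev.psi, Nat.floor_natCast] at hψ
    calc _ ≤ ∑ n ∈ Ioc 0 N, 2 * C / N * Λ n := by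
          refine (abs_sum_le_sum_abs _ _).trans (sum_le_sum fun d hd ↦ ?_)
          have hd0 : 0 < d := (mem_Ioc.1 hd).1
          have hd0' : (0 : ℝ) < d := by exact_mod_cast hd0
          have h₁ := hlim (N / d)
          rw [abs_sub_comm] at h₁
          have h₂ : (N : ℝ) / d ≤ (N / d : ℕ) + 1 := by
            rw [← Nat.floor_div_eq_div (K := ℝ)]
            exact (Nat.lt_floor_add_one _).le
          have h₃ : 2 * C / ((N / d : ℕ) + 1) ≤ 2 * C / (N / d : ℝ) := by gcongr
          change |h d * l - h d * ∑ m ∈ Ioc 0 (N / d), g m| ≤ _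
          rw [← mul_sub, abs_mul]
          have h₄ : |h d| ≤ Λ d / d := by
            simp only [h, coe_mk]
            rw [abs_div, abs_mul, abs_of_nonneg (vonMangoldt_nonneg (n := d)), Nat.abs_cast]
            gcongr
            exact mul_le_of_le_one_left vonMangoldt_nonneg (hbd d)
          have hΛ : 0 ≤ Λ d / d := div_nonneg vonMangoldt_nonneg hd0'.le
          calc _ ≤ Λ d / d * (2 * C / (N / d : ℝ)) :=
                mul_le_mul h₄ (h₁.trans h₃) (abs_nonneg _) hΛ
            _ = _ := by field_simp
      _ = 2 * C / N * ∑ n ∈ Ioc 0 N, Λ n := by rw [mul_sum]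
      _ ≤ 2 * C / N * ((Real.log 4 + 4) * N) := by gcongr
      _ = _ := by field_simp
  have := abs_add_le ((∑ n ∈ Ioc 0 N, f n * Λ n / n) * l - ∑ n ∈ Ioc 0 N, f n / n * Real.log n)
    (∑ n ∈ Ioc 0 N, f n / n * Real.log n)
  rw [sub_add_cancel] at this
  linarith [hK N]

/-- Mertens' first theorem for the von Mangoldt function. -/
theorem exists_abs_sum_vonMangoldt_div_sub_log_le :
    ∃ K : ℝ, ∀ N : ℕ, 1 ≤ N → |∑ n ∈ Ioc 0 N, Λ n / n - Real.log N| ≤ K := by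
  have h4 : 0 ≤ Real.log 4 := Real.log_nonneg (by norm_num)
  refine ⟨Real.log 4 + 4, fun N hN ↦ ?_⟩
  have hN' : (0 : ℝ) < N := by exact_mod_cast hN
  have hψ := Chebyshev.psi_le_const_mul_self hN'.le
  rw [Chebyshev.psi, Nat.floor_natCast] at hψ
  have hfac : ∑ n ∈ Ioc 0 N, Λ n * (N / n : ℕ) = Real.log N.factorial := by
    have h₁ := sum_Ioc_mul_zeta_eq_sum Λ N
    rw [← h₁, vonMangoldt_mul_zeta]
    clear * -
    induction N with
    | zero => simp
    | succ N ih =>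
      rw [sum_Ioc_succ_top (Nat.zero_le N), ih, Nat.factorial_succ, Nat.cast_mul,
        Real.log_mul (by positivity) (by positivity), log_apply, add_comm]
  have hup : Real.log N.factorial ≤ N * Real.log N := by
    rw [← Real.log_pow]
    exact Real.log_le_log (by positivity) (by exact_mod_cast N.factorial_le_pow)
  have hlow : N * Real.log N - N ≤ Real.log N.factorial := by
    have := Stirling.le_log_factorial_stirling (n := N) (by omega)
    have h1 : 0 ≤ Real.log N := Real.log_natCast_nonneg N
    have h2 : 0 ≤ Real.log (2 * Real.pi) := Real.log_nonneg (by linarith [Real.pi_gt_three])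
    linarith
  have hle : ∑ n ∈ Ioc 0 N, Λ n * (N / n : ℕ) ≤ N * ∑ n ∈ Ioc 0 N, Λ n / n := by
    rw [mul_sum]
    refine sum_le_sum fun n _ ↦ ?_
    calc _ ≤ Λ n * (N / n : ℝ) := mul_le_mul_of_nonneg_left Nat.cast_div_le vonMangoldt_nonneg
      _ = _ := by ring
  have hge : N * ∑ n ∈ Ioc 0 N, Λ n / n - ∑ n ∈ Ioc 0 N, Λ n ≤
      ∑ n ∈ Ioc 0 N, Λ n * (N / n : ℕ) := by
    rw [mul_sum, ← sum_sub_distrib]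
    refine sum_le_sum fun n _ ↦ ?_
    have h₂ : (N : ℝ) / n ≤ (N / n : ℕ) + 1 := by
      rw [← Nat.floor_div_eq_div (K := ℝ)]
      exact (Nat.lt_floor_add_one _).le
    calc _ = Λ n * (N / n - 1 : ℝ) := by ring
      _ ≤ _ := mul_le_mul_of_nonneg_left (by linarith) vonMangoldt_nonneg
  rw [abs_le]
  constructor
  · refine le_of_mul_le_mul_left ?_ hN'
    nlinarith
  · refine le_of_mul_le_mul_left ?_ hN'
    nlinarith

theorem DirichletCharacter.norm_sum_range_le {N : ℕ} [NeZero N] {χ : DirichletCharacter ℂ N}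
    (hχ : χ ≠ 1) (n : ℕ) : ‖∑ i ∈ range n, χ i‖ ≤ N := by
  have hper : ∑ i ∈ range N, χ i = 0 := by
    rw [← MulChar.sum_eq_zero_of_ne_one hχ]
    refine sum_bij (fun i _ ↦ (i : ZMod N)) (fun _ _ ↦ mem_univ _) (fun i hi j hj h ↦ ?_)
      (fun b _ ↦ ⟨b.val, mem_range.2 b.val_lt, by simp⟩) fun _ _ ↦ rfl
    rw [ZMod.natCast_eq_natCast_iff'] at h
    rwa [Nat.mod_eq_of_lt (mem_range.1 hi), Nat.mod_eq_of_lt (mem_range.1 hj)] at h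
  induction n using Nat.strong_induction_on with
  | _ n ih =>
    rcases lt_or_ge n N with h | h
    · refine (norm_sum_le_of_le (f := fun i : ℕ ↦ χ i) (range n)
        fun i _ ↦ χ.norm_le_one (i : ZMod N)).trans ?_
      simpa using h.le
    · obtain ⟨m, rfl⟩ := Nat.exists_eq_add_of_le h
      rw [sum_range_add, hper, zero_add]
      simpa using ih m (by have := NeZero.pos N; omega)

/-- If `χ ≠ 1`, the conditionally convergent series `∑ χ n / n` does not vanish. -/
theorem DirichletCharacter.sum_div_limit_ne_zero {N : ℕ} [NeZero N] {χ : DirichletCharacter ℂ N}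
    (hχ : χ ≠ 1) {f : ℕ → ℝ} (hf : ∀ n : ℕ, χ n = f n) {C l : ℝ} (hC : 0 ≤ C)
    (hlim : ∀ N : ℕ, |∑ n ∈ Ioc 0 N, f n / n - l| ≤ 2 * C / (N + 1)) : l ≠ 0 := by
  rintro rfl
  simp only [sub_zero] at hlim
  set g : ℕ → ℂ := fun n ↦ χ n / n with hg
  have hterm : ∀ ε : ℝ, LSeries.term g ε = LSeries.term (χ ·) (1 + ε : ℂ) := by
    intro ε
    ext n
    rcases eq_or_ne n 0 with rfl | hn
    · simp
    · have : (n : ℂ) ≠ 0 := by exact_mod_cast hn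
      rw [LSeries.term_of_ne_zero hn, LSeries.term_of_ne_zero hn, Complex.cpow_add _ _ this,
        Complex.cpow_one, hg, div_div]
  have hgsum : ∀ M : ℕ, ‖∑ k ∈ Icc 1 M, g k‖ ≤ 2 * C / (M + 1) := by
    intro M
    have h1 : ∑ k ∈ Icc 1 M, g k = ((∑ k ∈ Ioc 0 M, f k / k : ℝ) : ℂ) := by
      push_cast
      exact sum_congr rfl fun k _ ↦ by rw [hg]; simp only [hf]
    rw [h1, Complex.norm_real]
    exact hlim M
  have h_int : MeasureTheory.IntegrableOn (fun t : ℝ ↦ 2 * C * t ^ (-2 : ℝ)) (Set.Ioi 1) :=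
    (integrableOn_Ioi_rpow_of_lt (by norm_num) one_pos).const_mul _
  have hbound : ∀ ε : ℝ, 0 < ε →
      ‖χ.LFunction (1 + ε : ℂ)‖ ≤ ε * ∫ t in Set.Ioi (1 : ℝ), 2 * C * t ^ (-2 : ℝ) := by
    intro ε hε
    have hre : 1 < (1 + ε : ℂ).re := by simpa
    have hO : (fun n ↦ ∑ k ∈ Icc 1 n, g k) =O[atTop] fun n : ℕ ↦ (n : ℝ) ^ (0 : ℝ) := by
      refine Asymptotics.IsBigO.of_bound (2 * C) (Eventually.of_forall fun n ↦ ?_)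
      rw [Real.rpow_zero, norm_one, mul_one]
      refine (hgsum n).trans (div_le_self (by positivity) ?_)
      have : (0 : ℝ) ≤ n := by positivity
      linarith
    have hsum : LSeriesSummable g ε := by
      rw [LSeriesSummable, hterm]
      exact χ.LSeriesSummable_of_one_lt_re hre
    have hL : χ.LFunction (1 + ε : ℂ) = LSeries g ε := by
      rw [χ.LFunction_eq_LSeries hre, LSeries, LSeries, hterm]
    rw [hL, LSeries_eq_mul_integral g le_rfl (by simpa) hsum hO, norm_mul, Complex.norm_real,
      Real.norm_of_nonneg hε.le]
    gcongr
    refine MeasureTheory.norm_integral_le_of_norm_le h_int ?_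
    filter_upwards [MeasureTheory.ae_restrict_mem measurableSet_Ioi] with t ht
    have ht1 : (1 : ℝ) < t := ht
    have ht0 : 0 < t := one_pos.trans ht1
    rw [norm_mul, Complex.norm_cpow_eq_rpow_re_of_pos ht0]
    have h1 : ‖∑ k ∈ Icc 1 ⌊t⌋₊, g k‖ ≤ 2 * C / t := by
      refine (hgsum _).trans ?_
      gcongr
      exact (Nat.lt_floor_add_one t).le
    have h2 : t ^ (-(ε + 1 : ℂ)).re ≤ t ^ (-1 : ℝ) :=
      Real.rpow_le_rpow_of_exponent_le ht1.le (by simp [hε.le])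
    calc _ ≤ 2 * C / t * t ^ (-1 : ℝ) := by gcongr
      _ = 2 * C * t ^ (-2 : ℝ) := by
        rw [show (-2 : ℝ) = -1 + -1 by norm_num, Real.rpow_add ht0, Real.rpow_neg_one]
        ring
  refine DirichletCharacter.LFunction_apply_one_ne_zero hχ ?_
  have hcont : Tendsto (fun ε : ℝ ↦ ‖χ.LFunction (1 + ε : ℂ)‖) (𝓝[>] 0)
      (𝓝 ‖χ.LFunction 1‖) := by
    have h1 : Continuous fun ε : ℝ ↦ ‖χ.LFunction (1 + ε : ℂ)‖ := by
      have := (DirichletCharacter.differentiable_LFunction hχ).continuous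
      fun_prop
    have := h1.tendsto 0
    simp only [Complex.ofReal_zero, add_zero] at this
    exact this.mono_left nhdsWithin_le_nhds
  have hzero : Tendsto (fun ε : ℝ ↦ ε * ∫ t in Set.Ioi (1 : ℝ), 2 * C * t ^ (-2 : ℝ)) (𝓝[>] 0)
      (𝓝 0) := by
    have h1 : Continuous fun ε : ℝ ↦ ε * ∫ t in Set.Ioi (1 : ℝ), 2 * C * t ^ (-2 : ℝ) := by
      fun_prop
    have := h1.tendsto 0
    rw [zero_mul] at this
    exact this.mono_left nhdsWithin_le_nhds
  exact norm_le_zero_iff.1 (le_of_tendsto_of_tendsto hcont hzero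
    (eventually_nhdsWithin_of_forall hbound))

open scoped NumberTheorySymbols in
theorem jacobiSym_neg_four_mul_mod (a : ℕ) {n : ℕ} (hn : n % (4 * a) ≠ 0) :
    J(-4 * a | n) = J(-4 * a | n % (4 * a)) := by
  have hn0 : n ≠ 0 := by rintro rfl; simp at hn
  rcases Nat.even_or_odd n with he | ho
  · have he' : Even (n % (4 * a)) := by
      rw [Nat.even_iff, Nat.mod_mod_of_dvd _ ⟨2 * a, by ring⟩]; exact Nat.even_iff.1 he
    have h : ∀ m : ℕ, m ≠ 0 → Even m → J(-4 * a | m) = 0 := by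
      intro m hm hme
      refine jacobiSym.eq_zero_iff.2 ⟨hm, fun h ↦ ?_⟩
      have h2 : (2 : ℤ) ∣ Int.gcd (-4 * a) m :=
        Int.dvd_coe_gcd ⟨-2 * a, by ring⟩ (by exact_mod_cast hme.two_dvd)
      rw [h] at h2
      norm_num at h2
    rw [h n hn0 he, h _ hn he']
  · have ho' : Odd (n % (4 * a)) := ho.mod_even ⟨2 * a, by ring⟩
    rw [show (-4 * a : ℤ) = 4 * (-a) by ring, jacobiSym.mul_left, jacobiSym.mul_left,
      jacobiSym.at_four ho, jacobiSym.at_four ho', jacobiSym.mod_right _ ho]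
    simp

open scoped NumberTheorySymbols in
/-- The Dirichlet character `n ↦ (-4a / n)` modulo `4a`. -/
noncomputable def negQuadraticCharacter (a : ℕ) (ha : a ≠ 0) : DirichletCharacter ℤ (4 * a) :=
  have : NeZero (4 * a) := ⟨by positivity⟩
  have hu : ∀ x : ZMod (4 * a), x = 0 → ¬ IsUnit x := by
    rintro x rfl h
    have : Nontrivial (ZMod (4 * a)) := ZMod.nontrivial_iff.2 (by omega)
    exact not_isUnit_zero h
  { toFun x := if x = 0 then 0 else J(-4 * a | x.val)
    map_one' := by
      have : Fact (1 < 4 * a) := ⟨by omega⟩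
      rw [if_neg one_ne_zero, ZMod.val_one, jacobiSym.one_right]
    map_mul' x y := by
      rcases eq_or_ne x 0 with rfl | hx
      · simp
      rcases eq_or_ne y 0 with rfl | hy
      · simp
      have hx' : x.val ≠ 0 := by rwa [ne_eq, ZMod.val_eq_zero]
      have hy' : y.val ≠ 0 := by rwa [ne_eq, ZMod.val_eq_zero]
      rw [if_neg hx, if_neg hy, ← jacobiSym.mul_right' _ hx' hy']
      split_ifs with h
      · symm
        refine jacobiSym.eq_zero_iff.2 ⟨mul_ne_zero hx' hy', fun h1 ↦ ?_⟩
        have h2 : 4 * a ∣ x.val * y.val := by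
          rw [← ZMod.natCast_eq_zero_iff]
          simpa using h
        have h3 : (4 * a : ℤ) ∣ Int.gcd (-4 * a) (x.val * y.val : ℕ) :=
          Int.dvd_coe_gcd ⟨-1, by ring⟩ (by exact_mod_cast h2)
        rw [h1] at h3
        have := Int.le_of_dvd one_pos h3
        omega
      · rw [ZMod.val_mul, ← jacobiSym_neg_four_mul_mod]
        rwa [← ZMod.val_mul, ne_eq, ZMod.val_eq_zero]
    map_nonunit' x hx := by
      split_ifs with h
      · rfl
      · refine jacobiSym.eq_zero_iff.2 ⟨by rwa [ne_eq, ZMod.val_eq_zero], fun h1 ↦ hx ?_⟩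
        rw [← ZMod.natCast_zmod_val x, ZMod.isUnit_iff_coprime, Nat.coprime_comm]
        rw [Nat.Coprime, ← h1, Int.gcd_def]
        rw [Int.natAbs_mul]
        rfl }

open scoped NumberTheorySymbols in
theorem negQuadraticCharacter_natCast {a : ℕ} (ha : a ≠ 0) {n : ℕ} (hn : n % (4 * a) ≠ 0) :
    negQuadraticCharacter a ha n = J(-4 * a | n) := by
  have : NeZero (4 * a) := ⟨by positivity⟩
  have h : (n : ZMod (4 * a)) ≠ 0 := by
    rwa [ne_eq, ZMod.natCast_eq_zero_iff, Nat.dvd_iff_mod_eq_zero]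
  change (if (n : ZMod (4 * a)) = 0 then 0 else J(-4 * a | (n : ZMod (4 * a)).val)) = _
  rw [if_neg h, ZMod.val_natCast, ← jacobiSym_neg_four_mul_mod _ hn]

theorem negQuadraticCharacter_sub_one {a : ℕ} (ha : a ≠ 0) :
    negQuadraticCharacter a ha (4 * a - 1 : ℕ) = -1 := by
  have hodd : Odd (4 * a - 1) := ⟨2 * a - 1, by omega⟩
  rw [negQuadraticCharacter_natCast ha (by rw [Nat.mod_eq_of_lt] <;> omega),
    show (-4 * a : ℤ) = -(4 * a) by ring, jacobiSym.neg _ hodd,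
    ZMod.χ₄_nat_three_mod_four (by omega),
    jacobiSym.mod_left' (a₂ := 1), jacobiSym.one_left, mul_one]
  refine Int.modEq_iff_dvd.2 ⟨-1, ?_⟩
  rw [Nat.cast_sub (by omega)]
  push_cast
  ring

theorem negQuadraticCharacter_trichotomy {a : ℕ} (ha : a ≠ 0) (x : ZMod (4 * a)) :
    negQuadraticCharacter a ha x = 0 ∨ negQuadraticCharacter a ha x = 1 ∨
      negQuadraticCharacter a ha x = -1 := by
  change (if x = 0 then 0 else _) = _ ∨ (if x = 0 then 0 else _) = _ ∨
    (if x = 0 then 0 else _) = _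
  split_ifs
  · simp
  · exact jacobiSym.trichotomy _ _

/-- An odd prime at which the character is `1` admits a square root of `-a`. -/
theorem exists_dvd_sq_add_of_negQuadraticCharacter_eq_one {a : ℕ} (ha : a ≠ 0) {p : ℕ}
    (hp : p.Prime) (h : negQuadraticCharacter a ha p = 1) :
    p ≠ 2 ∧ ¬ p ∣ a ∧ ∃ t : ℤ, (p : ℤ) ∣ t ^ 2 + a := by
  have hu : IsUnit (p : ZMod (4 * a)) := by
    by_contra hu
    rw [MulChar.map_nonunit _ hu] at h
    exact zero_ne_one h
  rw [ZMod.isUnit_iff_coprime] at hu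
  have hpa : ¬ p ∣ 4 * a := hp.coprime_iff_not_dvd.1 hu
  have hp2 : p ≠ 2 := by
    rintro rfl
    exact hpa ⟨2 * a, by ring⟩
  rw [negQuadraticCharacter_natCast] at h
  · refine ⟨hp2, fun h ↦ hpa (h.mul_left 4), ?_⟩
    have := Fact.mk hp
    rw [show (-4 * a : ℤ) = 4 * (-a) by ring, jacobiSym.mul_left,
      jacobiSym.at_four (hp.odd_of_ne_two hp2), one_mul] at h
    obtain ⟨x, hx⟩ := ZMod.isSquare_of_jacobiSym_eq_one h
    refine ⟨x.valMinAbs, ?_⟩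
    rw [← ZMod.intCast_zmod_eq_zero_iff_dvd]
    push_cast
    rw [sq, ← hx]
    simp
  · intro h0
    have h1 : 4 * a ∣ p := Nat.dvd_of_mod_eq_zero h0
    have := Nat.Coprime.eq_one_of_dvd hu.symm h1
    omega

/-- An imaginary quadratic field contains `√-a` for some positive integer `a`. -/
theorem exists_sq_eq_neg_natCast (k : IntermediateField ℚ ℂ) [NumberField ↥k]
    (hquad : Module.finrank ℚ ↥k = 2)
    (himag : ¬ (k : Set ℂ) ⊆ Set.range (Complex.ofReal)) :
    ∃ a : ℕ, a ≠ 0 ∧ ∃ w : 𝓞 ↥k, w ^ 2 = -(a : 𝓞 ↥k) := by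
  obtain ⟨z, hzk, hz⟩ := Set.not_subset.1 himag
  have hdep : ∃ b c : ℚ, z ^ 2 + b * z + c = 0 := by
    let x : k := ⟨z, hzk⟩
    have h_int : IsIntegral ℚ x := IsIntegral.of_finite ℚ x
    have hdeg : (minpoly ℚ x).natDegree ≤ 2 := hquad ▸ minpoly.natDegree_le x
    have hne : (minpoly ℚ x).natDegree ≠ 1 := by
      intro h1
      obtain ⟨q, hq⟩ := minpoly.natDegree_eq_one_iff.1 h1
      refine hz ⟨q, ?_⟩
      have := congrArg (fun y : k ↦ (y : ℂ)) hq
      simpa using this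
    have hpos := minpoly.natDegree_pos h_int
    have h2 : (minpoly ℚ x).natDegree = 2 := by omega
    have h0 := minpoly.aeval ℚ x
    have hlead : (minpoly ℚ x).coeff 2 = 1 := by
      rw [← h2]; exact minpoly.monic h_int
    rw [Polynomial.aeval_eq_sum_range, h2] at h0
    simp only [Finset.sum_range_succ, Finset.sum_range_zero, hlead] at h0
    refine ⟨(minpoly ℚ x).coeff 1, (minpoly ℚ x).coeff 0, ?_⟩
    have := congrArg (fun y : k ↦ (y : ℂ)) h0
    simp [Algebra.smul_def, x] at this
    linear_combination this
  obtain ⟨b, c, hbc⟩ := hdep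
  have hzim : z.im ≠ 0 := fun h ↦ hz ⟨z.re, Complex.ext (by simp) (by simp [h])⟩
  set q : ℚ := b ^ 2 - 4 * c with hq
  have hsq : (2 * z + b) ^ 2 = q := by
    rw [hq]; push_cast; linear_combination 4 * hbc
  have hre : (2 * z + b).re = 0 := by
    have := congrArg Complex.im hsq
    rw [sq, Complex.mul_im] at this
    have h1 : ((q : ℂ)).im = 0 := by simp
    have h2 : (2 * z + b).im = 2 * z.im := by simp
    rw [h1, h2] at this
    have h3 : (2 * z + b).re * z.im = 0 := by linarith
    exact (mul_eq_zero.1 h3).resolve_right hzim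
  have hqneg : q < 0 := by
    have := congrArg Complex.re hsq
    rw [sq, Complex.mul_re, hre] at this
    have h1 : ((q : ℂ)).re = q := by simp
    have h2 : (2 * z + b).im = 2 * z.im := by simp
    rw [h1, h2] at this
    have h3 : 0 < z.im ^ 2 := by positivity
    have : (q : ℝ) < 0 := by nlinarith
    exact_mod_cast this
  have hnum : q.num < 0 := Rat.num_neg.2 hqneg
  obtain ⟨m, hm⟩ := Int.exists_eq_neg_ofNat hnum.le
  refine ⟨m * q.den, mul_ne_zero (by omega) q.den_ne_zero, ?_⟩
  let y : k := q.den * (⟨z, hzk⟩ + ⟨z, hzk⟩ + (b : k))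
  have hy : y ^ 2 = -((m * q.den : ℕ) : k) := by
    apply Subtype.coe_injective
    have h2 : (q : ℂ) * q.den = q.num := by
      exact_mod_cast congrArg (Rat.cast : ℚ → ℂ) q.mul_den_eq_num
    rw [hm] at h2
    push_cast at h2
    simp [y]
    linear_combination (q.den : ℂ) ^ 2 * hsq + q.den * h2
  have hyint : IsIntegral ℤ y := by
    refine IsIntegral.of_pow two_pos ?_
    rw [hy]
    exact (isIntegral_natCast _).neg
  obtain ⟨w, hw⟩ : ∃ w : 𝓞 ↥k, (w : k) = y := ⟨⟨y, hyint⟩, rfl⟩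
  refine ⟨w, RingOfIntegers.ext ?_⟩
  simpa [hw] using hy

theorem span_pair_natCast_ne_top {k : IntermediateField ℚ ℂ} [NumberField ↥k] {a : ℕ} (ha : a ≠ 0)
    {w : 𝓞 ↥k} (hw : w ^ 2 = -(a : 𝓞 ↥k)) {p : ℕ} {t : ℤ} (hp : ¬ (p : ℤ) ∣ 2 * t)
    (hpt : (p : ℤ) ∣ t ^ 2 + a) :
    Ideal.span {(p : 𝓞 ↥k), w - t} ≠ ⊤ := by
  intro htop
  obtain ⟨m, hm⟩ := hpt
  obtain ⟨x, y, hxy⟩ := Ideal.mem_span_pair.1 ((Ideal.eq_top_iff_one _).1 htop)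
  have hm' : (t : 𝓞 ↥k) ^ 2 + a = p * m := by exact_mod_cast congrArg (Int.cast : ℤ → 𝓞 ↥k) hm
  obtain ⟨β, hβ⟩ : ∃ β : 𝓞 ↥k, w + t = p * β :=
    ⟨x * (w + t) - m * y, by linear_combination -(w + t) * hxy + y * hw - y * hm'⟩
  let ι : 𝓞 ↥k →+* ℂ := (algebraMap ↥k ℂ).comp (algebraMap (𝓞 ↥k) ↥k)
  have hβ' : ι w + t = p * ι β := by simpa using congrArg ι hβ
  have hw' : ι w ^ 2 = -a := by simpa using congrArg ι hw
  have hconj : (starRingEnd ℂ) (ι w) = -ι w := by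
    have h1 : (starRingEnd ℂ) (ι w) ^ 2 = ι w ^ 2 := by rw [← map_pow, hw']; simp
    refine (sq_eq_sq_iff_eq_or_eq_neg.1 h1).resolve_left fun h2 ↦ ?_
    obtain ⟨r, hr⟩ := Complex.conj_eq_iff_real.1 h2
    rw [hr] at hw'
    have h3 : r ^ 2 = -a := by exact_mod_cast hw'
    have h4 : (0 : ℝ) < a := by positivity
    nlinarith [sq_nonneg r]
  have hp0 : (p : ℂ) ≠ 0 := by
    rintro h
    have hp0 : p = 0 := by exact_mod_cast h
    subst hp0
    have : (t : ℂ) ^ 2 + a = 0 := by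
      have : t ^ 2 + a = 0 := by simpa using hm
      exact_mod_cast congrArg (Int.cast : ℤ → ℂ) this
    have h3 : t ^ 2 + a = 0 := by exact_mod_cast this
    have : 0 < a := by positivity
    nlinarith [sq_nonneg t]
  have htr : ι β + (starRingEnd ℂ) (ι β) = ((2 * t / p : ℚ) : ℂ) := by
    have h1 := congrArg (starRingEnd ℂ) hβ'
    rw [map_add, map_mul, hconj] at h1
    simp only [Complex.conj_natCast, map_intCast] at h1
    push_cast
    rw [eq_div_iff hp0]
    linear_combination -hβ' - h1
  have h_int : IsIntegral ℤ (ι β + (starRingEnd ℂ) (ι β)) := by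
    have h1 : IsIntegral ℤ (ι β) := (RingOfIntegers.isIntegral β).map ι.toIntAlgHom
    exact h1.add (h1.map (starRingEnd ℂ).toIntAlgHom)
  rw [htr] at h_int
  have h_int' : IsIntegral ℤ (2 * t / p : ℚ) :=
    (isIntegral_algHom_iff (algebraMap ℚ ℂ).toIntAlgHom (algebraMap ℚ ℂ).injective).1 h_int
  obtain ⟨n, hn⟩ := IsIntegrallyClosed.isIntegral_iff.1 h_int'
  refine hp ⟨n, ?_⟩
  have hp0' : (p : ℚ) ≠ 0 := by exact_mod_cast hp0
  rw [eq_div_iff hp0'] at hn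
  have : (n : ℚ) * p = 2 * t := by simpa using hn
  have : n * p = 2 * t := by exact_mod_cast this
  linarith

theorem ratPrimeSplitsIn_of_dvd_sq_add {k : IntermediateField ℚ ℂ} [NumberField ↥k]
    (hquad : Module.finrank ℚ ↥k = 2) {a : ℕ} (ha : a ≠ 0)
    {w : 𝓞 ↥k} (hw : w ^ 2 = -(a : 𝓞 ↥k)) {p : ℕ} (hp : p.Prime) (hp2 : p ≠ 2) (hpa : ¬ p ∣ a)
    {t : ℤ} (hpt : (p : ℤ) ∣ t ^ 2 + a) : RatPrimeSplitsIn k p := by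
  have hpZ : Prime (p : ℤ) := Nat.prime_iff_prime_int.1 hp
  have h2t : ¬ (p : ℤ) ∣ 2 * t := by
    intro h
    rcases hpZ.dvd_or_dvd h with h | h
    · exact hp2 ((Nat.prime_dvd_prime_iff_eq hp Nat.prime_two).1 (by exact_mod_cast h))
    · refine hpa (Int.natCast_dvd_natCast.1 ?_)
      exact (dvd_add_right (dvd_pow h two_ne_zero)).1 hpt
  obtain ⟨u, v, huv⟩ : IsCoprime (p : ℤ) (2 * t) :=
    (Prime.coprime_iff_not_dvd hpZ).2 h2t
  have huv' : (u : 𝓞 ↥k) * p + v * (2 * t) = 1 := by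
    exact_mod_cast congrArg (Int.cast : ℤ → 𝓞 ↥k) huv
  have hP := span_pair_natCast_ne_top ha hw h2t hpt
  have hQ := span_pair_natCast_ne_top ha hw (t := -t) (by simpa using h2t) (by simpa using hpt)
  rw [Int.cast_neg, sub_neg_eq_add] at hQ
  have hmul : Ideal.span {(p : 𝓞 ↥k)} =
      Ideal.span {(p : 𝓞 ↥k), w - t} * Ideal.span {(p : 𝓞 ↥k), w + t} := by
    apply le_antisymm
    · rw [Ideal.span_singleton_le_iff_mem]
      have h1 : (p : 𝓞 ↥k) ∈ Ideal.span {(p : 𝓞 ↥k), w - t} := Ideal.subset_span (by simp)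
      have h2 : (p : 𝓞 ↥k) ∈ Ideal.span {(p : 𝓞 ↥k), w + t} := Ideal.subset_span (by simp)
      have h3 : w - t ∈ Ideal.span {(p : 𝓞 ↥k), w - t} := Ideal.subset_span (by simp)
      have h4 : w + t ∈ Ideal.span {(p : 𝓞 ↥k), w + t} := Ideal.subset_span (by simp)
      have := add_mem (Ideal.mul_mem_left _ (u : 𝓞 ↥k) (Ideal.mul_mem_mul h1 h2))
        (Ideal.mul_mem_left _ (v : 𝓞 ↥k)
          (sub_mem (Ideal.mul_mem_mul h1 h4) (Ideal.mul_mem_mul h3 h2)))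
      convert this using 1
      linear_combination -(p : 𝓞 ↥k) * huv'
    · obtain ⟨m, hm⟩ := hpt
      have hm' : (t : 𝓞 ↥k) ^ 2 + a = p * m := by
        exact_mod_cast congrArg (Int.cast : ℤ → 𝓞 ↥k) hm
      rw [Ideal.span_pair_mul_span_pair, Ideal.span_le]
      rintro x (rfl | rfl | rfl | rfl) <;>
        rw [SetLike.mem_coe, Ideal.mem_span_singleton]
      · exact dvd_mul_right _ _
      · exact dvd_mul_right _ _
      · exact dvd_mul_left _ _
      · exact ⟨-m, by linear_combination hw - hm'⟩
  have hnorm : Ideal.absNorm (Ideal.span {(p : 𝓞 ↥k), w - t}) *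
      Ideal.absNorm (Ideal.span {(p : 𝓞 ↥k), w + t}) = p ^ 2 := by
    rw [← map_mul, ← hmul, Ideal.absNorm_span_natCast, RingOfIntegers.rank, hquad]
  rw [Nat.Prime.mul_eq_prime_sq_iff hp (by rwa [ne_eq, Ideal.absNorm_eq_one_iff])
    (by rwa [ne_eq, Ideal.absNorm_eq_one_iff])] at hnorm
  refine ⟨_, _, fun hPQ ↦ hP ?_, Ideal.isPrime_of_irreducible_absNorm ?_,
    Ideal.isPrime_of_irreducible_absNorm ?_, hmul⟩
  · have h1 : (p : 𝓞 ↥k) ∈ Ideal.span {(p : 𝓞 ↥k), w - t} := Ideal.subset_span (by simp)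
    have h3 : w - t ∈ Ideal.span {(p : 𝓞 ↥k), w - t} := Ideal.subset_span (by simp)
    have h4 : w + t ∈ Ideal.span {(p : 𝓞 ↥k), w - t} := hPQ ▸ Ideal.subset_span (by simp)
    rw [Ideal.eq_top_iff_one]
    convert add_mem (Ideal.mul_mem_left _ (u : 𝓞 ↥k) h1)
      (Ideal.mul_mem_left _ (v : 𝓞 ↥k) (sub_mem h4 h3)) using 1
    linear_combination -huv'
  · rw [hnorm.1]; exact hp
  · rw [hnorm.2]; exact hp

/-- A Chebyshev-type lower bound for a counting function makes the underlying set infinite. -/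
theorem infinite_setOf_of_le_mul_count_mul_log {P : ℕ → Prop} [DecidablePred P] {C : ℝ} {x₀ : ℕ}
    (h : ∀ N : ℕ, x₀ ≤ N → (N : ℝ) ≤ C * Nat.count P (N + 1) * Real.log N) :
    {q | P q}.Infinite := by
  intro hfin
  set B := #hfin.toFinset
  have hB (N : ℕ) : Nat.count P (N + 1) ≤ B := by
    rw [Nat.count_eq_card_filter_range]
    refine card_le_card fun q hq ↦ ?_
    simp only [Finset.mem_filter] at hq
    exact hfin.mem_toFinset.2 hq.2
  have hlit := (Real.isLittleO_log_id_atTop.comp_tendsto tendsto_natCast_atTop_atTop).def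
    (c := 1 / (2 * (|C| * B + 1))) (by positivity)
  obtain ⟨N, hN, hx, hN1⟩ :=
    (hlit.and ((eventually_ge_atTop x₀).and (eventually_ge_atTop 1))).exists
  have hlog : 0 ≤ Real.log N := Real.log_natCast_nonneg N
  have hN0 : (1 : ℝ) ≤ N := by exact_mod_cast hN1
  simp only [Function.comp_apply, id, Real.norm_eq_abs, abs_of_nonneg hlog, Nat.abs_cast] at hN
  have h1 : C * Nat.count P (N + 1) ≤ |C| * B :=
    mul_le_mul (le_abs_self C) (by exact_mod_cast hB N) (by positivity) (abs_nonneg C)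
  have h2 : (N : ℝ) ≤ (|C| * B + 1) * Real.log N :=
    (h N hx).trans (by gcongr; linarith)
  have h3 : (|C| * B + 1) * Real.log N ≤ N / 2 := by
    calc _ ≤ (|C| * B + 1) * (1 / (2 * (|C| * B + 1)) * N) := by gcongr
      _ = N / 2 := by field_simp
  linarith

/-- A Chebyshev-type lower bound for a counting function bounds the `n`-th element. -/
theorem exists_nth_lt_of_le_mul_count_mul_log {P : ℕ → Prop} [DecidablePred P] {C : ℝ} {x₀ : ℕ}
    (hC : 1 ≤ C) (h : ∀ N : ℕ, x₀ ≤ N → (N : ℝ) ≤ C * Nat.count P (N + 1) * Real.log N) :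
    ∃ c : ℝ, 0 < c ∧ ∀ n : ℕ, 1 ≤ n → (Nat.nth P (n - 1) : ℝ) < c * (n * Real.log (2 * n)) := by
  have hinf := infinite_setOf_of_le_mul_count_mul_log h
  have hl2 : 0 < Real.log 2 := Real.log_pos one_lt_two
  have hlC : 0 ≤ Real.log C := Real.log_nonneg hC
  set K : ℝ := 2 * Real.log C / Real.log 2 + 2
  have hK : 0 < K := by positivity
  refine ⟨C * K + x₀ / Real.log 2 + 1, by positivity, fun n hn ↦ ?_⟩
  have hn1 : (1 : ℝ) ≤ n := by exact_mod_cast hn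
  have hln : Real.log 2 ≤ Real.log (2 * n) := Real.log_le_log two_pos (by linarith)
  have hpos : 0 < n * Real.log (2 * n) := by nlinarith
  suffices hmain : (Nat.nth P (n - 1) : ℝ) ≤ (C * K + x₀ / Real.log 2) * (n * Real.log (2 * n)) by
    linarith
  set y := Nat.nth P (n - 1) with hy
  rcases le_total x₀ y with hxy | hxy
  · have hb := h y hxy
    rw [hy, Nat.count_nth_succ_of_infinite hinf, Nat.sub_add_cancel hn, ← hy] at hb
    have hsq : Real.log y ≤ K * Real.log (2 * n) := by
      rcases Nat.eq_zero_or_pos y with h0 | h0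
      · simp only [h0, Nat.cast_zero, Real.log_zero]
        exact mul_nonneg hK.le (by linarith)
      have hy0 : (0 : ℝ) < y := by exact_mod_cast h0
      have hs : 0 < √(y : ℝ) := Real.sqrt_pos.2 hy0
      have hss : √(y : ℝ) * √(y : ℝ) = y := Real.mul_self_sqrt hy0.le
      have hlog : Real.log y = 2 * Real.log √(y : ℝ) := by
        rw [Real.log_sqrt hy0.le]; ring
      have hls : Real.log √(y : ℝ) ≤ √(y : ℝ) := (Real.log_le_sub_one_of_pos hs).trans (by linarith)
      have h1 : √(y : ℝ) ≤ C * (2 * n) := by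
        refine le_of_mul_le_mul_right ?_ hs
        rw [hss]
        refine hb.trans ?_
        rw [hlog]
        calc C * n * (2 * Real.log √(y : ℝ)) ≤ C * n * (2 * √(y : ℝ)) := by gcongr
          _ = _ := by ring
      have h2 := Real.log_le_log hs h1
      rw [Real.log_mul (by linarith) (by linarith)] at h2
      have h3 : Real.log C ≤ Real.log C / Real.log 2 * Real.log (2 * n) := by
        rw [div_mul_eq_mul_div, le_div_iff₀ hl2]
        gcongr
      rw [hlog]
      calc 2 * Real.log √(y : ℝ)
          ≤ 2 * (Real.log C / Real.log 2 * Real.log (2 * n) + Real.log (2 * n)) := by linarith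
        _ = K * Real.log (2 * n) := by simp only [K]; ring
    calc (y : ℝ) ≤ C * n * Real.log y := hb
      _ ≤ C * n * (K * Real.log (2 * n)) := by gcongr
      _ = C * K * (n * Real.log (2 * n)) := by ring
      _ ≤ _ := by gcongr; linarith [div_nonneg (Nat.cast_nonneg (α := ℝ) x₀) hl2.le]
  · have h1 : (y : ℝ) ≤ x₀ := by exact_mod_cast hxy
    have h2 : (x₀ : ℝ) ≤ x₀ / Real.log 2 * (n * Real.log (2 * n)) := by
      rw [div_mul_eq_mul_div, le_div_iff₀ hl2]
      gcongr
      nlinarith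
    have h3 : 0 ≤ C * K * (n * Real.log (2 * n)) := by positivity
    linarith

/-- If `f` takes values in `{0, 1, -1}` and the twisted Mertens sum of `f` is bounded, then
the primes with `f p = 1` satisfy a Chebyshev-type lower bound. -/
theorem exists_le_mul_count_mul_log {f : ℕ → ℝ} {P : ℕ → Prop} [DecidablePred P] {K : ℝ} {b : ℕ}
    (hf : ∀ n, f n = 0 ∨ f n = 1 ∨ f n = -1)
    (hK : ∀ N : ℕ, |∑ n ∈ Ioc 0 N, f n * Λ n / n| ≤ K)
    (h₀ : ∀ p : ℕ, p.Prime → f p = 0 → p ≤ b) (h₁ : ∀ p : ℕ, p.Prime → f p = 1 → P p) :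
    ∃ C : ℝ, 1 ≤ C ∧ ∃ x₀ : ℕ, ∀ N : ℕ, x₀ ≤ N →
      (N : ℝ) ≤ C * Nat.count P (N + 1) * Real.log N := by
  obtain ⟨K', hK'⟩ := exists_abs_sum_vonMangoldt_div_sub_log_le
  obtain ⟨D, hD⟩ := Chebyshev.psi_sub_theta_le_mul_sqrt
  set R : ℝ := ∑ n ∈ Ioc 0 b, Λ n
  have hS (N : ℕ) (hN : 1 ≤ N) :
      |∑ n ∈ Ioc 0 N, (1 + f n) * Λ n / n - Real.log N| ≤ K + K' := by
    have : ∑ n ∈ Ioc 0 N, (1 + f n) * Λ n / n - Real.log N =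
        ∑ n ∈ Ioc 0 N, f n * Λ n / n + (∑ n ∈ Ioc 0 N, Λ n / n - Real.log N) := by
      rw [← add_sub_assoc, ← sum_add_distrib]
      congr 1
      exact sum_congr rfl fun n _ ↦ by ring
    rw [this]
    exact (abs_add_le _ _).trans (add_le_add (hK N) (hK' N hN))
  have hnn (n : ℕ) : 0 ≤ (1 + f n) * Λ n :=
    mul_nonneg (by rcases hf n with h | h | h <;> rw [h] <;> norm_num) vonMangoldt_nonneg
  obtain ⟨A, hA2, hA⟩ : ∃ A : ℕ, 2 ≤ A ∧ 2 * (K + K') + 2 ≤ Real.log A :=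
    ((eventually_ge_atTop 2).and ((Real.tendsto_log_atTop.comp
      tendsto_natCast_atTop_atTop).eventually_ge_atTop _)).exists
  have hA0 : (2 : ℝ) ≤ A := by exact_mod_cast hA2
  have hlow (M : ℕ) (hM : 1 ≤ M) : 2 * (M : ℝ) ≤ ∑ n ∈ Ioc 0 (A * M), (1 + f n) * Λ n := by
    have hM0 : (1 : ℝ) ≤ M := by exact_mod_cast hM
    have hMA : M ≤ A * M := Nat.le_mul_of_pos_left M (by omega)
    have e₁ := abs_le.1 (hS M hM)
    have e₂ := abs_le.1 (hS (A * M) (hM.trans hMA))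
    rw [← sum_Ioc_consecutive _ (Nat.zero_le M) hMA, Nat.cast_mul,
      Real.log_mul (by linarith) (by linarith)] at e₂
    have e₃ : ∑ n ∈ Ioc M (A * M), (1 + f n) * Λ n / n ≤
        (∑ n ∈ Ioc M (A * M), (1 + f n) * Λ n) / M := by
      rw [sum_div]
      refine sum_le_sum fun n hn ↦ ?_
      have : M ≤ n := (mem_Ioc.1 hn).1.le
      exact div_le_div_of_nonneg_left (hnn n) (by linarith) (by exact_mod_cast this)
    have e₄ : ∑ n ∈ Ioc M (A * M), (1 + f n) * Λ n ≤ ∑ n ∈ Ioc 0 (A * M), (1 + f n) * Λ n :=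
      sum_le_sum_of_subset_of_nonneg (Ioc_subset_Ioc_left (Nat.zero_le M)) fun n _ _ ↦ hnn n
    refine le_trans ?_ e₄
    rw [← le_div_iff₀ (by linarith)]
    linarith
  have hupp (X : ℕ) : ∑ n ∈ Ioc 0 X, (1 + f n) * Λ n ≤
      2 * (D * √(X : ℝ)) + R + 2 * Real.log X * Nat.count P (X + 1) := by
    have hpt : ∀ n ∈ Ioc 0 X, (1 + f n) * Λ n ≤ 2 * (if ¬ n.Prime then Λ n else 0) +
        (if n ≤ b then Λ n else 0) + (if P n then 2 * Real.log X else 0) := by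
      intro n hn
      obtain ⟨hn0, hnX⟩ := mem_Ioc.1 hn
      have hlogX : 0 ≤ Real.log X := Real.log_natCast_nonneg X
      have hΛ : 0 ≤ Λ n := vonMangoldt_nonneg
      have i₁ : 0 ≤ 2 * (if ¬ n.Prime then Λ n else 0) := by split_ifs <;> linarith
      have i₂ : 0 ≤ if n ≤ b then Λ n else 0 := by split_ifs <;> linarith
      have i₃ : 0 ≤ if P n then 2 * Real.log X else 0 := by split_ifs <;> linarith
      by_cases hp : n.Prime
      · rcases hf n with h | h | h
        · rw [if_pos (h₀ n hp h)] at i₂ ⊢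
          rw [h]; linarith
        · rw [if_pos (h₁ n hp h)] at i₃ ⊢
          have : Λ n ≤ Real.log X := vonMangoldt_le_log.trans
            (Real.log_le_log (by exact_mod_cast hn0) (by exact_mod_cast hnX))
          rw [h]; linarith
        · rw [h]; linarith
      · rw [if_pos hp] at i₁ ⊢
        have : (1 + f n) * Λ n ≤ 2 * Λ n := by
          gcongr
          rcases hf n with h | h | h <;> rw [h] <;> norm_num
        linarith
    refine (sum_le_sum hpt).trans ?_
    rw [sum_add_distrib, sum_add_distrib, ← mul_sum, ← sum_filter, ← sum_filter, ← sum_filter,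
      sum_const, nsmul_eq_mul]
    have hψ := hD X
    rw [Chebyshev.psi_sub_theta_eq_sum_not_prime, Nat.floor_natCast] at hψ
    have hR : ∑ n ∈ Ioc 0 X with n ≤ b, Λ n ≤ R :=
      sum_le_sum_of_subset_of_nonneg
        (fun n hn ↦ by simp only [Finset.mem_filter, mem_Ioc] at hn ⊢; omega)
        fun n _ _ ↦ vonMangoldt_nonneg
    have hcount : (#{n ∈ Ioc 0 X | P n} : ℝ) ≤ Nat.count P (X + 1) := by
      rw [Nat.count_eq_card_filter_range]
      exact_mod_cast card_le_card fun n hn ↦ by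
        simp only [Finset.mem_filter, mem_Ioc, mem_range] at hn ⊢
        exact ⟨by omega, hn.2⟩
    have := mul_le_mul_of_nonneg_right hcount
      (mul_nonneg zero_le_two (Real.log_natCast_nonneg X))
    linarith
  obtain ⟨M₀, hM₀⟩ := exists_nat_ge (4 * D ^ 2 * A + 2 * R)
  refine ⟨4 * A, by linarith, A * (M₀ + 1), fun N hN ↦ ?_⟩
  set M := N / A
  have hM : M₀ + 1 ≤ M := (Nat.le_div_iff_mul_le (by omega)).2 (by rwa [mul_comm])
  have hM1 : 1 ≤ M := by omega
  have hAM : A * M ≤ N := Nat.mul_div_le N A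
  have hNA : N ≤ 2 * A * M := by
    have h : N < A * (M + 1) := Nat.lt_mul_div_succ N (by omega)
    nlinarith
  have hMR : 4 * D ^ 2 * A + 2 * R ≤ M := hM₀.trans (by exact_mod_cast (by omega : M₀ ≤ M))
  have hsqrt : 2 * (D * √((A * M : ℕ) : ℝ)) ≤ 2 * D ^ 2 * A + M / 2 := by
    rw [Nat.cast_mul, Real.sqrt_mul (by positivity)]
    have s₁ := Real.sq_sqrt (show (0 : ℝ) ≤ A by positivity)
    have s₂ := Real.sq_sqrt (show (0 : ℝ) ≤ M by positivity)
    nlinarith [sq_nonneg (2 * D * √(A : ℝ) - √(M : ℝ))]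
  have hmain : (M : ℝ) ≤ 2 * Real.log (A * M : ℕ) * Nat.count P (A * M + 1) := by
    linarith [hlow M hM1, hupp (A * M)]
  have hAM0 : 0 < A * M := Nat.mul_pos (by omega) hM1
  have hlogle : Real.log (A * M : ℕ) ≤ Real.log N :=
    Real.log_le_log (by exact_mod_cast hAM0) (by exact_mod_cast hAM)
  have hcle : (Nat.count P (A * M + 1) : ℝ) ≤ Nat.count P (N + 1) := by
    exact_mod_cast Nat.count_monotone P (by omega)
  calc (N : ℝ) ≤ 2 * A * M := by exact_mod_cast hNA
    _ ≤ 2 * A * (2 * Real.log (A * M : ℕ) * Nat.count P (A * M + 1)) := by gcongr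
    _ ≤ 2 * A * (2 * Real.log N * Nat.count P (N + 1)) := by
      have := Real.log_natCast_nonneg N
      gcongr
    _ = _ := by ring

/-- The primes at which `n ↦ (-4a / n)` takes the value `1` satisfy a Chebyshev-type lower bound. -/
theorem exists_le_mul_count_mul_log_of_negQuadraticCharacter {a : ℕ} (ha : a ≠ 0) {P : ℕ → Prop}
    [DecidablePred P] (hP : ∀ p : ℕ, p.Prime → negQuadraticCharacter a ha p = 1 → P p) :
    ∃ C : ℝ, 1 ≤ C ∧ ∃ x₀ : ℕ, ∀ N : ℕ, x₀ ≤ N →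
      (N : ℝ) ≤ C * Nat.count P (N + 1) * Real.log N := by
  have : NeZero (4 * a) := ⟨by positivity⟩
  set f : ℕ → ℝ := fun n ↦ (negQuadraticCharacter a ha n : ℤ)
  let χ : DirichletCharacter ℂ (4 * a) :=
    (negQuadraticCharacter a ha).ringHomComp (Int.castRingHom ℂ)
  have hχf (n : ℕ) : χ n = f n := by
    simp [χ, f, MulChar.ringHomComp_apply]
  have hf (n : ℕ) : f n = 0 ∨ f n = 1 ∨ f n = -1 := by
    rcases negQuadraticCharacter_trichotomy ha n with h | h | h <;> simp [f, h]
  have hχ : χ ≠ 1 := by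
    intro h
    have h₁ := hχf (4 * a - 1)
    have h₂ : f (4 * a - 1) = -1 := by
      simp only [f, negQuadraticCharacter_sub_one ha, Int.cast_neg, Int.cast_one]
    rw [h₂, h] at h₁
    by_cases hu : IsUnit ((4 * a - 1 : ℕ) : ZMod (4 * a))
    · rw [MulChar.one_apply hu] at h₁
      norm_num at h₁
    · rw [MulChar.map_nonunit _ hu] at h₁
      norm_num at h₁
  have hsum (N : ℕ) : |∑ n ∈ range N, f n| ≤ (4 * a : ℕ) := by
    have h := DirichletCharacter.norm_sum_range_le hχ N
    simp only [hχf] at h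
    rwa [← Complex.ofReal_sum, Complex.norm_real, Real.norm_eq_abs] at h
  obtain ⟨l, hl⟩ := exists_abs_sum_div_sub_le hsum
  have hl₀ := DirichletCharacter.sum_div_limit_ne_zero hχ hχf (Nat.cast_nonneg _) hl
  obtain ⟨K, hK⟩ := exists_abs_sum_mul_vonMangoldt_div_le (f := f)
    (fun m n ↦ by simp only [f, Nat.cast_mul, map_mul, Int.cast_mul])
    (fun n ↦ by rcases hf n with h | h | h <;> rw [h] <;> norm_num)
    hl₀ (Nat.cast_nonneg _) hl (exists_abs_sum_log_div_le hsum)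
  refine exists_le_mul_count_mul_log (b := 4 * a) hf hK (fun p hp h ↦ ?_)
    fun p hp h ↦ hP p hp (Int.cast_eq_one.1 h)
  by_contra hpb
  have hu : IsUnit (p : ZMod (4 * a)) := by
    rw [ZMod.isUnit_iff_coprime, hp.coprime_iff_not_dvd]
    exact fun hd ↦ hpb (Nat.le_of_dvd (by positivity) hd)
  exact (hu.map (negQuadraticCharacter a ha)).ne_zero (Int.cast_eq_zero.1 h)

end

/-- Let `k` be an imaginary quadratic field.  There is a constant `c > 0` such that for
every `n ≥ 1` the `n`-th smallest odd rational prime split in `k` exists and is less than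
`c·n·log(2n)`. -/
theorem nth_odd_split_prime_bound
    (k : IntermediateField ℚ ℂ) [NumberField ↥k]
    (hquad : Module.finrank ℚ ↥k = 2)
    (himag : ¬ (k : Set ℂ) ⊆ Set.range (Complex.ofReal)) :
    ∃ c : ℝ, 0 < c ∧
      {q : ℕ | q.Prime ∧ q ≠ 2 ∧ RatPrimeSplitsIn k q}.Infinite ∧
      ∀ n : ℕ, 1 ≤ n →
        (Nat.nth (fun q : ℕ => q.Prime ∧ q ≠ 2 ∧ RatPrimeSplitsIn k q) (n - 1) : ℝ)
          < c * ((n : ℝ) * Real.log (2 * n)) := by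
  classical
  obtain ⟨a, ha, w, hw⟩ := exists_sq_eq_neg_natCast k hquad himag
  obtain ⟨C, hC, x₀, h⟩ := exists_le_mul_count_mul_log_of_negQuadraticCharacter ha
    (P := fun q : ℕ => q.Prime ∧ q ≠ 2 ∧ RatPrimeSplitsIn k q) fun p hp hp1 ↦ by
      obtain ⟨hp2, hpa, t, ht⟩ := exists_dvd_sq_add_of_negQuadraticCharacter_eq_one ha hp hp1
      exact ⟨hp, hp2, ratPrimeSplitsIn_of_dvd_sq_add hquad ha hw hp hp2 hpa ht⟩
  obtain ⟨c, hc, hlt⟩ := exists_nth_lt_of_le_mul_count_mul_log hC h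
  exact ⟨c, hc, infinite_setOf_of_le_mul_count_mul_log h, hlt⟩
end

section
/- Let n ≥ 0 and let q₁, …, q_{n+1} be pairwise distinct rational primes. Then there exists a constant c ≥ (3/π²)·(1/3^{n+1}) such that the number of imaginary quadratic fields k (counted up to isomorphism, equivalently counted by their discriminants) with |Δ_k| < x in which q₁, …, qₙ are all inert and q_{n+1} splits is asymptotic to c·x as x → ∞. -/
open NumberField

/-- The quadratic field `ℚ(√d) ⊂ ℂ`, realized by adjoining the square roots of `d`. -/
noncomputable def sqrtFieldC (d : ℤ) : IntermediateField ℚ ℂ :=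
  IntermediateField.adjoin ℚ {z : ℂ | z ^ 2 = (d : ℂ)}

/-- A rational prime `q` is *inert* in the number field `K ⊂ ℂ` if `q O_K` remains a
prime ideal of `O_K`. -/
def IsInertIn (K : IntermediateField ℚ ℂ) (q : ℕ) : Prop :=
  (Ideal.span {(q : 𝓞 ↥K)}).IsPrime

/-- A rational prime `q` *splits* in the number field `K ⊂ ℂ` if `q O_K` is a product of
two distinct prime ideals of `O_K`. -/
def SplitsInC (K : IntermediateField ℚ ℂ) (q : ℕ) : Prop :=
  ∃ P Q : Ideal (𝓞 ↥K), P ≠ Q ∧ P.IsPrime ∧ Q.IsPrime ∧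
    Ideal.span {(q : 𝓞 ↥K)} = P * Q

/-- `d ≡ 0, 1 (mod 4)`, and `d` is not of the form `s² d'` with `d' ≡ 0, 1 (mod 4)` and
`|s| > 1`. -/
def IsFundamental (d : ℤ) : Prop :=
  (d % 4 = 0 ∨ d % 4 = 1) ∧
    ∀ s d' : ℤ, d = s ^ 2 * d' → (d' % 4 = 0 ∨ d' % 4 = 1) → s ^ 2 = 1

lemma exists_four_mul_eq {d : ℤ} (hd : d % 4 = 0 ∨ d % 4 = 1) : ∃ s : ℤ, 4 * s = d - d ^ 2 := by
  refine ⟨(d - d ^ 2) / 4, Int.mul_ediv_cancel' ?_⟩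
  apply Int.dvd_of_emod_eq_zero
  rcases hd with h | h <;> simp [Int.sub_emod, pow_two, Int.mul_emod, h]

/-- The generator `(d + √d) / 2` of the order of discriminant `d`. -/
noncomputable def orderGen (d : ℤ) : ℂ := ⟨d / 2, Real.sqrt (-d) / 2⟩

lemma orderGen_mul_self {d s : ℤ} (hd : d < 0) (hs : 4 * s = d - d ^ 2) :
    orderGen d * orderGen d = s + d * orderGen d := by
  have h : (0 : ℝ) ≤ -d := by
    have : (d : ℝ) < 0 := by exact_mod_cast hd
    linarith
  have h2 : (4 * s : ℝ) = d - d ^ 2 := by exact_mod_cast hs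
  have h3 := Real.mul_self_sqrt h
  apply Complex.ext <;> simp [orderGen]
  · linarith
  · ring

lemma sqrtFieldC_eq_adjoin_orderGen {d : ℤ} (hd : d < 0) :
    sqrtFieldC d = IntermediateField.adjoin ℚ {orderGen d} := by
  have h : (0 : ℝ) ≤ -d := by
    have : (d : ℝ) < 0 := by exact_mod_cast hd
    linarith
  have h3 := Real.mul_self_sqrt h
  have hsq : (2 * orderGen d - d) ^ 2 = (d : ℂ) := by
    apply Complex.ext <;> simp [orderGen, pow_two]
    · linarith
    · ring
  apply le_antisymm
  · refine IntermediateField.adjoin_le_iff.2 fun z hz => ?_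
    have hmem : 2 * orderGen d - d ∈ IntermediateField.adjoin ℚ {orderGen d} :=
      sub_mem (mul_mem (ofNat_mem _ 2) (IntermediateField.mem_adjoin_simple_self _ _))
        (intCast_mem _ d)
    have : z ^ 2 = (2 * orderGen d - d) ^ 2 := by rw [hsq]; exact hz
    rcases sq_eq_sq_iff_eq_or_eq_neg.1 this with rfl | rfl
    · exact hmem
    · exact neg_mem hmem
  · refine IntermediateField.adjoin_le_iff.2 ?_
    rintro z rfl
    have hmem : 2 * orderGen d - d ∈ sqrtFieldC d := IntermediateField.subset_adjoin _ _ hsq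
    have : orderGen d = ((2 * orderGen d - d) + d) / 2 := by ring
    show orderGen d ∈ sqrtFieldC d
    rw [this]
    exact div_mem (add_mem hmem (intCast_mem _ d)) (ofNat_mem _ 2)

lemma isIntegral_orderGen {d s : ℤ} (hd : d < 0) (hs : 4 * s = d - d ^ 2) :
    IsIntegral ℤ (orderGen d) := by
  refine ⟨Polynomial.X ^ 2 - Polynomial.C d * Polynomial.X - Polynomial.C s, ?_, ?_⟩
  · monicity!
  · have := orderGen_mul_self hd hs
    simp only [Polynomial.eval₂_sub, Polynomial.eval₂_mul, Polynomial.eval₂_pow, Polynomial.eval₂_X,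
      Polynomial.eval₂_C]
    simp only [eq_intCast]
    linear_combination this

lemma orderGen_mem {d : ℤ} (hd : d < 0) : orderGen d ∈ sqrtFieldC d := by
  rw [sqrtFieldC_eq_adjoin_orderGen hd]
  exact IntermediateField.mem_adjoin_simple_self _ _

/-- The embedding into `ℂ` of the quadratic algebra over `ℚ` with the relation of `orderGen d`. -/
noncomputable def quadraticToComplex {d s : ℤ} (hd : d < 0) (hs : 4 * s = d - d ^ 2) :
    QuadraticAlgebra ℚ (s : ℚ) (d : ℚ) →ₐ[ℚ] ℂ :=
  QuadraticAlgebra.lift ⟨orderGen d, by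
    rw [orderGen_mul_self hd hs]; simp [Algebra.smul_def]⟩

lemma quadraticToComplex_apply {d s : ℤ} (hd : d < 0) (hs : 4 * s = d - d ^ 2)
    (z : QuadraticAlgebra ℚ (s : ℚ) (d : ℚ)) :
    quadraticToComplex hd hs z = z.re + z.im * orderGen d := by
  simp [quadraticToComplex, Algebra.smul_def]

lemma rat_add_mul_orderGen_eq_zero {d : ℤ} (hd : d < 0) {x y : ℚ}
    (h : (x : ℂ) + y * orderGen d = 0) : x = 0 ∧ y = 0 := by
  have hpos : 0 < Real.sqrt (-d) := Real.sqrt_pos.2 (by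
    have : (d : ℝ) < 0 := by exact_mod_cast hd
    linarith)
  have him := congrArg Complex.im h
  simp [orderGen, hpos.ne'] at him
  subst him
  simpa using h

lemma quadraticToComplex_injective {d s : ℤ} (hd : d < 0) (hs : 4 * s = d - d ^ 2) :
    Function.Injective (quadraticToComplex hd hs) := by
  rw [injective_iff_map_eq_zero]
  intro z hz
  rw [quadraticToComplex_apply] at hz
  obtain ⟨h1, h2⟩ := rat_add_mul_orderGen_eq_zero hd hz
  exact QuadraticAlgebra.ext h1 h2

lemma quadraticToComplex_range {d s : ℤ} (hd : d < 0) (hs : 4 * s = d - d ^ 2) :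
    (quadraticToComplex hd hs).range = (sqrtFieldC d).toSubalgebra := by
  rw [sqrtFieldC_eq_adjoin_orderGen hd, IntermediateField.adjoin_simple_toSubalgebra_of_isAlgebraic
    ((isIntegral_orderGen hd hs).tower_top (A := ℚ)).isAlgebraic]
  apply le_antisymm
  · rintro _ ⟨z, rfl⟩
    simp only [AlgHom.toRingHom_eq_coe, RingHom.coe_coe]
    rw [quadraticToComplex_apply]
    exact add_mem (Subalgebra.algebraMap_mem _ z.re) (mul_mem (Subalgebra.algebraMap_mem _ z.im)
      (Algebra.self_mem_adjoin_singleton _ _))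
  · refine Algebra.adjoin_le ?_
    rintro _ rfl
    exact ⟨QuadraticAlgebra.omega, by simp [quadraticToComplex_apply]⟩

/-- The field `ℚ(√d)` as a quadratic algebra over `ℚ`. -/
noncomputable def quadraticEquivSqrtField {d s : ℤ} (hd : d < 0) (hs : 4 * s = d - d ^ 2) :
    QuadraticAlgebra ℚ (s : ℚ) (d : ℚ) ≃ₗ[ℚ] sqrtFieldC d :=
  ((AlgEquiv.ofInjective _ (quadraticToComplex_injective hd hs)).trans
    (Subalgebra.equivOfEq _ _ (quadraticToComplex_range hd hs))).toLinearEquiv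

lemma finrank_sqrtFieldC {d s : ℤ} (hd : d < 0) (hs : 4 * s = d - d ^ 2) :
    Module.finrank ℚ (sqrtFieldC d) = 2 := by
  rw [← (quadraticEquivSqrtField hd hs).finrank_eq, QuadraticAlgebra.finrank_eq_two]

lemma numberField_sqrtFieldC {d s : ℤ} (hd : d < 0) (hs : 4 * s = d - d ^ 2) :
    NumberField (sqrtFieldC d) where
  to_charZero := inferInstance
  to_finiteDimensional := Module.Finite.equiv (quadraticEquivSqrtField hd hs)

lemma exists_rat_of_mem {d s : ℤ} (hd : d < 0) (hs : 4 * s = d - d ^ 2) {z : ℂ}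
    (hz : z ∈ sqrtFieldC d) : ∃ x y : ℚ, z = x + y * orderGen d := by
  have : z ∈ (quadraticToComplex hd hs).range := by
    rw [quadraticToComplex_range]; exact hz
  obtain ⟨w, rfl⟩ := this
  exact ⟨w.re, w.im, quadraticToComplex_apply _ _ _⟩

/-- The generator `(d + √d) / 2`, as an algebraic integer of `ℚ(√d)`. -/
noncomputable def orderGenInt {d s : ℤ} (hd : d < 0) (hs : 4 * s = d - d ^ 2) :
    𝓞 (sqrtFieldC d) :=
  ⟨⟨orderGen d, orderGen_mem hd⟩,
    (isIntegral_algebraMap_iff (A := sqrtFieldC d) (B := ℂ)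
      (algebraMap (sqrtFieldC d) ℂ).injective).1 (isIntegral_orderGen hd hs)⟩

/-- The inclusion of the ring of integers of `ℚ(√d)` into `ℂ`. -/
noncomputable def integersToComplex (d : ℤ) : 𝓞 (sqrtFieldC d) →+* ℂ :=
  (algebraMap (sqrtFieldC d) ℂ).comp (algebraMap (𝓞 (sqrtFieldC d)) (sqrtFieldC d))

lemma integersToComplex_injective (d : ℤ) : Function.Injective (integersToComplex d) :=
  (algebraMap (sqrtFieldC d) ℂ).injective.comp RingOfIntegers.coe_injective

lemma integersToComplex_orderGenInt {d s : ℤ} (hd : d < 0) (hs : 4 * s = d - d ^ 2) :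
    integersToComplex d (orderGenInt hd hs) = orderGen d := rfl

/-- The map from the order of discriminant `d` to the ring of integers of `ℚ(√d)`. -/
noncomputable def orderHom {d s : ℤ} (hd : d < 0) (hs : 4 * s = d - d ^ 2) :
    QuadraticAlgebra ℤ s d →ₐ[ℤ] 𝓞 (sqrtFieldC d) :=
  QuadraticAlgebra.lift ⟨orderGenInt hd hs, by
    apply integersToComplex_injective
    simp [integersToComplex_orderGenInt, orderGen_mul_self hd hs]⟩

lemma integersToComplex_orderHom {d s : ℤ} (hd : d < 0) (hs : 4 * s = d - d ^ 2)
    (z : QuadraticAlgebra ℤ s d) :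
    integersToComplex d (orderHom hd hs z) = z.re + z.im * orderGen d := by
  simp [orderHom, integersToComplex_orderGenInt]

lemma orderHom_injective {d s : ℤ} (hd : d < 0) (hs : 4 * s = d - d ^ 2) :
    Function.Injective (orderHom hd hs) := by
  rw [injective_iff_map_eq_zero]
  intro z hz
  have h := integersToComplex_orderHom hd hs z
  rw [hz, map_zero] at h
  obtain ⟨h1, h2⟩ := rat_add_mul_orderGen_eq_zero hd (x := z.re) (y := z.im) (by
    push_cast; exact h.symm)
  exact QuadraticAlgebra.ext (by exact_mod_cast h1) (by exact_mod_cast h2)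

lemma exists_int_of_isIntegral_ratCast {x : ℚ} (h : IsIntegral ℤ (x : ℂ)) : ∃ m : ℤ, x = m := by
  have h' : IsIntegral ℤ x :=
    (isIntegral_algebraMap_iff (A := ℚ) (B := ℂ) (algebraMap ℚ ℂ).injective).1 (by simpa using h)
  obtain ⟨m, hm⟩ := IsIntegrallyClosed.isIntegral_iff.1 h'
  exact ⟨m, by simpa using hm.symm⟩

lemma IsFundamental.den_eq_one {d : ℤ} (hd : IsFundamental d) {b : ℚ} {e : ℤ}
    (he : e % 4 = 0 ∨ e % 4 = 1) (h : b ^ 2 * d = e) : b.den = 1 := by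
  have hden : (b.den : ℚ) ≠ 0 := by exact_mod_cast b.den_ne_zero
  have h1 : b.num ^ 2 * d = b.den ^ 2 * e := by
    have : (b.num : ℚ) ^ 2 * d = b.den ^ 2 * e := by
      rw [← h, ← mul_assoc, ← mul_pow, Rat.den_mul_eq_num]
    exact_mod_cast this
  have hcop : IsCoprime ((b.den : ℤ) ^ 2) (b.num ^ 2) := by
    have := b.reduced
    exact (Int.isCoprime_iff_gcd_eq_one.2 (by simpa [Int.gcd, Nat.coprime_comm] using this)).pow
  obtain ⟨d', hd'⟩ : (b.den : ℤ) ^ 2 ∣ d :=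
    hcop.dvd_of_dvd_mul_left ⟨e, h1⟩
  have hne : (b.den : ℤ) ^ 2 ≠ 0 := by simp
  have he' : b.num ^ 2 * d' = e := by
    apply mul_left_cancel₀ hne
    rw [← h1, hd']; ring
  have hd'4 : d' % 4 = 0 ∨ d' % 4 = 1 := by
    have hodd : (b.den : ℤ) % 2 = 1 ∨ b.num % 2 = 1 := by
      by_contra! hcon
      have h2 : (2 : ℤ) ∣ b.den := by omega
      have h3 : (2 : ℤ) ∣ b.num := by omega
      have :=
        (Int.isCoprime_iff_gcd_eq_one.1 (IsCoprime.pow_iff (by norm_num) (by norm_num) |>.1 hcop))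
      have h4 := Int.dvd_coe_gcd h2 h3
      rw [this] at h4
      norm_num at h4
    have key : ∀ t : ℤ, t % 2 = 1 → (t ^ 2 * d') % 4 = d' % 4 := by
      intro t ht
      have : t ^ 2 % 4 = 1 := by
        have : t % 4 = 1 ∨ t % 4 = 3 := by omega
        rcases this with h | h <;> simp [pow_two, Int.mul_emod, h]
      rw [Int.mul_emod, this, one_mul, Int.emod_emod_of_dvd _ (dvd_refl _)]
    rcases hodd with h | h
    · rw [← key _ h, ← hd']; exact hd.1
    · rw [← key _ h, he']; exact he
  have := hd.2 b.den d' hd' hd'4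
  have h5 : (b.den : ℤ) = 1 := by
    exact (pow_eq_one_iff_of_nonneg (by positivity) two_ne_zero).1 this
  exact_mod_cast h5

lemma IsFundamental.orderHom_surjective {d s : ℤ} (hf : IsFundamental d) (hd : d < 0)
    (hs : 4 * s = d - d ^ 2) : Function.Surjective (orderHom hd hs) := by
  intro w
  obtain ⟨x, y, hxy⟩ := exists_rat_of_mem hd hs (w : sqrtFieldC d).2
  have hsQ : (4 * s : ℚ) = d - d ^ 2 := by exact_mod_cast hs
  have hw : IsIntegral ℤ (integersToComplex d w) := w.isIntegral.map (integersToComplex d).toIntAlgHom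
  have hwxy : integersToComplex d w = x + y * orderGen d := hxy
  rw [hwxy] at hw
  have hc : IsIntegral ℤ ((starRingEnd ℂ) (x + y * orderGen d)) :=
    hw.map ((starRingEnd ℂ).toIntAlgHom)
  have hstar : (starRingEnd ℂ) (x + y * orderGen d) = x + y * (d - orderGen d) := by
    have : (starRingEnd ℂ) (orderGen d) = d - orderGen d := by
      apply Complex.ext <;> simp [orderGen]
      ring
    rw [map_add, map_mul, this]
    simp
  rw [hstar] at hc
  obtain ⟨T, hT⟩ := exists_int_of_isIntegral_ratCast (x := 2 * x + d * y) (by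
    have e : ((2 * x + d * y : ℚ) : ℂ) = (x + y * orderGen d) + (x + y * (d - orderGen d)) := by
      push_cast; ring
    rw [e]
    exact hw.add hc)
  obtain ⟨N, hN⟩ := exists_int_of_isIntegral_ratCast (x := x ^ 2 + d * x * y - s * y ^ 2) (by
    have e : ((x ^ 2 + d * x * y - s * y ^ 2 : ℚ) : ℂ) =
        (x + y * orderGen d) * (x + y * (d - orderGen d)) := by
      push_cast
      linear_combination (y : ℂ) ^ 2 * orderGen_mul_self hd hs
    rw [e]
    exact hw.mul hc)
  have hy : y.den = 1 := by
    refine hf.den_eq_one (e := T ^ 2 - 4 * N) ?_ ?_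
    · have : T ^ 2 % 4 = 0 ∨ T ^ 2 % 4 = 1 := by
        have : T % 4 = 0 ∨ T % 4 = 1 ∨ T % 4 = 2 ∨ T % 4 = 3 := by omega
        rcases this with h | h | h | h <;> simp [pow_two, Int.mul_emod, h]
      omega
    · push_cast
      rw [← hT, ← hN]
      linear_combination -y ^ 2 * hsQ
  obtain ⟨v, rfl⟩ : ∃ v : ℤ, y = v := ⟨y.num, (Rat.den_eq_one_iff y |>.1 hy).symm⟩
  obtain ⟨u, rfl⟩ := exists_int_of_isIntegral_ratCast (x := x) (by
    have h2 : IsIntegral ℤ ((v : ℂ) * orderGen d) :=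
      (isIntegral_algebraMap (R := ℤ) (x := v)).mul (isIntegral_orderGen hd hs)
    have h3 := hw.sub h2
    simpa using h3)
  refine ⟨⟨u, v⟩, integersToComplex_injective d ?_⟩
  rw [integersToComplex_orderHom, hwxy]
  simp

/-- For a fundamental discriminant `d < 0`, the ring of integers of `ℚ(√d)` is the order of
discriminant `d`. -/
noncomputable def IsFundamental.orderEquiv {d s : ℤ} (hf : IsFundamental d) (hd : d < 0)
    (hs : 4 * s = d - d ^ 2) : QuadraticAlgebra ℤ s d ≃ₐ[ℤ] 𝓞 (sqrtFieldC d) :=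
  AlgEquiv.ofBijective (orderHom hd hs) ⟨orderHom_injective hd hs, hf.orderHom_surjective hd hs⟩

lemma QuadraticAlgebra.trace_eq_algebra_trace {R : Type*} [CommRing R] {a b : R}
    (z : QuadraticAlgebra R a b) : Algebra.trace R _ z = z.trace := by
  rw [Algebra.trace_eq_matrix_trace (QuadraticAlgebra.basis a b), Matrix.trace_fin_two,
    Algebra.leftMulMatrix_eq_repr_mul, Algebra.leftMulMatrix_eq_repr_mul]
  have h0 : QuadraticAlgebra.basis a b 0 = 1 := by
    apply (QuadraticAlgebra.basis a b).repr.injective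
    ext i
    fin_cases i <;> simp
  have h1 : QuadraticAlgebra.basis a b 1 = QuadraticAlgebra.omega := by
    apply (QuadraticAlgebra.basis a b).repr.injective
    ext i
    fin_cases i <;> simp
  rw [h0, h1]
  simp [QuadraticAlgebra.trace_def]
  ring

lemma QuadraticAlgebra.discr_basis {R : Type*} [CommRing R] (a b : R) :
    Algebra.discr R (QuadraticAlgebra.basis a b) = b ^ 2 + 4 * a := by
  have h0 : QuadraticAlgebra.basis a b 0 = 1 := by
    apply (QuadraticAlgebra.basis a b).repr.injective
    ext i
    fin_cases i <;> simp
  have h1 : QuadraticAlgebra.basis a b 1 = QuadraticAlgebra.omega := by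
    apply (QuadraticAlgebra.basis a b).repr.injective
    ext i
    fin_cases i <;> simp
  rw [Algebra.discr_def, Matrix.det_fin_two]
  simp only [Algebra.traceMatrix_apply, Algebra.traceForm_apply, h0, h1,
    QuadraticAlgebra.trace_eq_algebra_trace]
  simp [QuadraticAlgebra.trace_def]
  ring

lemma IsFundamental.discr_eq {d : ℤ} (hf : IsFundamental d) (hd : d < 0)
    [NumberField (sqrtFieldC d)] : NumberField.discr (sqrtFieldC d) = d := by
  obtain ⟨s, hs⟩ := exists_four_mul_eq hf.1
  rw [← NumberField.discr_eq_discr _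
    ((QuadraticAlgebra.basis s d).map (hf.orderEquiv hd hs).toLinearEquiv)]
  have := Algebra.discr_eq_discr_of_algEquiv (QuadraticAlgebra.basis s d) (hf.orderEquiv hd hs)
  rw [QuadraticAlgebra.discr_basis] at this
  have h2 : d ^ 2 + 4 * s = d := by linear_combination hs
  rw [h2] at this
  exact this.symm

lemma sqrtFieldC_sq_mul {t : ℤ} (ht : t ≠ 0) (d : ℤ) : sqrtFieldC (t ^ 2 * d) = sqrtFieldC d := by
  have htC : (t : ℂ) ≠ 0 := by exact_mod_cast ht
  apply le_antisymm <;> refine IntermediateField.adjoin_le_iff.2 fun z (hz : z ^ 2 = _) => ?_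
  · have hmem : z / t ∈ sqrtFieldC d := by
      refine IntermediateField.subset_adjoin _ _ ?_
      show (z / t) ^ 2 = d
      rw [div_pow, hz]; push_cast; field_simp
    have : z = z / t * t := by field_simp
    rw [this]
    exact mul_mem hmem (intCast_mem _ t)
  · have hmem : t * z ∈ sqrtFieldC (t ^ 2 * d) := by
      refine IntermediateField.subset_adjoin _ _ ?_
      show (t * z) ^ 2 = _
      rw [mul_pow, hz]; push_cast; rfl
    have : z = t * z / t := by field_simp
    rw [this]
    exact div_mem hmem (intCast_mem _ t)

lemma exists_isFundamental {d : ℤ} (hd : d ≠ 0) (h4 : d % 4 = 0 ∨ d % 4 = 1) :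
    ∃ t d' : ℤ, d = t ^ 2 * d' ∧ IsFundamental d' := by
  induction hn : d.natAbs using Nat.strong_induction_on generalizing d with
  | _ n ih =>
    by_cases hf : IsFundamental d
    · exact ⟨1, d, by simp, hf⟩
    · simp only [IsFundamental, h4, true_and, not_forall] at hf
      obtain ⟨t, d', hdt, hd4, ht⟩ := hf
      have hd' : d' ≠ 0 := by rintro rfl; simp at hdt; exact hd hdt
      have ht0 : t ≠ 0 := by rintro rfl; simp at hdt; exact hd hdt
      have hlt : d'.natAbs < n := by
        rw [← hn, hdt, Int.natAbs_mul]
        have h1 : 1 < (t ^ 2).natAbs := by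
          have : 0 < t ^ 2 := by positivity
          omega
        have h2 : 0 < d'.natAbs := Int.natAbs_pos.2 hd'
        nlinarith
      obtain ⟨r, D, hD, hDf⟩ := ih _ hlt hd' hd4 rfl
      exact ⟨t * r, D, by rw [hdt, hD]; ring, hDf⟩

lemma isFundamental_of_discr_eq {d : ℤ} (hd : d < 0) [NumberField (sqrtFieldC d)]
    (h : NumberField.discr (sqrtFieldC d) = d) : IsFundamental d := by
  obtain ⟨t, D, hD, hf⟩ := exists_isFundamental (d := 2 ^ 2 * d) (by omega) (by omega)
  have ht : t ≠ 0 := by rintro rfl; omega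
  have hDneg : D < 0 := by
    have : 0 < t ^ 2 := by positivity
    nlinarith
  have hK : sqrtFieldC d = sqrtFieldC D := by
    rw [← sqrtFieldC_sq_mul two_ne_zero d, hD, sqrtFieldC_sq_mul ht]
  have : NumberField (sqrtFieldC D) := hK ▸ ‹NumberField (sqrtFieldC d)›
  have h2 : NumberField.discr (sqrtFieldC d) = NumberField.discr (sqrtFieldC D) :=
    NumberField.discr_eq_discr_of_algEquiv _ (IntermediateField.equivOfEq hK)
  rw [h, hf.discr_eq hDneg] at h2
  rwa [h2]

/-- `q R` is a product of two distinct prime ideals of `R`. -/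
def IsSplitInRing (R : Type*) [CommRing R] (q : ℕ) : Prop :=
  ∃ P Q : Ideal R, P ≠ Q ∧ P.IsPrime ∧ Q.IsPrime ∧ Ideal.span {(q : R)} = P * Q

lemma isPrime_span_natCast_of_ringEquiv {R S : Type*} [CommRing R] [CommRing S] (e : R ≃+* S)
    {q : ℕ} (h : (Ideal.span {(q : R)}).IsPrime) : (Ideal.span {(q : S)}).IsPrime := by
  have := Ideal.map_isPrime_of_equiv e (I := Ideal.span {(q : R)})
  simpa [Ideal.map_span] using this

lemma IsSplitInRing.of_ringEquiv {R S : Type*} [CommRing R] [CommRing S] (e : R ≃+* S)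
    {q : ℕ} (h : IsSplitInRing R q) : IsSplitInRing S q := by
  obtain ⟨P, Q, hne, hP, hQ, h⟩ := h
  refine ⟨P.map e, Q.map e, fun hPQ => hne ?_, Ideal.map_isPrime_of_equiv e,
    Ideal.map_isPrime_of_equiv e, ?_⟩
  · exact e.idealComapOrderIso.symm.injective (by simpa using hPQ)
  · rw [← Ideal.map_mul, ← h]
    simp [Ideal.map_span]

namespace QuadraticAlgebra

variable {s d : ℤ} {q : ℕ}

lemma mem_span_natCast {x : QuadraticAlgebra ℤ s d} :
    x ∈ Ideal.span {(q : QuadraticAlgebra ℤ s d)} ↔ (q : ℤ) ∣ x.re ∧ (q : ℤ) ∣ x.im := by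
  rw [Ideal.mem_span_singleton]
  constructor
  · rintro ⟨y, rfl⟩
    simp
  · rintro ⟨⟨u, hu⟩, ⟨v, hv⟩⟩
    exact ⟨⟨u, v⟩, by ext <;> simp [hu, hv]⟩

/-- Evaluation at a root modulo `q` of the polynomial `X² - d X - s`. -/
noncomputable def evalRoot {a : ℤ} (ha : (q : ℤ) ∣ a ^ 2 - d * a - s) :
    QuadraticAlgebra ℤ s d →ₐ[ℤ] ZMod q :=
  lift ⟨(a : ZMod q), by
    have := (ZMod.intCast_zmod_eq_zero_iff_dvd _ q).2 ha
    push_cast at this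
    simp
    linear_combination this⟩

lemma mem_ker_evalRoot {a : ℤ} (ha : (q : ℤ) ∣ a ^ 2 - d * a - s)
    {x : QuadraticAlgebra ℤ s d} :
    x ∈ RingHom.ker (evalRoot ha) ↔ (q : ℤ) ∣ x.re + x.im * a := by
  rw [RingHom.mem_ker, ← ZMod.intCast_zmod_eq_zero_iff_dvd]
  simp [evalRoot]

lemma isMaximal_ker_evalRoot [Fact q.Prime] {a : ℤ} (ha : (q : ℤ) ∣ a ^ 2 - d * a - s) :
    (RingHom.ker (evalRoot ha)).IsMaximal :=
  RingHom.ker_isMaximal_of_surjective _ fun z => by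
    obtain ⟨n, rfl⟩ := ZMod.intCast_surjective z
    exact ⟨n, map_intCast _ _⟩

lemma isPrime_span_natCast_iff (hq : q.Prime) :
    (Ideal.span {(q : QuadraticAlgebra ℤ s d)}).IsPrime ↔
      ∀ a : ℤ, ¬ (q : ℤ) ∣ a ^ 2 - d * a - s := by
  have hqZ : Prime (q : ℤ) := Nat.prime_iff_prime_int.1 hq
  constructor
  · intro hP a ha
    have hmem : (⟨-a, 1⟩ * ⟨a - d, 1⟩ : QuadraticAlgebra ℤ s d) ∈
        Ideal.span {(q : QuadraticAlgebra ℤ s d)} := by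
      rw [mem_span_natCast]
      constructor
      · have : (⟨-a, 1⟩ * ⟨a - d, 1⟩ : QuadraticAlgebra ℤ s d).re = -(a ^ 2 - d * a - s) := by
          simp; ring
        rw [this]
        exact (dvd_neg).2 ha
      · have : (⟨-a, 1⟩ * ⟨a - d, 1⟩ : QuadraticAlgebra ℤ s d).im = 0 := by
          simp; ring
        rw [this]
        exact dvd_zero _
    rcases hP.mem_or_mem hmem with h | h <;>
    · have := (mem_span_natCast.1 h).2
      exact hqZ.not_dvd_one this
  · intro hroot
    have key : ∀ x : QuadraticAlgebra ℤ s d, (q : ℤ) ∣ x.norm →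
        x ∈ Ideal.span {(q : QuadraticAlgebra ℤ s d)} := by
      intro x hx
      rw [norm_def] at hx
      have him : (q : ℤ) ∣ x.im := by
        by_contra hnd
        obtain ⟨v, w, hvw⟩ := (hqZ.coprime_iff_not_dvd.2 hnd)
        apply hroot (-x.re * w)
        obtain ⟨k, hk⟩ := hx
        refine ⟨k * w ^ 2 + v * (d * x.re * w - s * (1 + w * x.im)), ?_⟩
        linear_combination w ^ 2 * hk + (s * (1 + w * x.im) - d * x.re * w) * hvw
      refine mem_span_natCast.2 ⟨hqZ.dvd_of_dvd_pow (n := 2) ?_, him⟩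
      have : x.re ^ 2 = (x.re * x.re + d * x.re * x.im - s * x.im * x.im) -
        x.im * (d * x.re - s * x.im) := by ring
      rw [this]
      exact dvd_sub hx (him.mul_right _)
    refine ⟨fun htop => ?_, fun {x y} hxy => ?_⟩
    · have : (1 : QuadraticAlgebra ℤ s d) ∈ Ideal.span {(q : QuadraticAlgebra ℤ s d)} := by
        rw [htop]; trivial
      exact hqZ.not_dvd_one (mem_span_natCast.1 this).1
    · have hdvd : (q : ℤ) ∣ x.norm * y.norm := by
        obtain ⟨z, hz⟩ := Ideal.mem_span_singleton.1 hxy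
        rw [← map_mul, hz, map_mul, norm_natCast, pow_two, mul_assoc]
        exact dvd_mul_right _ _
      exact (hqZ.dvd_or_dvd hdvd).imp (key x) (key y)

lemma not_isSplitInRing_of_isPrime (hq : q.Prime)
    (h : (Ideal.span {(q : QuadraticAlgebra ℤ s d)}).IsPrime) :
    ¬ IsSplitInRing (QuadraticAlgebra ℤ s d) q := by
  rintro ⟨P, Q, hne, hP, hQ, hPQ⟩
  have key : ∀ P Q : Ideal (QuadraticAlgebra ℤ s d), Q.IsPrime →
      Ideal.span {(q : QuadraticAlgebra ℤ s d)} = P * Q →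
      ¬ P ≤ Ideal.span {(q : QuadraticAlgebra ℤ s d)} := by
    intro P Q hQ hPQ hle
    have h1 : P = Ideal.span {(q : QuadraticAlgebra ℤ s d)} :=
      le_antisymm hle (hPQ ▸ Ideal.mul_le_left)
    have h2 : (q : QuadraticAlgebra ℤ s d) ∈ Ideal.span {(q : QuadraticAlgebra ℤ s d)} * Q := by
      rw [← h1, ← hPQ]
      exact Ideal.mem_span_singleton_self _
    obtain ⟨y, hy, hqy⟩ := Ideal.mem_span_singleton_mul.1 h2
    have hre := congrArg re hqy
    have him := congrArg im hqy
    simp [hq.ne_zero] at hre him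
    have : y = 1 := by ext <;> simp [hre, him]
    exact hQ.ne_top ((Ideal.eq_top_iff_one _).2 (this ▸ hy))
  rcases h.mul_le.1 hPQ.ge with h' | h'
  · exact key P Q hQ hPQ h'
  · exact key Q P hP (by rw [hPQ, mul_comm]) h'

lemma isSplitInRing_iff (hq : q.Prime) :
    IsSplitInRing (QuadraticAlgebra ℤ s d) q ↔
      ∃ a : ℤ, (q : ℤ) ∣ a ^ 2 - d * a - s ∧ ¬ (q : ℤ) ∣ 2 * a - d := by
  have : Fact q.Prime := ⟨hq⟩
  have hqZ : Prime (q : ℤ) := Nat.prime_iff_prime_int.1 hq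
  constructor
  · intro hsplit
    by_contra! hcon
    by_cases hroot : ∀ a : ℤ, ¬ (q : ℤ) ∣ a ^ 2 - d * a - s
    · exact not_isSplitInRing_of_isPrime hq ((isPrime_span_natCast_iff hq).2 hroot) hsplit
    push Not at hroot
    obtain ⟨a, ha⟩ := hroot
    have had := hcon a ha
    obtain ⟨P, Q, hne, hP, hQ, hPQ⟩ := hsplit
    have hsq : (⟨-a, 1⟩ * ⟨-a, 1⟩ : QuadraticAlgebra ℤ s d) ∈
        Ideal.span {(q : QuadraticAlgebra ℤ s d)} := by
      rw [mem_span_natCast]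
      constructor
      · have : (⟨-a, 1⟩ * ⟨-a, 1⟩ : QuadraticAlgebra ℤ s d).re =
            a * (2 * a - d) - (a ^ 2 - d * a - s) := by
          simp; ring
        rw [this]
        exact dvd_sub (had.mul_left _) ha
      · have : (⟨-a, 1⟩ * ⟨-a, 1⟩ : QuadraticAlgebra ℤ s d).im = -(2 * a - d) := by
          simp; ring
        rw [this]
        exact (dvd_neg).2 had
    have key : ∀ I : Ideal (QuadraticAlgebra ℤ s d), I.IsPrime →
        Ideal.span {(q : QuadraticAlgebra ℤ s d)} ≤ I → RingHom.ker (evalRoot ha) = I := by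
      intro I hI hle
      refine (isMaximal_ker_evalRoot ha).eq_of_le hI.ne_top fun x hx => ?_
      have hω : (⟨-a, 1⟩ : QuadraticAlgebra ℤ s d) ∈ I := (hI.mem_or_mem (hle hsq)).elim id id
      have hc : (⟨x.re + x.im * a, 0⟩ : QuadraticAlgebra ℤ s d) ∈ I :=
        hle (mem_span_natCast.2 ⟨(mem_ker_evalRoot ha).1 hx, dvd_zero _⟩)
      have : x = ⟨x.re + x.im * a, 0⟩ + ⟨x.im, 0⟩ * ⟨-a, 1⟩ := by ext <;> simp
      rw [this]
      exact add_mem hc (I.mul_mem_left _ hω)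
    exact hne ((key P hP (hPQ ▸ Ideal.mul_le_left)).symm.trans
      (key Q hQ (hPQ ▸ Ideal.mul_le_right)))
  · rintro ⟨a, ha, had⟩
    have ha' : (q : ℤ) ∣ (d - a) ^ 2 - d * (d - a) - s := by
      have : (d - a) ^ 2 - d * (d - a) - s = a ^ 2 - d * a - s := by ring
      rwa [this]
    have hne : RingHom.ker (evalRoot ha) ≠ RingHom.ker (evalRoot ha') := by
      intro h
      have hmem : (⟨-a, 1⟩ : QuadraticAlgebra ℤ s d) ∈ RingHom.ker (evalRoot ha) := by
        rw [mem_ker_evalRoot]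
        simp
      rw [h, mem_ker_evalRoot] at hmem
      apply had
      have : 2 * a - d = -(-a + 1 * (d - a)) := by ring
      rw [this]
      exact (dvd_neg).2 hmem
    have h1 := isMaximal_ker_evalRoot ha
    have h2 := isMaximal_ker_evalRoot ha'
    refine ⟨_, _, hne, h1.isPrime, h2.isPrime, ?_⟩
    rw [Ideal.mul_eq_inf_of_isCoprime (Ideal.isCoprime_iff_sup_eq.2 (h1.coprime_of_ne h2 hne))]
    ext x
    rw [Ideal.mem_inf, mem_span_natCast, mem_ker_evalRoot, mem_ker_evalRoot]
    constructor
    · rintro ⟨hr, hi⟩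
      exact ⟨dvd_add hr (hi.mul_right _), dvd_add hr (hi.mul_right _)⟩
    · rintro ⟨hr, hi⟩
      have him : (q : ℤ) ∣ x.im := by
        have : (q : ℤ) ∣ (2 * a - d) * x.im := by
          have e : (2 * a - d) * x.im = (x.re + x.im * a) - (x.re + x.im * (d - a)) := by ring
          rw [e]
          exact dvd_sub hr hi
        exact (hqZ.dvd_or_dvd this).resolve_left had
      exact ⟨(dvd_add_left (him.mul_right _)).1 hr, him⟩

end QuadraticAlgebra

lemma IsFundamental.isInertIn_iff {d s : ℤ} (hf : IsFundamental d) (hd : d < 0)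
    (hs : 4 * s = d - d ^ 2) {q : ℕ} (hq : q.Prime) :
    IsInertIn (sqrtFieldC d) q ↔ ∀ a : ℤ, ¬ (q : ℤ) ∣ a ^ 2 - d * a - s := by
  rw [← QuadraticAlgebra.isPrime_span_natCast_iff hq]
  have e := (hf.orderEquiv hd hs).toRingEquiv
  exact ⟨fun h => isPrime_span_natCast_of_ringEquiv e.symm h,
    fun h => isPrime_span_natCast_of_ringEquiv e h⟩

lemma IsFundamental.splitsInC_iff {d s : ℤ} (hf : IsFundamental d) (hd : d < 0)
    (hs : 4 * s = d - d ^ 2) {q : ℕ} (hq : q.Prime) :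
    SplitsInC (sqrtFieldC d) q ↔
      ∃ a : ℤ, (q : ℤ) ∣ a ^ 2 - d * a - s ∧ ¬ (q : ℤ) ∣ 2 * a - d := by
  rw [← QuadraticAlgebra.isSplitInRing_iff hq]
  have e := (hf.orderEquiv hd hs).toRingEquiv
  exact ⟨fun h => IsSplitInRing.of_ringEquiv e.symm h, fun h => IsSplitInRing.of_ringEquiv e h⟩

open Filter Finset in
lemma tendsto_div_natCast_of_abs_sub_le {g : ℕ → ℝ} {α C : ℝ} (h : ∀ X, |g X - α * X| ≤ C) :
    Tendsto (fun X : ℕ => g X / X) atTop (nhds α) := by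
  rw [tendsto_iff_dist_tendsto_zero]
  refine squeeze_zero' (Eventually.of_forall fun _ => dist_nonneg) ?_
    (tendsto_const_div_atTop_nhds_zero_nat C)
  filter_upwards [eventually_gt_atTop 0] with X hX
  have hX' : (0 : ℝ) < X := by exact_mod_cast hX
  rw [Real.dist_eq]
  have : g X / X - α = (g X - α * X) / X := by field_simp
  rw [this, abs_div, abs_of_pos hX']
  gcongr
  exact h X

lemma Function.Periodic.natCount_mul_add {P : ℕ → Prop} [DecidablePred P] {m : ℕ}
    (hP : Function.Periodic P m) (k r : ℕ) :
    Nat.count P (m * k + r) = k * Nat.count P m + Nat.count P r := by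
  induction k with
  | zero => simp
  | succ k ih =>
    have : m * (k + 1) + r = m + (m * k + r) := by ring
    rw [this, Nat.count_add]
    have h2 : (fun i => P (m + i)) = P := by
      funext i
      rw [add_comm]
      exact hP i
    simp only [h2, ih]
    ring

open Filter in
lemma Function.Periodic.abs_count_sub_le {P : ℕ → Prop} [DecidablePred P] {m : ℕ} (hm : 0 < m)
    (hP : Function.Periodic P m) (X : ℕ) :
    |(Nat.count P X : ℝ) - (Nat.count P m / m : ℝ) * X| ≤ m := by
  have hm' : (0 : ℝ) < m := by exact_mod_cast hm
  have hX : (X : ℝ) = m * (X / m : ℕ) + (X % m : ℕ) := by exact_mod_cast (Nat.div_add_mod X m).symm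
  have hc : Nat.count P X = (X / m) * Nat.count P m + Nat.count P (X % m) := by
    rw [← hP.natCount_mul_add, Nat.div_add_mod]
  have hr : ((X % m : ℕ) : ℝ) ≤ m := by exact_mod_cast (Nat.mod_lt X hm).le
  have h1 : (Nat.count P (X % m) : ℝ) ≤ m :=
    le_trans (by exact_mod_cast Nat.count_le P) hr
  have h2 : (Nat.count P m / m : ℝ) ≤ 1 := by
    rw [div_le_one hm']
    exact_mod_cast Nat.count_le P
  have h3 : (0 : ℝ) ≤ Nat.count P m / m := by positivity
  have h4 : (Nat.count P X : ℝ) - (Nat.count P m / m : ℝ) * X =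
      Nat.count P (X % m) - (Nat.count P m / m : ℝ) * (X % m : ℕ) := by
    rw [hX, hc]
    push_cast
    field_simp
    ring
  rw [h4, abs_le]
  have h5 : (Nat.count P m / m : ℝ) * (X % m : ℕ) ≤ m := by
    calc _ ≤ 1 * (m : ℝ) := by gcongr
      _ = m := one_mul _
  have h6 : 0 ≤ (Nat.count P m / m : ℝ) * (X % m : ℕ) := by positivity
  have h7 : (0 : ℝ) ≤ Nat.count P (X % m) := by positivity
  constructor <;> linarith

lemma card_filter_Ico_one (P : ℕ → Prop) [DecidablePred P] (X : ℕ) :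
    |(((Finset.Ico 1 X).filter P).card : ℝ) - Nat.count P X| ≤ 1 := by
  rw [Nat.count_eq_card_filter_range]
  have h1 : (Finset.Ico 1 X).filter P ⊆ (Finset.range X).filter P :=
    Finset.filter_subset_filter _ fun x hx => by simp at hx ⊢; omega
  have h2 : (Finset.range X).filter P ⊆ insert 0 ((Finset.Ico 1 X).filter P) := by
    intro x hx
    simp at hx ⊢
    by_cases h : x = 0
    · exact Or.inl h
    · exact Or.inr ⟨by omega, hx.2⟩
  have h3 := Finset.card_le_card h1
  have h4 := (Finset.card_le_card h2).trans (Finset.card_insert_le _ _)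
  rw [abs_le]
  have h3' : (((Finset.Ico 1 X).filter P).card : ℝ) ≤ ((Finset.range X).filter P).card := by
    exact_mod_cast h3
  have h4' : (((Finset.range X).filter P).card : ℝ) ≤ ((Finset.Ico 1 X).filter P).card + 1 := by
    exact_mod_cast h4
  constructor <;> linarith

open Filter in
lemma Function.Periodic.tendsto_card_filter_div {P : ℕ → Prop} [DecidablePred P] {m : ℕ}
    (hm : 0 < m) (hP : Function.Periodic P m) :
    Tendsto (fun X : ℕ => (((Finset.Ico 1 X).filter P).card : ℝ) / X) atTop
      (nhds (Nat.count P m / m)) := by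
  refine tendsto_div_natCast_of_abs_sub_le (C := 1 + m) fun X => ?_
  exact (abs_sub_le _ (Nat.count P X : ℝ) _).trans
    (add_le_add (card_filter_Ico_one P X) (hP.abs_count_sub_le hm X))

lemma Function.Periodic.count_and_mul {P Q : ℕ → Prop} [DecidablePred P] [DecidablePred Q]
    {a b : ℕ} (ha : 0 < a) (hb : 0 < b) (hab : a.Coprime b) (hP : Function.Periodic P a)
    (hQ : Function.Periodic Q b) :
    Nat.count (fun n => P n ∧ Q n) (a * b) = Nat.count P a * Nat.count Q b := by
  simp only [Nat.count_eq_card_filter_range]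
  rw [← Finset.card_product]
  refine Finset.card_bij (fun n _ => (n % a, n % b)) ?_ ?_ ?_
  · intro n hn
    simp only [Finset.mem_filter, Finset.mem_range, Finset.mem_product] at hn ⊢
    exact ⟨⟨Nat.mod_lt _ ha, by rw [hP.map_mod_nat]; exact hn.2.1⟩,
      ⟨Nat.mod_lt _ hb, by rw [hQ.map_mod_nat]; exact hn.2.2⟩⟩
  · intro n hn n' hn' h
    simp only [Finset.mem_filter, Finset.mem_range, Prod.mk.injEq] at hn hn' h
    have := (Nat.modEq_and_modEq_iff_modEq_mul hab).1 ⟨h.1, h.2⟩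
    exact Nat.ModEq.eq_of_lt_of_lt this hn.1 hn'.1
  · rintro ⟨u, v⟩ huv
    simp only [Finset.mem_filter, Finset.mem_range, Finset.mem_product] at huv
    obtain ⟨⟨hu, hPu⟩, ⟨hv, hQv⟩⟩ := huv
    have h1 := (Nat.chineseRemainder hab u v).2
    have hlt := Nat.chineseRemainder_lt_mul hab u v ha.ne' hb.ne'
    set n := (Nat.chineseRemainder hab u v : ℕ)
    have hnu : n % a = u := by rw [h1.1, Nat.mod_eq_of_lt hu]
    have hnv : n % b = v := by rw [h1.2, Nat.mod_eq_of_lt hv]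
    refine ⟨n, ?_, by rw [hnu, hnv]⟩
    simp only [Finset.mem_filter, Finset.mem_range]
    exact ⟨hlt, by rw [← hP.map_mod_nat, hnu]; exact hPu, by rw [← hQ.map_mod_nat, hnv]; exact hQv⟩

lemma exists_sq_dvd_iff_dvd {M N : ℕ} (hN : N ≠ 0) :
    ∃ L : ℕ, L ≠ 0 ∧ ∀ e, (e ^ 2 ∣ N ∧ e.Coprime M) ↔ e ∣ L := by
  classical
  set S := (Finset.range (N + 1)).filter fun e => e ^ 2 ∣ N ∧ e.Coprime M with hS
  have hmem : ∀ e, e ∈ S ↔ e ^ 2 ∣ N ∧ e.Coprime M := by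
    intro e
    simp only [hS, Finset.mem_filter, Finset.mem_range, and_iff_right_iff_imp]
    rintro ⟨h, -⟩
    have h1 := Nat.le_of_dvd (Nat.pos_of_ne_zero hN) h
    have h2 := Nat.le_self_pow two_ne_zero e
    omega
  have hL : S.lcm id ^ 2 ∣ N ∧ (S.lcm id).Coprime M := by
    have : ∀ T ⊆ S, T.lcm id ^ 2 ∣ N ∧ (T.lcm id).Coprime M := by
      intro T
      induction T using Finset.induction_on with
      | empty => simp
      | insert a T _ ih =>
        intro hT
        obtain ⟨h1, h2⟩ := ih ((Finset.subset_insert _ _).trans hT)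
        obtain ⟨h3, h4⟩ := (hmem a).1 (hT (Finset.mem_insert_self _ _))
        rw [Finset.lcm_insert, id]
        constructor
        · have : GCDMonoid.lcm a (T.lcm id) = Nat.lcm a (T.lcm id) := rfl
          rw [this, ← Nat.pow_lcm_pow]
          exact Nat.lcm_dvd h3 h1
        · exact Nat.Coprime.of_dvd_left (Nat.lcm_dvd_mul a (T.lcm id)) (h4.mul_left h2)
    exact this S subset_rfl
  refine ⟨S.lcm id, ?_, fun e => ⟨fun h => Finset.dvd_lcm ((hmem e).2 h), fun h => ?_⟩⟩
  · intro h0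
    rw [h0] at hL
    simp at hL
    exact hN hL.1
  · exact ⟨(pow_dvd_pow_of_dvd h 2).trans hL.1, hL.2.of_dvd_left h⟩

open scoped ArithmeticFunction.Moebius in
lemma sum_moebius_sq_dvd_coprime {M N X : ℕ} (hN : N ≠ 0) (hX : N < X)
    [Decidable (∀ p : ℕ, p.Prime → ¬ p ∣ M → ¬ p ^ 2 ∣ N)] :
    ∑ e ∈ Finset.range X, (if e ^ 2 ∣ N ∧ e.Coprime M then μ e else 0) =
      if ∀ p : ℕ, p.Prime → ¬ p ∣ M → ¬ p ^ 2 ∣ N then 1 else 0 := by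
  obtain ⟨L, hL0, hL⟩ := exists_sq_dvd_iff_dvd (M := M) hN
  have h1 : (Finset.range X).filter (fun e => e ^ 2 ∣ N ∧ e.Coprime M) = L.divisors := by
    ext e
    rw [Finset.mem_filter, Nat.mem_divisors, hL, Finset.mem_range]
    refine ⟨fun h => ⟨h.2, hL0⟩, fun h => ⟨?_, h.1⟩⟩
    have h1 := Nat.le_of_dvd (Nat.pos_of_ne_zero hN) ((hL e).2 h.1).1
    have h2 := Nat.le_self_pow two_ne_zero e
    omega
  rw [← Finset.sum_filter, h1, ← ArithmeticFunction.coe_mul_zeta_apply,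
    ArithmeticFunction.moebius_mul_coe_zeta, ArithmeticFunction.one_apply]
  congr 1
  apply propext
  rw [Nat.eq_one_iff_not_exists_prime_dvd]
  refine forall_congr' fun p => ⟨fun h hp hpM hpN => ?_, fun h hp hpL => ?_⟩
  · exact h hp ((hL p).1 ⟨hpN, (Nat.Prime.coprime_iff_not_dvd hp).2 hpM⟩)
  · obtain ⟨h2, h3⟩ := (hL p).2 hpL
    exact h hp ((Nat.Prime.coprime_iff_not_dvd hp).1 h3) h2

lemma periodic_dvd (m : ℕ) : Function.Periodic (fun n : ℕ => m ∣ n) m := fun n => by simp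

lemma count_dvd_self {m : ℕ} (hm : 0 < m) : Nat.count (fun n => m ∣ n) m = 1 := by
  rw [Nat.count_eq_card_filter_range, Finset.card_eq_one]
  refine ⟨0, ?_⟩
  ext n
  simp only [Finset.mem_filter, Finset.mem_range, Finset.mem_singleton]
  refine ⟨fun h => Nat.eq_zero_of_dvd_of_lt h.2 h.1, ?_⟩
  rintro rfl
  exact ⟨hm, dvd_zero _⟩

open Filter in
open scoped ArithmeticFunction.Moebius in
/-- The density of the integers in a periodic set of period `M` that are not divisible by the square
of any prime not dividing `M`. -/
theorem tendsto_card_squarefree_away_div {A : ℕ → Prop} [DecidablePred A] {M : ℕ} (hM : 0 < M)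
    (hA : Function.Periodic A M)
    [DecidablePred fun N => ∀ p : ℕ, p.Prime → ¬ p ∣ M → ¬ p ^ 2 ∣ N] :
    Tendsto (fun X : ℕ => (((Finset.Ico 1 X).filter fun N =>
        A N ∧ ∀ p : ℕ, p.Prime → ¬ p ∣ M → ¬ p ^ 2 ∣ N).card : ℝ) / X) atTop
      (nhds ((Nat.count A M / M : ℝ) *
        ∑' e : ℕ, if e.Coprime M then (μ e : ℝ) / e ^ 2 else 0)) := by
  have hcount : ∀ X : ℕ, (((Finset.Ico 1 X).filter fun N =>
        A N ∧ ∀ p : ℕ, p.Prime → ¬ p ∣ M → ¬ p ^ 2 ∣ N).card : ℝ) / X =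
      ∑' e : ℕ, if e.Coprime M then
        (μ e : ℝ) * ((((Finset.Ico 1 X).filter fun N => A N ∧ e ^ 2 ∣ N).card : ℝ) / X) else 0 := by
    intro X
    rw [tsum_eq_sum (s := Finset.range X)]
    · have h1 : (((Finset.Ico 1 X).filter fun N =>
          A N ∧ ∀ p : ℕ, p.Prime → ¬ p ∣ M → ¬ p ^ 2 ∣ N).card : ℤ) =
          ∑ e ∈ Finset.range X, if e.Coprime M then
            μ e * (((Finset.Ico 1 X).filter fun N => A N ∧ e ^ 2 ∣ N).card : ℤ) else 0 := by
        rw [← Finset.filter_filter, Finset.card_filter]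
        push_cast
        have h2 : ∀ N ∈ (Finset.Ico 1 X).filter A,
            (if ∀ p : ℕ, p.Prime → ¬ p ∣ M → ¬ p ^ 2 ∣ N then (1 : ℤ) else 0) =
            ∑ e ∈ Finset.range X, (if e ^ 2 ∣ N ∧ e.Coprime M then μ e else 0) := by
          intro N hN
          simp only [Finset.mem_filter, Finset.mem_Ico] at hN
          exact (sum_moebius_sq_dvd_coprime (by omega) hN.1.2).symm
        rw [Finset.sum_congr rfl h2, Finset.sum_comm]
        refine Finset.sum_congr rfl fun e _ => ?_
        by_cases he : e.Coprime M
        · rw [if_pos he]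
          simp_rw [and_iff_left he]
          rw [← Finset.sum_filter, Finset.filter_filter, Finset.sum_const, nsmul_eq_mul, mul_comm]
        · simp [he]
      have h2 := congrArg (fun z : ℤ => (z : ℝ) / X) h1
      push_cast at h2
      rw [h2, Finset.sum_div]
      refine Finset.sum_congr rfl fun e _ => ?_
      split_ifs <;> simp [mul_div_assoc]
    · intro e he
      have : ((Finset.Ico 1 X).filter fun N => A N ∧ e ^ 2 ∣ N) = ∅ := by
        rw [Finset.filter_eq_empty_iff]
        rintro N hN ⟨-, h⟩
        simp only [Finset.mem_Ico, Finset.mem_range] at hN he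
        have h1 := Nat.le_of_dvd (by omega) h
        have h2 := Nat.le_self_pow two_ne_zero e
        omega
      simp [this]
  rw [funext hcount, ← tsum_mul_left]
  refine tendsto_tsum_of_dominated_convergence (bound := fun e : ℕ => 1 / (e : ℝ) ^ 2)
    (Real.summable_one_div_nat_pow.2 one_lt_two) ?_ ?_
  · intro e
    split_ifs with he
    · rcases Nat.eq_zero_or_pos e with rfl | hepos
      · simp
      have he2 : 0 < e ^ 2 := by positivity
      have hcop : M.Coprime (e ^ 2) := (he.pow_left 2).symm
      have hper : Function.Periodic (fun N => A N ∧ e ^ 2 ∣ N) (M * e ^ 2) := by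
        intro N
        have h1 : A (N + M * e ^ 2) = A N := by
          rw [mul_comm M]
          exact hA.nat_mul _ N
        have h2 : (e ^ 2 ∣ N + M * e ^ 2) = (e ^ 2 ∣ N) :=
          propext (Nat.dvd_add_left (dvd_mul_left _ _))
        simp only [h1, h2]
      have := (hper.tendsto_card_filter_div (by positivity)).const_mul (μ e : ℝ)
      rw [hA.count_and_mul hM he2 hcop (periodic_dvd _), count_dvd_self he2] at this
      convert this using 2
      push_cast
      field_simp
    · simp
  · filter_upwards [eventually_gt_atTop 0] with X hX e
    have hX' : (0 : ℝ) < X := by exact_mod_cast hX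
    split_ifs with he
    · rw [norm_mul]
      have hmu : ‖(μ e : ℝ)‖ ≤ 1 := by
        rw [Real.norm_eq_abs]
        exact_mod_cast ArithmeticFunction.abs_moebius_le_one
      have hcard : (((Finset.Ico 1 X).filter fun N => A N ∧ e ^ 2 ∣ N).card : ℝ) ≤
          X / (e : ℝ) ^ 2 := by
        have h1 : ((Finset.Ico 1 X).filter fun N => A N ∧ e ^ 2 ∣ N) ⊆
            (Finset.Ioc 0 X).filter fun N => e ^ 2 ∣ N := by
          intro N hN
          simp at hN ⊢
          exact ⟨by omega, hN.2.2⟩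
        have h2 := Finset.card_le_card h1
        rw [Nat.Ioc_filter_dvd_card_eq_div] at h2
        calc _ ≤ ((X / e ^ 2 : ℕ) : ℝ) := by exact_mod_cast h2
          _ ≤ _ := by
            have := Nat.cast_div_le (α := ℝ) (m := X) (n := e ^ 2)
            push_cast at this
            exact this
      rw [Real.norm_of_nonneg (by positivity : (0 : ℝ) ≤ _ / (X : ℝ))]
      calc _ ≤ 1 * ((X / (e : ℝ) ^ 2) / X) := by gcongr
        _ = 1 / (e : ℝ) ^ 2 := by field_simp
    · simp

open scoped ArithmeticFunction.Moebius in
lemma tsum_moebius_coprime_div_sq {M : ℕ} (hM : 0 < M) :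
    ∑' e : ℕ, (if e.Coprime M then (μ e : ℝ) / e ^ 2 else 0) =
      6 / Real.pi ^ 2 / ∏ p ∈ M.primeFactors, (1 - 1 / (p : ℝ) ^ 2) := by
  have : NeZero M := ⟨hM.ne'⟩
  have h2 : (1 : ℝ) < (2 : ℂ).re := by norm_num
  have h := DirichletCharacter.LSeries.mul_mu_eq_one (1 : DirichletCharacter ℂ M) h2
  have hz := DirichletCharacter.LFunctionTrivChar_eq_mul_riemannZeta (N := M) (s := 2) (by norm_num)
  rw [← DirichletCharacter.LFunction_eq_LSeries _ h2,
    show DirichletCharacter.LFunction (1 : DirichletCharacter ℂ M) 2 = _ from hz,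
    riemannZeta_two] at h
  have hL :
      LSeries ((fun n : ℕ => (1 : DirichletCharacter ℂ M) n) * fun n : ℕ => ((μ n : ℤ) : ℂ)) 2 =
      ((∑' e : ℕ, (if e.Coprime M then (μ e : ℝ) / e ^ 2 else 0) : ℝ) : ℂ) := by
    rw [LSeries, Complex.ofReal_tsum]
    refine tsum_congr fun e => ?_
    rcases Nat.eq_zero_or_pos e with rfl | he
    · simp
    rw [LSeries.term_of_ne_zero he.ne']
    split_ifs with hc
    · simp [MulChar.one_apply ((ZMod.isUnit_iff_coprime e M).2 hc)]
    · simp [MulChar.map_nonunit _ (fun hu => hc ((ZMod.isUnit_iff_coprime e M).1 hu))]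
  have hprod : (∏ p ∈ M.primeFactors, (1 - (p : ℂ) ^ (-2 : ℂ))) =
      ((∏ p ∈ M.primeFactors, (1 - 1 / (p : ℝ) ^ 2) : ℝ) : ℂ) := by
    push_cast
    refine Finset.prod_congr rfl fun p _ => ?_
    rw [Complex.cpow_neg]
    simp
  rw [hL, hprod] at h
  have h' : (∏ p ∈ M.primeFactors, (1 - 1 / (p : ℝ) ^ 2)) * (Real.pi ^ 2 / 6) *
      (∑' e : ℕ, (if e.Coprime M then (μ e : ℝ) / e ^ 2 else 0)) = 1 := by
    exact_mod_cast h
  have hpi := Real.pi_ne_zero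
  have hne : (∏ p ∈ M.primeFactors, (1 - 1 / (p : ℝ) ^ 2)) ≠ 0 := by
    intro h0
    rw [h0] at h'
    simp at h'
  field_simp at h' ⊢
  linear_combination h'

/-- The residues modulo `16` of the absolute values of the negative fundamental discriminants. -/
def IsFundamentalModSixteen (N : ℕ) : Prop :=
  N % 16 = 3 ∨ N % 16 = 4 ∨ N % 16 = 7 ∨ N % 16 = 8 ∨ N % 16 = 11 ∨ N % 16 = 15

instance : DecidablePred IsFundamentalModSixteen := fun _ => inferInstanceAs (Decidable (_ ∨ _))

lemma sq_emod_four_of_odd {p : ℤ} (hp : p % 2 = 1) : p ^ 2 % 4 = 1 := by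
  obtain ⟨k, rfl⟩ : ∃ k, p = 2 * k + 1 := ⟨p / 2, by omega⟩
  have : (2 * k + 1) ^ 2 = 4 * (k ^ 2 + k) + 1 := by ring
  omega

lemma isFundamental_neg_natCast_iff {N : ℕ} :
    IsFundamental (-(N : ℤ)) ↔
      IsFundamentalModSixteen N ∧ ∀ p : ℕ, p.Prime → p ≠ 2 → ¬ p ^ 2 ∣ N := by
  constructor
  · rintro ⟨h4, h⟩
    constructor
    · by_contra hcon
      unfold IsFundamentalModSixteen at hcon
      have h0 : N % 16 = 0 ∨ N % 16 = 12 ∨ N % 16 = 1 ∨ N % 4 = 2 ∨ N % 4 = 1 := by omega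
      have := h 2 (-(N : ℤ) / 4) (by omega) (by omega)
      norm_num at this
    · rintro p hp hp2 ⟨k, hk⟩
      have hodd : (p : ℤ) % 2 = 1 := by
        have := hp.eq_two_or_odd
        omega
      have hsq := sq_emod_four_of_odd hodd
      have hd : -(N : ℤ) = (p : ℤ) ^ 2 * (-(k : ℤ)) := by
        rw [hk]
        push_cast
        ring
      have hmod : (-(N : ℤ)) % 4 = (-(k : ℤ)) % 4 := by
        rw [hd, Int.mul_emod, hsq]
        omega
      have h1 := h p (-(k : ℤ)) hd (by omega)
      have h2 : p ^ 2 = 1 := by exact_mod_cast h1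
      have h3 := hp.two_le
      nlinarith
  · rintro ⟨h16, hp⟩
    unfold IsFundamentalModSixteen at h16
    refine ⟨by omega, fun s d' hd hd4 => ?_⟩
    by_contra hs
    have hs1 : s.natAbs ≠ 1 := by
      intro h1
      apply hs
      rw [← Int.natAbs_sq, h1]
      norm_num
    obtain ⟨p, hpp, t, ht⟩ := Nat.exists_prime_and_dvd hs1
    have hs2 : s ^ 2 = (p : ℤ) ^ 2 * (t : ℤ) ^ 2 := by
      rw [← Int.natAbs_sq, ht]
      push_cast
      ring
    by_cases hp2 : p = 2
    · subst hp2
      have hN4 : (N : ℤ) = 4 * -((t : ℤ) ^ 2 * d') := by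
        push_cast at hs2
        rw [hs2] at hd
        linarith
      have hmod : ((t : ℤ) ^ 2 * d') % 4 = 0 ∨ ((t : ℤ) ^ 2 * d') % 4 = 1 := by
        rw [Int.mul_emod]
        rcases Int.emod_two_eq_zero_or_one (t : ℤ) with h | h
        · obtain ⟨k, hk⟩ : ∃ k, (t : ℤ) = 2 * k := ⟨t / 2, by omega⟩
          have : (t : ℤ) ^ 2 % 4 = 0 := by
            rw [hk, show (2 * k) ^ 2 = 4 * k ^ 2 by ring]
            omega
          simp [this]
        · rw [sq_emod_four_of_odd h]
          rcases hd4 with h | h <;> simp [h]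
      omega
    · refine hp p hpp hp2 ?_
      have : (p : ℤ) ^ 2 ∣ -(N : ℤ) := ⟨(t : ℤ) ^ 2 * d', by rw [hd, hs2]; ring⟩
      rw [dvd_neg] at this
      exact_mod_cast this

/-- The congruence condition on `N` saying that the Kronecker symbol of the discriminant `-N` at the
prime `p` is `ε`, where `ε = 1` or `ε = -1`. -/
def KroneckerNegEq (ε : ℤ) (p N : ℕ) : Prop :=
  if p = 2 then (N : ℤ) % 8 = 5 + 2 * ε else jacobiSym (-(N : ℤ)) p = ε

instance (ε : ℤ) (p : ℕ) : DecidablePred (KroneckerNegEq ε p) :=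
  fun _ => inferInstanceAs (Decidable (ite _ _ _))

lemma KroneckerNegEq.not_dvd {ε : ℤ} {p N : ℕ} (hε : ε ≠ 0) (hp : p.Prime) (hp2 : p ≠ 2)
    (h : KroneckerNegEq ε p N) : ¬ p ∣ N := by
  have : Fact p.Prime := ⟨hp⟩
  rw [KroneckerNegEq, if_neg hp2, ← jacobiSym.legendreSym.to_jacobiSym] at h
  intro hd
  have := (legendreSym.eq_zero_iff p (-(N : ℤ))).2 (by
    push_cast
    rw [(ZMod.natCast_eq_zero_iff N p).2 hd, neg_zero])
  exact hε (h.symm.trans this)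

lemma periodic_kroneckerNegEq (ε : ℤ) (p : ℕ) :
    Function.Periodic (KroneckerNegEq ε p) (if p = 2 then 16 else p) := by
  intro N
  unfold KroneckerNegEq
  split_ifs with h
  · have : ((N + 16 : ℕ) : ℤ) % 8 = (N : ℤ) % 8 := by omega
    rw [this]
  · congr 1
    rw [jacobiSym.mod_left, jacobiSym.mod_left (-(N : ℤ))]
    congr 1
    push_cast
    rw [neg_add, ← sub_eq_add_neg, Int.sub_emod_right]

lemma periodic_isFundamentalModSixteen : Function.Periodic IsFundamentalModSixteen 16 := by
  intro N
  simp only [IsFundamentalModSixteen, Nat.add_mod_right]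

lemma two_mul_card_quadraticChar_eq {p : ℕ} [Fact p.Prime] (hp2 : p ≠ 2) {ε : ℤ}
    (hε : ε = 1 ∨ ε = -1) :
    2 * ((Finset.univ.filter fun a : ZMod p => quadraticChar (ZMod p) a = ε).card : ℤ) = p - 1 := by
  have hchar : ringChar (ZMod p) ≠ 2 := by rwa [ZMod.ringChar_zmod_n]
  have h1 : ∀ a : ZMod p, 2 * (if quadraticChar (ZMod p) a = ε then (1 : ℤ) else 0) =
      (1 - if a = 0 then 1 else 0) + ε * quadraticChar (ZMod p) a := by
    intro a
    by_cases ha : a = 0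
    · rcases hε with rfl | rfl <;> simp [ha]
    · rcases quadraticChar_dichotomy ha with h | h <;> rcases hε with rfl | rfl <;> simp [ha, h]
  rw [Finset.card_filter]
  push_cast
  rw [Finset.mul_sum, Finset.sum_congr rfl fun a _ => h1 a, Finset.sum_add_distrib,
    ← Finset.mul_sum, quadraticChar_sum_zero hchar, Finset.sum_sub_distrib]
  simp [ZMod.card]

lemma two_mul_count_kroneckerNegEq {p : ℕ} (hp : p.Prime) (hp2 : p ≠ 2) {ε : ℤ}
    (hε : ε = 1 ∨ ε = -1) : 2 * (Nat.count (KroneckerNegEq ε p) p : ℤ) = p - 1 := by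
  have : Fact p.Prime := ⟨hp⟩
  rw [← two_mul_card_quadraticChar_eq hp2 hε, Nat.count_eq_card_filter_range]
  congr 2
  have key : ∀ N : ℕ, KroneckerNegEq ε p N ↔ quadraticChar (ZMod p) (-(N : ZMod p)) = ε := by
    intro N
    rw [KroneckerNegEq, if_neg hp2, ← jacobiSym.legendreSym.to_jacobiSym, legendreSym]
    push_cast
    rfl
  refine Finset.card_bij (fun N _ => -(N : ZMod p)) ?_ ?_ ?_
  · intro N hN
    simpa [key] using (Finset.mem_filter.1 hN).2
  · intro N hN N' hN' h
    simp only [Finset.mem_filter, Finset.mem_range] at hN hN'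
    have h1 := (ZMod.natCast_eq_natCast_iff _ _ _).1 (neg_injective h)
    exact Nat.ModEq.eq_of_lt_of_lt h1 hN.1 hN'.1
  · intro b hb
    simp only [Finset.mem_filter, Finset.mem_univ, true_and] at hb
    refine ⟨(-b).val, ?_, by simp⟩
    simp only [Finset.mem_filter, Finset.mem_range, key]
    exact ⟨ZMod.val_lt _, by simpa using hb⟩

lemma four_mul_eval_minpoly {d s a : ℤ} (hs : 4 * s = d - d ^ 2) :
    4 * (a ^ 2 - d * a - s) = (2 * a - d) ^ 2 - d := by
  linear_combination -hs

lemma dvd_four_mul_iff_of_odd_prime {q : ℕ} (hq : q.Prime) (hq2 : q ≠ 2) (z : ℤ) :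
    (q : ℤ) ∣ 4 * z ↔ (q : ℤ) ∣ z := by
  refine ⟨fun h => ?_, fun h => h.mul_left 4⟩
  rcases (Nat.prime_iff_prime_int.1 hq).dvd_or_dvd h with h | h
  · exfalso
    have h1 : q ∣ 2 ^ 2 := by exact_mod_cast h
    exact hq2 ((Nat.prime_dvd_prime_iff_eq hq Nat.prime_two).1 (hq.dvd_of_dvd_pow h1))
  · exact h

lemma isSquare_intCast_zmod_iff {q : ℕ} (hq : q.Prime) (hq2 : q ≠ 2) {d s : ℤ}
    (hs : 4 * s = d - d ^ 2) :
    IsSquare (d : ZMod q) ↔ ∃ a : ℤ, (q : ℤ) ∣ a ^ 2 - d * a - s := by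
  have : Fact q.Prime := ⟨hq⟩
  constructor
  · rintro ⟨r, hr⟩
    have h2 : (2 : ZMod q) ≠ 0 := by
      intro h
      have : ((2 : ℕ) : ZMod q) = 0 := by exact_mod_cast h
      rw [ZMod.natCast_eq_zero_iff] at this
      exact hq2 ((Nat.prime_dvd_prime_iff_eq hq Nat.prime_two).1 this)
    obtain ⟨a, ha⟩ := ZMod.intCast_surjective ((r + d) / 2 : ZMod q)
    refine ⟨a, ?_⟩
    rw [← dvd_four_mul_iff_of_odd_prime hq hq2, four_mul_eval_minpoly hs,
      ← ZMod.intCast_zmod_eq_zero_iff_dvd]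
    push_cast
    rw [ha]
    field_simp
    rw [hr]
    ring
  · rintro ⟨a, ha⟩
    rw [← dvd_four_mul_iff_of_odd_prime hq hq2, four_mul_eval_minpoly hs,
      ← ZMod.intCast_zmod_eq_zero_iff_dvd] at ha
    push_cast at ha
    exact ⟨2 * a - d, by linear_combination -ha⟩

lemma two_dvd_sq_sub_sub_iff (d s a : ℤ) :
    (2 : ℤ) ∣ a ^ 2 - d * a - s ↔ 2 ∣ a * (1 - d) - s := by
  have h : (2 : ℤ) ∣ a ^ 2 - a := by
    have := (Int.even_mul_pred_self a).two_dvd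
    rwa [show a ^ 2 - a = a * (a - 1) by ring]
  rw [← dvd_sub_right h, ← dvd_neg]
  ring_nf

lemma kroneckerNegEq_neg_one_iff {q N : ℕ} (hq : q.Prime) {s : ℤ}
    (hs : 4 * s = -(N : ℤ) - (-(N : ℤ)) ^ 2) :
    KroneckerNegEq (-1) q N ↔ ∀ a : ℤ, ¬ (q : ℤ) ∣ a ^ 2 - -(N : ℤ) * a - s := by
  have : Fact q.Prime := ⟨hq⟩
  unfold KroneckerNegEq
  split_ifs with h
  · subst h
    push_cast
    simp_rw [two_dvd_sq_sub_sub_iff]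
    obtain ⟨k, r, hr, hN⟩ : ∃ k r : ℤ,
        (r = 0 ∨ r = 1 ∨ r = 2 ∨ r = 3 ∨ r = 4 ∨ r = 5 ∨ r = 6 ∨ r = 7) ∧
          (N : ℤ) = 8 * k + r :=
      ⟨N / 8, N % 8, by omega, by omega⟩
    rw [hN] at hs ⊢
    have hs' : 4 * s = -(64 * k ^ 2 + 16 * (k * r) + 8 * k + r ^ 2 + r) := by
      linear_combination hs
    constructor
    · intro h8 a
      have : r = 3 := by omega
      subst this
      have h2 : a * (1 - -(8 * k + 3)) = 2 * (a * (4 * k + 2)) := by ring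
      omega
    · intro h
      have h0 := h 0
      have h1 := h 1
      rcases hr with rfl | rfl | rfl | rfl | rfl | rfl | rfl | rfl <;> omega
  · rw [← jacobiSym.legendreSym.to_jacobiSym, legendreSym.eq_neg_one_iff,
      isSquare_intCast_zmod_iff hq h hs, not_exists]

lemma kroneckerNegEq_one_iff {q N : ℕ} (hq : q.Prime) {s : ℤ}
    (hs : 4 * s = -(N : ℤ) - (-(N : ℤ)) ^ 2) :
    KroneckerNegEq 1 q N ↔
      ∃ a : ℤ, (q : ℤ) ∣ a ^ 2 - -(N : ℤ) * a - s ∧ ¬ (q : ℤ) ∣ 2 * a - -(N : ℤ) := by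
  have : Fact q.Prime := ⟨hq⟩
  unfold KroneckerNegEq
  split_ifs with h
  · subst h
    push_cast
    simp_rw [two_dvd_sq_sub_sub_iff]
    obtain ⟨k, r, hr, hN⟩ : ∃ k r : ℤ,
        (r = 0 ∨ r = 1 ∨ r = 2 ∨ r = 3 ∨ r = 4 ∨ r = 5 ∨ r = 6 ∨ r = 7) ∧
          (N : ℤ) = 8 * k + r :=
      ⟨N / 8, N % 8, by omega, by omega⟩
    rw [hN] at hs ⊢
    have hs' : 4 * s = -(64 * k ^ 2 + 16 * (k * r) + 8 * k + r ^ 2 + r) := by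
      linear_combination hs
    constructor
    · intro h8
      have : r = 7 := by omega
      subst this
      exact ⟨0, by omega, by omega⟩
    · rintro ⟨a, h1, h2⟩
      rcases hr with rfl | rfl | rfl | rfl | rfl | rfl | rfl | rfl
      all_goals first | omega | skip
      have h3 : a * (1 - -(8 * k + 3)) = 2 * (a * (4 * k + 2)) := by ring
      omega
  · have key : ∀ a : ℤ, (q : ℤ) ∣ a ^ 2 - -(N : ℤ) * a - s →
        ((q : ℤ) ∣ 2 * a - -(N : ℤ) ↔ ((-(N : ℤ) : ℤ) : ZMod q) = 0) := by
      intro a ha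
      rw [← dvd_four_mul_iff_of_odd_prime hq h, four_mul_eval_minpoly hs] at ha
      rw [ZMod.intCast_zmod_eq_zero_iff_dvd, ← dvd_iff_dvd_of_dvd_sub ha]
      exact ((Nat.prime_iff_prime_int.1 hq).dvd_pow_iff_dvd two_ne_zero).symm
    rw [← jacobiSym.legendreSym.to_jacobiSym]
    constructor
    · intro h1
      have h0 : ((-(N : ℤ) : ℤ) : ZMod q) ≠ 0 := by
        intro h0
        rw [(legendreSym.eq_zero_iff q _).2 h0] at h1
        exact zero_ne_one h1
      obtain ⟨a, ha⟩ := (isSquare_intCast_zmod_iff hq h hs).1 ((legendreSym.eq_one_iff q h0).1 h1)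
      exact ⟨a, ha, fun hd => h0 ((key a ha).1 hd)⟩
    · rintro ⟨a, ha, hd⟩
      exact (legendreSym.eq_one_iff q fun h0 => hd ((key a ha).2 h0)).2
        ((isSquare_intCast_zmod_iff hq h hs).2 ⟨a, ha⟩)

/-- The modulus of the conditions at the prime `p`: it is `16` for `p = 2` and `p` otherwise. -/
def localModulus (p : ℕ) : ℕ := if p = 2 then 16 else p

/-- The conditions at the prime `p`: the residue modulo `16` is that of a fundamental discriminant
if `p = 2`, and the Kronecker symbol at `p` is `ε p` if `p ∈ T`. -/
def LocalCondition (T : Finset ℕ) (ε : ℕ → ℤ) (p N : ℕ) : Prop :=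
  (p = 2 → IsFundamentalModSixteen N) ∧ (p ∈ T → KroneckerNegEq (ε p) p N)

instance (T : Finset ℕ) (ε : ℕ → ℤ) (p : ℕ) : DecidablePred (LocalCondition T ε p) :=
  fun _ => inferInstanceAs (Decidable (_ ∧ _))

lemma periodic_localCondition (T : Finset ℕ) (ε : ℕ → ℤ) (p : ℕ) :
    Function.Periodic (LocalCondition T ε p) (localModulus p) := by
  intro N
  have h := periodic_kroneckerNegEq (ε p) p N
  unfold LocalCondition localModulus
  rw [h]
  by_cases hp : p = 2
  · rw [if_pos hp, periodic_isFundamentalModSixteen N]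
  · simp [hp]

lemma localModulus_pos {p : ℕ} (hp : p.Prime) : 0 < localModulus p := by
  unfold localModulus
  split_ifs
  · norm_num
  · exact hp.pos

lemma Nat.Prime.dvd_localModulus_iff {p r : ℕ} (hr : r.Prime) (hp : p.Prime) :
    r ∣ localModulus p ↔ r = p := by
  unfold localModulus
  split_ifs with h
  · subst h
    rw [show 16 = 2 ^ 4 by norm_num, hr.prime.dvd_pow_iff_dvd (by norm_num),
      Nat.prime_dvd_prime_iff_eq hr Nat.prime_two]
  · exact Nat.prime_dvd_prime_iff_eq hr hp

lemma Nat.Prime.dvd_prod_localModulus_iff {S : Finset ℕ} (hS : ∀ p ∈ S, p.Prime) {r : ℕ}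
    (hr : r.Prime) : r ∣ ∏ p ∈ S, localModulus p ↔ r ∈ S := by
  rw [hr.prime.dvd_finsetProd_iff]
  constructor
  · rintro ⟨p, hp, h⟩
    rwa [(hr.dvd_localModulus_iff (hS p hp)).1 h]
  · exact fun h => ⟨r, h, (hr.dvd_localModulus_iff (hS r h)).2 rfl⟩

lemma primeFactors_prod_localModulus {S : Finset ℕ} (hS : ∀ p ∈ S, p.Prime) :
    (∏ p ∈ S, localModulus p).primeFactors = S := by
  ext r
  rw [Nat.mem_primeFactors]
  constructor
  · rintro ⟨hr, h, -⟩
    exact (hr.dvd_prod_localModulus_iff hS).1 h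
  · intro h
    exact ⟨hS r h, ((hS r h).dvd_prod_localModulus_iff hS).2 h,
      (Finset.prod_pos fun p hp => localModulus_pos (hS p hp)).ne'⟩

lemma Function.Periodic.forall_mem_finset {B : ℕ → ℕ → Prop} {m : ℕ → ℕ} {S : Finset ℕ}
    (hB : ∀ p ∈ S, Function.Periodic (B p) (m p)) :
    Function.Periodic (fun N => ∀ p ∈ S, B p N) (∏ p ∈ S, m p) := by
  intro N
  refine propext (forall₂_congr fun p hp => ?_)
  obtain ⟨k, hk⟩ := Finset.dvd_prod_of_mem m hp
  rw [hk, mul_comm]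
  exact ((hB p hp).nat_mul k N).to_iff

lemma Function.Periodic.count_forall_mem_finset {B : ℕ → ℕ → Prop} [∀ p, DecidablePred (B p)]
    {m : ℕ → ℕ} {S : Finset ℕ} (hm : ∀ p ∈ S, 0 < m p)
    (hco : (S : Set ℕ).Pairwise fun p r => (m p).Coprime (m r))
    (hB : ∀ p ∈ S, Function.Periodic (B p) (m p)) :
    Nat.count (fun N => ∀ p ∈ S, B p N) (∏ p ∈ S, m p) = ∏ p ∈ S, Nat.count (B p) (m p) := by
  induction S using Finset.induction_on with
  | empty => simp
  | insert a S ha ih =>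
    simp only [Finset.forall_mem_insert] at hm hB
    rw [Finset.prod_insert ha, Finset.prod_insert ha, ← ih hm.2
      (hco.mono (by simp)) hB.2]
    simp only [Finset.forall_mem_insert]
    refine hB.1.count_and_mul hm.1 (Finset.prod_pos hm.2) ?_
      (Function.Periodic.forall_mem_finset hB.2)
    refine Nat.Coprime.prod_right fun p hp => hco (by simp) (by simp [hp]) ?_
    rintro rfl
    exact ha hp

lemma coprime_localModulus {p r : ℕ} (hp : p.Prime) (hr : r.Prime) (h : p ≠ r) :
    (localModulus p).Coprime (localModulus r) := by
  refine Nat.Coprime.symm (Nat.coprime_of_dvd fun k hk h1 h2 => h ?_)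
  rw [← (hk.dvd_localModulus_iff hp).1 h2, (hk.dvd_localModulus_iff hr).1 h1]

/-- The proportion of the residue classes satisfying the conditions at `p`, relative to the
proportion of those not divisible by `p ^ 2`. -/
noncomputable def localDensity (T : Finset ℕ) (ε : ℕ → ℤ) (p : ℕ) : ℝ :=
  (Nat.count (LocalCondition T ε p) (localModulus p) : ℝ) / localModulus p / (1 - 1 / (p : ℝ) ^ 2)

lemma localDensity_two_of_notMem {T : Finset ℕ} (ε : ℕ → ℤ) (h : 2 ∉ T) :
    localDensity T ε 2 = 1 / 2 := by
  have h1 : LocalCondition T ε 2 = IsFundamentalModSixteen := by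
    funext N
    simp [LocalCondition, h]
  have h2 : Nat.count IsFundamentalModSixteen 16 = 6 := by decide
  simp only [localDensity, h1, localModulus, if_true, h2]
  norm_num

lemma localDensity_two_of_mem {T : Finset ℕ} {ε : ℕ → ℤ} (h : 2 ∈ T) (hε : ε 2 = 1 ∨ ε 2 = -1) :
    localDensity T ε 2 = 1 / 6 := by
  have h2 : Nat.count (LocalCondition T ε 2) 16 = 2 := by
    have h1 : LocalCondition T ε 2 =
        fun N => IsFundamentalModSixteen N ∧ (N : ℤ) % 8 = 5 + 2 * ε 2 := by
      funext N
      simp [LocalCondition, h, KroneckerNegEq]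
    simp only [h1]
    rcases hε with h | h <;> simp only [h] <;> decide
  simp only [localDensity, localModulus, if_true, h2]
  norm_num

lemma one_third_le_localDensity {T : Finset ℕ} {ε : ℕ → ℤ} {p : ℕ} (hp : p.Prime) (hp2 : p ≠ 2)
    (h : p ∈ T) (hε : ε p = 1 ∨ ε p = -1) : 1 / 3 ≤ localDensity T ε p := by
  have h1 : LocalCondition T ε p = KroneckerNegEq (ε p) p := by
    funext N
    simp [LocalCondition, h, hp2]
  have h2 := two_mul_count_kroneckerNegEq hp hp2 hε
  have h3 : (Nat.count (KroneckerNegEq (ε p) p) p : ℝ) = (p - 1) / 2 := by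
    have : 2 * (Nat.count (KroneckerNegEq (ε p) p) p : ℝ) = p - 1 := by exact_mod_cast h2
    linarith
  have hp1 : (2 : ℝ) ≤ p := by exact_mod_cast hp.two_le
  have h4 : localDensity T ε p = p / (2 * (p + 1)) := by
    simp only [localDensity, h1, localModulus, if_neg hp2, h3]
    have h5 : (p : ℝ) - 1 ≠ 0 := by linarith
    have h6 : (p : ℝ) + 1 ≠ 0 := by linarith
    have h7 : (p : ℝ) ≠ 0 := by linarith
    have h8 : 1 - 1 / (p : ℝ) ^ 2 = (p - 1) * (p + 1) / p ^ 2 := by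
      field_simp
      ring
    rw [h8]
    field_simp
  rw [h4, div_le_div_iff₀ (by norm_num) (by positivity)]
  linarith

lemma le_prod_localDensity {T : Finset ℕ} {ε : ℕ → ℤ} (hT : ∀ p ∈ T, p.Prime)
    (hε : ∀ p, ε p = 1 ∨ ε p = -1) :
    1 / 2 * (1 / 3) ^ T.card ≤ ∏ p ∈ insert 2 T, localDensity T ε p := by
  have h3 : (1 / 3 : ℝ) ^ (T.erase 2).card ≤ ∏ p ∈ T.erase 2, localDensity T ε p := by
    rw [← Finset.prod_const]
    refine Finset.prod_le_prod (fun _ _ => by norm_num) fun p hp => ?_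
    rw [Finset.mem_erase] at hp
    exact one_third_le_localDensity (hT p hp.2) hp.1 hp.2 (hε p)
  rw [← Finset.insert_erase (Finset.mem_insert_self 2 T), Finset.erase_insert_eq_erase,
    Finset.prod_insert (Finset.notMem_erase 2 T)]
  by_cases h : 2 ∈ T
  · rw [localDensity_two_of_mem h (hε 2), ← Finset.card_erase_add_one h, pow_succ]
    linarith
  · rw [localDensity_two_of_notMem ε h]
    rw [Finset.erase_eq_of_notMem h] at h3 ⊢
    linarith

lemma isFundamental_and_kroneckerNegEq_iff {T : Finset ℕ} {ε : ℕ → ℤ} (hT : ∀ p ∈ T, p.Prime)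
    (hε : ∀ p, ε p ≠ 0) (N : ℕ) :
    (IsFundamental (-(N : ℤ)) ∧ ∀ p ∈ T, KroneckerNegEq (ε p) p N) ↔
      (∀ p ∈ insert 2 T, LocalCondition T ε p N) ∧
        ∀ p : ℕ, p.Prime → ¬ p ∣ ∏ r ∈ insert 2 T, localModulus r → ¬ p ^ 2 ∣ N := by
  have hS : ∀ p ∈ insert 2 T, p.Prime := by
    simpa only [Finset.forall_mem_insert] using ⟨Nat.prime_two, hT⟩
  rw [isFundamental_neg_natCast_iff]
  constructor
  · rintro ⟨⟨h16, hsq⟩, hK⟩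
    refine ⟨fun p _ => ⟨fun _ => h16, hK p⟩, fun p hp hpM => hsq p hp ?_⟩
    rintro rfl
    exact hpM ((hp.dvd_prod_localModulus_iff hS).2 (Finset.mem_insert_self _ _))
  · rintro ⟨hA, hsq⟩
    have hK : ∀ p ∈ T, KroneckerNegEq (ε p) p N :=
      fun p hp => (hA p (Finset.mem_insert_of_mem hp)).2 hp
    refine ⟨⟨(hA 2 (Finset.mem_insert_self _ _)).1 rfl, fun p hp hp2 => ?_⟩, hK⟩
    by_cases hpT : p ∈ T
    · exact fun h => (hK p hpT).not_dvd (hε p) hp hp2 ((dvd_pow_self p two_ne_zero).trans h)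
    · refine hsq p hp fun h => ?_
      rw [hp.dvd_prod_localModulus_iff hS] at h
      simp [hp2, hpT] at h

open Filter in
open scoped Classical in
/-- The density of the negative fundamental discriminants with prescribed nonzero Kronecker symbols
at the primes in `T`. -/
theorem tendsto_card_isFundamental_div {T : Finset ℕ} {ε : ℕ → ℤ} (hT : ∀ p ∈ T, p.Prime)
    (hε : ∀ p, ε p ≠ 0) :
    Tendsto (fun X : ℕ => (((Finset.Ico 1 X).filter fun N : ℕ =>
        IsFundamental (-(N : ℤ)) ∧ ∀ p ∈ T, KroneckerNegEq (ε p) p N).card : ℝ) / X) atTop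
      (nhds (6 / Real.pi ^ 2 * ∏ p ∈ insert 2 T, localDensity T ε p)) := by
  have hS : ∀ p ∈ insert 2 T, p.Prime := by
    simpa only [Finset.forall_mem_insert] using ⟨Nat.prime_two, hT⟩
  have hM : 0 < ∏ p ∈ insert 2 T, localModulus p :=
    Finset.prod_pos fun p hp => localModulus_pos (hS p hp)
  have hper := fun p (_ : p ∈ insert 2 T) => periodic_localCondition T ε p
  have h := tendsto_card_squarefree_away_div hM (Function.Periodic.forall_mem_finset hper)
  rw [tsum_moebius_coprime_div_sq hM, primeFactors_prod_localModulus hS,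
    Function.Periodic.count_forall_mem_finset (fun p hp => localModulus_pos (hS p hp))
      (fun p hp r hr hpr => coprime_localModulus (hS p hp) (hS r hr) hpr) hper] at h
  simp_rw [isFundamental_and_kroneckerNegEq_iff hT hε]
  convert h using 2
  simp only [localDensity, Finset.prod_div_distrib]
  push_cast
  ring

lemma exists_numberField_sqrtFieldC_iff {n : ℕ} {q : Fin (n + 1) → ℕ} (hq : ∀ i, (q i).Prime)
    {ε : ℕ → ℤ} (hε : ∀ i : Fin (n + 1), ε (q i) = if (i : ℕ) < n then -1 else 1)
    {N : ℕ} (hN : 0 < N) :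
    (∃ _ : NumberField ↥(sqrtFieldC (-(N : ℤ))),
      Module.finrank ℚ ↥(sqrtFieldC (-(N : ℤ))) = 2 ∧
      NumberField.discr ↥(sqrtFieldC (-(N : ℤ))) = -(N : ℤ) ∧
      (∀ i : Fin (n + 1), (i : ℕ) < n → IsInertIn (sqrtFieldC (-(N : ℤ))) (q i)) ∧
      SplitsInC (sqrtFieldC (-(N : ℤ))) (q (Fin.last n))) ↔
    IsFundamental (-(N : ℤ)) ∧ ∀ p ∈ Finset.univ.image q, KroneckerNegEq (ε p) p N := by
  have hd : -(N : ℤ) < 0 := by omega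
  simp only [Finset.forall_mem_image, Finset.mem_univ, forall_const, hε]
  have key : IsFundamental (-(N : ℤ)) →
      (((∀ i : Fin (n + 1), (i : ℕ) < n → IsInertIn (sqrtFieldC (-(N : ℤ))) (q i)) ∧
        SplitsInC (sqrtFieldC (-(N : ℤ))) (q (Fin.last n))) ↔
      ∀ i : Fin (n + 1), KroneckerNegEq (if (i : ℕ) < n then -1 else 1) (q i) N) := by
    intro hf
    obtain ⟨s, hs⟩ := exists_four_mul_eq hf.1
    simp_rw [hf.isInertIn_iff hd hs (hq _), hf.splitsInC_iff hd hs (hq _),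
      ← kroneckerNegEq_neg_one_iff (hq _) hs, ← kroneckerNegEq_one_iff (hq _) hs]
    constructor
    · rintro ⟨h1, h2⟩ i
      split_ifs with hi
      · exact h1 i hi
      · rwa [show i = Fin.last n from Fin.ext (by have := i.2; simp; omega)]
    · intro h
      exact ⟨fun i hi => by simpa [hi] using h i, by simpa using h (Fin.last n)⟩
  constructor
  · rintro ⟨_, -, hdisc, h⟩
    have hf := isFundamental_of_discr_eq hd hdisc
    exact ⟨hf, (key hf).1 h⟩
  · rintro ⟨hf, h⟩
    obtain ⟨s, hs⟩ := exists_four_mul_eq hf.1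
    have := numberField_sqrtFieldC hd hs
    exact ⟨this, finrank_sqrtFieldC hd hs, hf.discr_eq hd, (key hf).2 h⟩

open Classical in
lemma ncard_neg_int_eq_card {D : ℤ → Prop} {P : ℕ → Prop}
    (h : ∀ N : ℕ, 0 < N → (D (-(N : ℤ)) ↔ P N)) (x : ℝ) :
    {d : ℤ | |(d : ℝ)| < x ∧ d < 0 ∧ D d}.ncard = ((Finset.Ico 1 ⌈x⌉₊).filter P).card := by
  have himage : {d : ℤ | |(d : ℝ)| < x ∧ d < 0 ∧ D d} =
      (fun N : ℕ => -(N : ℤ)) '' ((Finset.Ico 1 ⌈x⌉₊).filter P : Finset ℕ) := by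
    ext d
    simp only [Set.mem_ofPred_eq, Set.mem_image, Finset.mem_coe, Finset.mem_filter, Finset.mem_Ico,
      Nat.lt_ceil]
    constructor
    · rintro ⟨hx, hd, hD⟩
      obtain ⟨N, rfl⟩ : ∃ N : ℕ, d = -(N : ℤ) := ⟨d.natAbs, by omega⟩
      have hN : 0 < N := by omega
      refine ⟨N, ⟨⟨hN, ?_⟩, (h N hN).1 hD⟩, rfl⟩
      simpa using hx
    · rintro ⟨N, ⟨⟨hN, hx⟩, hP⟩, rfl⟩
      exact ⟨by simpa using hx, by omega, (h N hN).2 hP⟩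
  rw [himage, Set.ncard_image_of_injective _ fun a b hab => by simpa using hab,
    Set.ncard_coe_finset]

/-- Given distinct primes `q₁, …, q_{n+1}`, the number of imaginary quadratic fields `k`
(counted by their discriminants `d`) with `|Δ_k| < x` in which `q₁, …, qₙ` are inert and
`q_{n+1}` splits is asymptotic to `c·x` for some constant `c ≥ (3/π²)·3^{-(n+1)}`. -/
theorem count_imaginary_quadratic_with_splitting_conditions
    (n : ℕ) (q : Fin (n + 1) → ℕ) (hq : ∀ i, (q i).Prime)
    (hinj : Function.Injective q) :
    ∃ c : ℝ, 3 / Real.pi ^ 2 * (1 / 3 ^ (n + 1)) ≤ c ∧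
      Filter.Tendsto
        (fun x : ℝ =>
          ({d : ℤ | |(d : ℝ)| < x ∧ d < 0 ∧
              ∃ _ : NumberField ↥(sqrtFieldC d),
                Module.finrank ℚ ↥(sqrtFieldC d) = 2 ∧
                NumberField.discr ↥(sqrtFieldC d) = d ∧
                (∀ i : Fin (n + 1), (i : ℕ) < n → IsInertIn (sqrtFieldC d) (q i)) ∧
                SplitsInC (sqrtFieldC d) (q (Fin.last n))}.ncard : ℝ) / x)
        Filter.atTop (nhds c) := by
  classical
  set T := Finset.univ.image q with hTdef
  set ε : ℕ → ℤ := fun p => if p = q (Fin.last n) then 1 else -1 with hεdef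
  have hT : ∀ p ∈ T, p.Prime := by
    simpa [hTdef] using hq
  have hε : ∀ p, ε p = 1 ∨ ε p = -1 := fun p => by
    simp only [hεdef]
    split_ifs <;> simp
  have hε0 : ∀ p, ε p ≠ 0 := fun p => by rcases hε p with h | h <;> simp [h]
  have hεq : ∀ i : Fin (n + 1), ε (q i) = if (i : ℕ) < n then -1 else 1 := fun i => by
    have hlast : i = Fin.last n ↔ ¬ (i : ℕ) < n := by
      rw [Fin.ext_iff, Fin.val_last]
      have := i.2
      omega
    simp only [hεdef, hinj.eq_iff, hlast]
    split_ifs <;> simp_all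
  have hcard : T.card = n + 1 := by
    rw [hTdef, Finset.card_image_of_injective _ hinj, Finset.card_univ, Fintype.card_fin]
  refine ⟨6 / Real.pi ^ 2 * ∏ p ∈ insert 2 T, localDensity T ε p, ?_, ?_⟩
  · have h := le_prod_localDensity hT hε
    rw [hcard] at h
    calc 3 / Real.pi ^ 2 * (1 / 3 ^ (n + 1)) =
          6 / Real.pi ^ 2 * (1 / 2 * (1 / 3) ^ (n + 1)) := by
          rw [one_div_pow]
          ring
      _ ≤ _ := by gcongr
  · have hcount := ncard_neg_int_eq_card
      (D := fun d => ∃ _ : NumberField ↥(sqrtFieldC d),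
        Module.finrank ℚ ↥(sqrtFieldC d) = 2 ∧
        NumberField.discr ↥(sqrtFieldC d) = d ∧
        (∀ i : Fin (n + 1), (i : ℕ) < n → IsInertIn (sqrtFieldC d) (q i)) ∧
        SplitsInC (sqrtFieldC d) (q (Fin.last n)))
      (P := fun N => IsFundamental (-(N : ℤ)) ∧ ∀ p ∈ T, KroneckerNegEq (ε p) p N)
      fun N hN => exists_numberField_sqrtFieldC_iff hq hεq hN
    simp_rw [hcount]
    have h := ((tendsto_card_isFundamental_div hT hε0).comp tendsto_nat_ceil_atTop).mul
      (tendsto_nat_ceil_div_atTop (R := ℝ))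
    rw [mul_one] at h
    refine h.congr' ?_
    filter_upwards [Filter.eventually_gt_atTop 0] with x hx
    have hx' : (⌈x⌉₊ : ℝ) ≠ 0 := by
      exact_mod_cast (Nat.ceil_pos.2 hx).ne'
    simp only [Function.comp_apply]
    field_simp
    congr!
end

section
/- Let ℓ be a rational prime. The number of quadratic fields k (real or imaginary, counted by their discriminants) with |Δ_k| ≤ x in which ℓ ramifies is asymptotic to (1/(ℓ+1))·(6/π²)·x as x → ∞; equivalently, the proportion of quadratic fields with |Δ_k| ≤ x in which ℓ ramifies tends to 1/(ℓ+1) as x → ∞. -/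
open NumberField

/-- A rational prime `ℓ` *ramifies* in the number field `K ⊂ ℂ` if `ℓ O_K = 𝔮²` for some
prime ideal `𝔮` of `O_K`. -/
def RamifiesInC (K : IntermediateField ℚ ℂ) (ℓ : ℕ) : Prop :=
  ∃ Q : Ideal (𝓞 ↥K), Q.IsPrime ∧ Ideal.span {(ℓ : 𝓞 ↥K)} = Q ^ 2

section

open Module Filter Topology

theorem ramifies_iff_dvd_discr {K : Type*} [Field K] [NumberField K]
    (h2 : Module.finrank ℚ K = 2) {ℓ : ℕ} (hℓ : ℓ.Prime) :
    (∃ Q : Ideal (𝓞 K), Q.IsPrime ∧ Ideal.span {(ℓ : 𝓞 K)} = Q ^ 2) ↔ (ℓ : ℤ) ∣ discr K := by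
  have hp : Prime (ℓ : ℤ) := Nat.prime_iff_prime_int.mp hℓ
  have hne : Ideal.span {(ℓ : ℤ)} ≠ ⊥ := by
    simpa [Ideal.span_singleton_eq_bot] using hℓ.ne_zero
  have hmax : (Ideal.span {(ℓ : ℤ)}).IsMaximal :=
    ((Ideal.span_singleton_prime hp.ne_zero).mpr hp).isMaximal hne
  have hmap : (Ideal.span {(ℓ : ℤ)}).map (algebraMap ℤ (𝓞 K)) = Ideal.span {(ℓ : 𝓞 K)} := by
    simp [Ideal.map_span]
  have hnorm : (Ideal.span {(ℓ : 𝓞 K)}).absNorm = ℓ ^ 2 := by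
    rw [Ideal.absNorm_span_singleton]
    have := Algebra.norm_algebraMap (R := ℤ) (S := 𝓞 K) ℓ
    have hf : Module.finrank ℤ (𝓞 K) = 2 := by rw [RingOfIntegers.rank, h2]
    simp only [eq_intCast, Int.cast_natCast] at this
    rw [this, hf]; simp [Int.natAbs_pow]
  constructor
  · rintro ⟨Q, -, hQ2⟩
    have hQ : Q.absNorm = ℓ := by
      have := hnorm
      rw [hQ2, map_pow] at this
      exact Nat.pow_left_injective two_ne_zero this
    have hd : Q ^ (2 - 1) ∣ differentIdeal ℤ (𝓞 K) :=
      pow_sub_one_dvd_differentIdeal ℤ Q 2 hne (by rw [hmap, hQ2])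
    have := Ideal.absNorm_dvd_absNorm_of_le (Ideal.dvd_iff_le.mp hd)
    rw [absNorm_differentIdeal K, map_pow, hQ] at this
    simpa [Int.natCast_dvd] using this
  · intro h
    rw [← Int.dvd_natAbs, ← absNorm_differentIdeal K (𝓞 K)] at h
    obtain ⟨P, hP, h₁, h₂⟩ := Ideal.exists_isMaximal_dvd_of_dvd_absNorm hp _ h
    refine ⟨P, hP.isPrime, ?_⟩
    have hlP : (ℓ : 𝓞 K) ∈ P := by
      have : (ℓ : ℤ) ∈ P.under ℤ := h₁ ▸ Ideal.mem_span_singleton_self _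
      simpa [Ideal.mem_comap] using this
    have hPd : P ∣ Ideal.span {(ℓ : 𝓞 K)} :=
      Ideal.dvd_iff_le.mpr ((Ideal.span_singleton_le_iff_mem _).mpr hlP)
    obtain ⟨Q, hQ⟩ := hPd
    have hfin : Finite (ℤ ⧸ Ideal.span {(ℓ : ℤ)}) :=
      Ideal.finiteQuotientOfFreeOfNeBot _ hne
    have hQP : Q ≤ P := by
      by_contra hcon
      refine not_dvd_differentIdeal_of_isCoprime (p := Ideal.span {(ℓ : ℤ)}) (A := ℤ) P Q ?_
        (by rw [hmap, hQ]) h₂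
      exact Ideal.isCoprime_iff_sup_eq.mpr (hP.1.2 _ (left_lt_sup.mpr hcon))
    obtain ⟨J, rfl⟩ := Ideal.dvd_iff_le.mpr hQP
    rw [hQ, ← mul_assoc, ← sq]
    have hn : P.absNorm ^ 2 * J.absNorm = ℓ ^ 2 := by
      rw [← hnorm, hQ]; simp only [map_mul]; ring
    have hP1 : P.absNorm ≠ 1 := fun h => hP.ne_top (Ideal.absNorm_eq_one_iff.mp h)
    have hPl' : P.absNorm = ℓ := by
      have h1 : P.absNorm ^ 2 ∣ ℓ ^ 2 := hn ▸ Dvd.intro _ rfl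
      have h2 := (Nat.pow_dvd_pow_iff two_ne_zero).mp h1
      exact ((Nat.dvd_prime hℓ).mp h2).resolve_left hP1
    rw [hPl'] at hn
    have hJ : J.absNorm = 1 :=
      Nat.eq_of_mul_eq_mul_left (pow_pos hℓ.pos 2) (by rw [hn, mul_one])
    rw [Ideal.absNorm_eq_one_iff.mp hJ]; simp

section
variable {K : Type*} [Field K] [NumberField K] {s : K} {m : ℤ}

theorem exists_basis_one_sqrt (h2 : finrank ℚ K = 2) (hs : s ^ 2 = m)
    (hm : ¬ IsSquare m) : ∃ b : Basis (Fin 2) ℚ K, b 0 = 1 ∧ b 1 = s := by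
  have hli : LinearIndependent ℚ ![(1 : K), s] := by
    rw [LinearIndependent.pair_iff' one_ne_zero]
    intro q hq
    apply hm
    rw [← Rat.isSquare_intCast_iff]
    refine ⟨q, ?_⟩
    apply (algebraMap ℚ K).injective
    rw [Algebra.smul_def, mul_one] at hq
    rw [map_mul, hq, ← sq, hs]; simp
  refine ⟨basisOfLinearIndependentOfCardEqFinrank hli (by simp [h2]), ?_, ?_⟩ <;> simp

theorem exists_coords (h2 : finrank ℚ K = 2) (hs : s ^ 2 = m) (hm : ¬ IsSquare m) (z : K) :
    ∃ x y : ℚ, z = x + y * s := by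
  obtain ⟨b, h0, h1⟩ := exists_basis_one_sqrt h2 hs hm
  refine ⟨b.repr z 0, b.repr z 1, ?_⟩
  conv_lhs => rw [← b.sum_repr z]
  simp [Fin.sum_univ_two, h0, h1, Algebra.smul_def]

theorem coords_unique (hs : s ^ 2 = m) (hm : ¬ IsSquare m)
    {x y x' y' : ℚ} (h : (x + y * s : K) = x' + y' * s) : x = x' ∧ y = y' := by
  have hy : y = y' := by
    by_contra hne
    apply hm
    have hne' : (y - y' : K) ≠ 0 := by exact_mod_cast sub_ne_zero.mpr hne
    have e : ((x' - x) / (y - y') : ℚ) = s := by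
      push_cast
      rw [div_eq_iff hne']; linear_combination -h
    rw [← Rat.isSquare_intCast_iff]
    refine ⟨(x' - x) / (y - y'), ?_⟩
    rw [← e] at hs
    rw [← sq]
    exact_mod_cast hs.symm
  subst hy
  exact ⟨by exact_mod_cast add_right_cancel h, rfl⟩

theorem trace_add_mul_sqrt (h2 : finrank ℚ K = 2) (hs : s ^ 2 = m) (hm : ¬ IsSquare m)
    (x y : ℚ) : Algebra.trace ℚ K (x + y * s) = 2 * x := by
  obtain ⟨b, h0, h1⟩ := exists_basis_one_sqrt h2 hs hm
  have hts : Algebra.trace ℚ K s = 0 := by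
    rw [Algebra.trace_eq_matrix_trace b, Matrix.trace, Fin.sum_univ_two]
    have e0 : s * b 0 = b 1 := by rw [h0, h1, mul_one]
    have e1 : s * b 1 = (m : ℚ) • b 0 := by rw [h0, h1, ← sq, hs, Algebra.smul_def]; simp
    simp [Algebra.leftMulMatrix_eq_repr_mul, e0, e1]
  have hx : (x + y * s : K) = algebraMap ℚ K x + y • s := by
    rw [Algebra.smul_def]; simp
  rw [hx, map_add, map_smul, hts, Algebra.trace_algebraMap, h2]; simp

theorem exists_integral_coords (h2 : finrank ℚ K = 2) (hs : s ^ 2 = m) (hm : ¬ IsSquare m) :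
    ∃ x₀ y₀ x₁ y₁ : ℚ, IsIntegral ℤ (x₀ + y₀ * s : K) ∧ IsIntegral ℤ (x₁ + y₁ * s : K) ∧
      (discr K : ℚ) = 4 * m * (x₀ * y₁ - x₁ * y₀) ^ 2 ∧
      ∀ z : K, IsIntegral ℤ z → ∃ p q : ℤ, z = p * (x₀ + y₀ * s) + q * (x₁ + y₁ * s) := by
  have hc : Fintype.card (Free.ChooseBasisIndex ℤ (𝓞 K)) = 2 := by
    rw [← finrank_eq_card_chooseBasisIndex, RingOfIntegers.rank, h2]
  let B : Basis (Fin 2) ℤ (𝓞 K) := (RingOfIntegers.basis K).reindex (Fintype.equivFinOfCardEq hc)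
  obtain ⟨x₀, y₀, h0⟩ := exists_coords h2 hs hm (B 0 : K)
  obtain ⟨x₁, y₁, h1⟩ := exists_coords h2 hs hm (B 1 : K)
  refine ⟨x₀, y₀, x₁, y₁, h0 ▸ (B 0).isIntegral_coe, h1 ▸ (B 1).isIntegral_coe, ?_, ?_⟩
  · have htr (i j : Fin 2) : ((Algebra.trace ℤ (𝓞 K) (B i * B j) : ℤ) : ℚ) =
        Algebra.trace ℚ K ((B i : K) * (B j : K)) := by
      have := Algebra.trace_localization ℤ (nonZeroDivisors ℤ) (Rₘ := ℚ) (Sₘ := K) (B i * B j)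
      rw [map_mul] at this
      exact this.symm
    have hmul (x y x' y' : ℚ) : Algebra.trace ℚ K ((x + y * s) * (x' + y' * s)) =
        2 * (x * x' + m * (y * y')) := by
      rw [← trace_add_mul_sqrt h2 hs hm _ (x * y' + y * x')]
      congr 1
      push_cast
      linear_combination (y * y' : K) * hs
    rw [← discr_eq_discr K B, Algebra.discr_def, Matrix.det_fin_two]
    simp only [Algebra.traceMatrix_apply, Algebra.traceForm_apply]
    push_cast
    rw [htr, htr, htr, htr, h0, h1, hmul, hmul, hmul, hmul]
    ring
  · intro z hz
    refine ⟨B.repr ⟨z, hz⟩ 0, B.repr ⟨z, hz⟩ 1, ?_⟩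
    have := congrArg (algebraMap (𝓞 K) K) (B.sum_repr ⟨z, hz⟩)
    simp only [Fin.sum_univ_two, map_add, zsmul_eq_mul, map_mul, map_intCast] at this
    rw [← h0, ← h1]
    exact this.symm

/-- The discriminant `4 m y²` of the lattice `ℤ + ℤ (x + y √m)` is a square multiple of the
field discriminant. -/
theorem exists_index_sq (h2 : finrank ℚ K = 2) (hs : s ^ 2 = m) (hm : ¬ IsSquare m)
    {x y : ℚ} (hxy : IsIntegral ℤ (x + y * s : K)) :
    ∃ t : ℤ, (4 * m * y ^ 2 : ℚ) = t ^ 2 * discr K := by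
  obtain ⟨x₀, y₀, x₁, y₁, -, -, hd, hspan⟩ := exists_integral_coords h2 hs hm
  obtain ⟨p, q, h1⟩ := hspan 1 isIntegral_one
  obtain ⟨r, w, h2⟩ := hspan _ hxy
  have e1 : p * x₀ + q * x₁ = 1 ∧ p * y₀ + q * y₁ = 0 := by
    apply coords_unique hs hm
    push_cast
    linear_combination -h1
  have e2 : r * x₀ + w * x₁ = x ∧ r * y₀ + w * y₁ = y := by
    apply coords_unique hs hm
    push_cast
    linear_combination -h2
  refine ⟨p * w - q * r, ?_⟩
  have : y = (p * w - q * r) * (x₀ * y₁ - x₁ * y₀) := by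
    obtain ⟨e1, e1'⟩ := e1
    obtain ⟨e2, e2'⟩ := e2
    linear_combination -e2' + (r * y₀ + w * y₁) * -e1 + (r * x₀ + w * x₁) * e1'
  rw [hd, this]; push_cast; ring

theorem isInt_of_isIntegral_ratCast {q : ℚ} (h : IsIntegral ℤ (q : K)) : ∃ n : ℤ, q = n := by
  have h' : IsIntegral ℤ (algebraMap ℚ K q) := by simpa using h
  rw [isIntegral_algebraMap_iff (algebraMap ℚ K).injective] at h'
  obtain ⟨n, hn⟩ := IsIntegrallyClosed.isIntegral_iff.mp h'
  exact ⟨n, by simpa using hn.symm⟩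

/-- Stickelberger's congruence for quadratic fields. -/
theorem discr_eq_sq_sub_four_mul (h2 : finrank ℚ K = 2) (hs : s ^ 2 = m) (hm : ¬ IsSquare m) :
    ∃ a n : ℤ, discr K = a ^ 2 - 4 * n := by
  obtain ⟨x₀, y₀, x₁, y₁, hi0, hi1, hd, -⟩ := exists_integral_coords h2 hs hm
  have key {x y : ℚ} (hi : IsIntegral ℤ (x + y * s : K)) : ∃ t : ℤ, 2 * x = t := by
    have := Algebra.isIntegral_trace (L := ℚ) hi
    rw [trace_add_mul_sqrt h2 hs hm] at this
    obtain ⟨n, hn⟩ := IsIntegrallyClosed.isIntegral_iff.mp this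
    exact ⟨n, by simpa using hn.symm⟩
  have key2 {x y : ℚ} (hi : IsIntegral ℤ (x + y * s : K)) : ∃ n : ℤ, x ^ 2 - m * y ^ 2 = n := by
    obtain ⟨t, ht⟩ := key hi
    have htK : (2 * x : K) = t := by exact_mod_cast congrArg (Rat.cast : ℚ → K) ht
    have : IsIntegral ℤ ((x ^ 2 - m * y ^ 2 : ℚ) : K) := by
      have e : ((x ^ 2 - m * y ^ 2 : ℚ) : K) = (x + y * s) * (t - (x + y * s)) := by
        push_cast
        linear_combination (y ^ 2 : K) * hs + (x + y * s) * htK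
      rw [e]
      exact hi.mul ((isIntegral_algebraMap (R := ℤ) (x := t)).sub hi)
    exact isInt_of_isIntegral_ratCast this
  obtain ⟨t0, ht0⟩ := key hi0
  obtain ⟨t1, ht1⟩ := key hi1
  obtain ⟨n0, hn0⟩ := key2 hi0
  obtain ⟨n1, hn1⟩ := key2 hi1
  have hi : IsIntegral ℤ
      ((x₀ * x₁ + m * y₀ * y₁ : ℚ) + (x₀ * y₁ + x₁ * y₀ : ℚ) * s : K) := by
    have e : ((x₀ * x₁ + m * y₀ * y₁ : ℚ) + (x₀ * y₁ + x₁ * y₀ : ℚ) * s : K) =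
        (x₀ + y₀ * s) * (x₁ + y₁ * s) := by
      push_cast
      linear_combination -(y₀ * y₁ : K) * hs
    exact e ▸ hi0.mul hi1
  obtain ⟨u, hu⟩ := key hi
  refine ⟨t0 * t1 - u, n0 * n1, ?_⟩
  have : (discr K : ℚ) = ((t0 * t1 - u : ℤ) : ℚ) ^ 2 - 4 * ((n0 * n1 : ℤ) : ℚ) := by
    rw [hd]; push_cast
    rw [← ht0, ← ht1, ← hn0, ← hn1, ← hu]; ring
  exact_mod_cast this

theorem Int.sq_eq_one_of_squarefree {m t n : ℤ} (hsf : Squarefree m) (h : m = t ^ 2 * n) :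
    t ^ 2 = 1 := by
  have : IsUnit t := hsf t ⟨n, by rw [h]; ring⟩
  rcases Int.isUnit_iff.mp this with rfl | rfl <;> norm_num

theorem Int.emod_four_ne_zero_of_squarefree {m : ℤ} (hsf : Squarefree m) : m % 4 ≠ 0 := by
  intro h
  have : IsUnit (2 : ℤ) := hsf 2 (by omega)
  rcases Int.isUnit_iff.mp this with h | h <;> omega

theorem discr_eq_of_emod_four_eq_one (h2 : finrank ℚ K = 2) (hs : s ^ 2 = m) (hm : ¬ IsSquare m)
    (hsf : Squarefree m) (h4 : m % 4 = 1) : discr K = m := by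
  have hxy : IsIntegral ℤ ((1 / 2 : ℚ) + (1 / 2 : ℚ) * s : K) := by
    obtain ⟨k, hk⟩ : ∃ k, m = 4 * k + 1 := ⟨m / 4, by omega⟩
    refine ⟨Polynomial.X ^ 2 - Polynomial.X - Polynomial.C k, by monicity!, ?_⟩
    have hkK : (m : K) = 4 * k + 1 := by exact_mod_cast congrArg (Int.cast : ℤ → K) hk
    simp only [Polynomial.eval₂_sub, Polynomial.eval₂_X_pow, Polynomial.eval₂_X, Polynomial.eval₂_C]
    push_cast [eq_intCast]
    linear_combination 1 / 4 * hs + 1 / 4 * hkK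
  obtain ⟨t, ht⟩ := exists_index_sq h2 hs hm hxy
  have ht' : m = t ^ 2 * discr K := by
    have : (m : ℚ) = t ^ 2 * discr K := by rw [← ht]; ring
    exact_mod_cast this
  rw [Int.sq_eq_one_of_squarefree hsf ht', one_mul] at ht'
  exact ht'.symm

theorem discr_eq_of_emod_four_ne_one (h2 : finrank ℚ K = 2) (hs : s ^ 2 = m) (hm : ¬ IsSquare m)
    (hsf : Squarefree m) (h4 : m % 4 ≠ 1) : discr K = 4 * m := by
  have hxy : IsIntegral ℤ ((0 : ℚ) + (1 : ℚ) * s : K) := by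
    refine ⟨Polynomial.X ^ 2 - Polynomial.C m, by monicity!, ?_⟩
    simp only [Polynomial.eval₂_sub, Polynomial.eval₂_X_pow, Polynomial.eval₂_C]
    simp [hs]
  obtain ⟨t, ht⟩ := exists_index_sq h2 hs hm hxy
  have ht' : 4 * m = t ^ 2 * discr K := by
    have : (4 * m : ℚ) = t ^ 2 * discr K := by rw [← ht]; ring
    exact_mod_cast this
  rcases Int.even_or_odd' t with ⟨u, rfl | rfl⟩
  · have hu : m = u ^ 2 * discr K := by linarith
    rw [Int.sq_eq_one_of_squarefree hsf hu, one_mul] at hu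
    obtain ⟨a, n, han⟩ := discr_eq_sq_sub_four_mul h2 hs hm
    have h0 := Int.emod_four_ne_zero_of_squarefree hsf
    rw [← hu] at han
    rcases Int.even_or_odd' a with ⟨c, rfl | rfl⟩ <;> ring_nf at han <;> omega
  · have hco : IsCoprime ((2 * u + 1) ^ 2) (4 : ℤ) := ⟨1, -(u ^ 2 + u), by ring⟩
    obtain ⟨n, hn⟩ := hco.dvd_of_dvd_mul_left ⟨_, ht'⟩
    rw [Int.sq_eq_one_of_squarefree hsf hn, one_mul] at ht'
    exact ht'.symm

end

/-- Fundamental discriminants, including `1`. -/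
def IsFundDiscr (d : ℤ) : Prop :=
  (Squarefree d ∧ d % 4 = 1) ∨ ∃ m : ℤ, d = 4 * m ∧ Squarefree m ∧ m % 4 ≠ 1

theorem Int.eq_one_of_squarefree_of_isSquare {m : ℤ} (hsf : Squarefree m) (h : IsSquare m) :
    m = 1 := by
  obtain ⟨a, rfl⟩ := h
  have := Int.sq_eq_one_of_squarefree (t := a) (n := 1) hsf (by ring)
  rwa [sq] at this

theorem Int.exists_eq_sq_mul_squarefree {d : ℤ} (hd : d ≠ 0) :
    ∃ f m : ℤ, f ≠ 0 ∧ d = f ^ 2 * m ∧ Squarefree m := by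
  obtain ⟨a, b, h, hsf⟩ := Nat.sq_mul_squarefree d.natAbs
  have hb : b ≠ 0 := by
    rintro rfl
    exact hd (by simpa using h.symm)
  refine ⟨b, d.sign * a, by exact_mod_cast hb, ?_, ?_⟩
  · calc d = d.sign * (d.natAbs : ℤ) := (Int.sign_mul_natAbs d).symm
      _ = b ^ 2 * (d.sign * a) := by rw [← h]; push_cast; ring
  · rw [← Int.squarefree_natAbs, Int.natAbs_mul, Int.natAbs_sign_of_ne_zero hd, one_mul]
    simpa

theorem isFundDiscr_discr {K : Type*} [Field K] [NumberField K] {s : K} {d : ℤ}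
    (h2 : finrank ℚ K = 2) (hs : s ^ 2 = d) (hd : ¬ IsSquare d) : IsFundDiscr (discr K) := by
  obtain ⟨f, m, hf, rfl, hsf⟩ := Int.exists_eq_sq_mul_squarefree
    (show d ≠ 0 by rintro rfl; exact hd ⟨0, rfl⟩)
  have hm : ¬ IsSquare m := fun h => hd ((IsSquare.sq f).mul h)
  have hs' : (s / f) ^ 2 = m := by
    have : (f : K) ≠ 0 := by exact_mod_cast hf
    rw [div_pow, hs]; push_cast; field_simp
  by_cases h4 : m % 4 = 1
  · rw [discr_eq_of_emod_four_eq_one h2 hs' hm hsf h4]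
    exact .inl ⟨hsf, h4⟩
  · rw [discr_eq_of_emod_four_ne_one h2 hs' hm hsf h4]
    exact .inr ⟨m, rfl, hsf, h4⟩

theorem IsFundDiscr.not_isSquare {d : ℤ} (h : IsFundDiscr d) (h1 : d ≠ 1) : ¬ IsSquare d := by
  rintro hsq
  obtain ⟨hsf, -⟩ | ⟨m, rfl, hsf, h4⟩ := h
  · exact h1 (Int.eq_one_of_squarefree_of_isSquare hsf hsq)
  · have : IsSquare m := by
      obtain ⟨a, ha⟩ := hsq
      rcases Int.even_or_odd' a with ⟨c, rfl | rfl⟩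
      · exact ⟨c, by linarith⟩
      · ring_nf at ha; omega
    rw [Int.eq_one_of_squarefree_of_isSquare hsf this] at h4
    exact h4 rfl

theorem IsFundDiscr.discr_eq {K : Type*} [Field K] [NumberField K] {s : K} {d : ℤ}
    (h : IsFundDiscr d) (h2 : finrank ℚ K = 2) (hs : s ^ 2 = d) (hd : ¬ IsSquare d) :
    discr K = d := by
  obtain ⟨hsf, h4⟩ | ⟨m, rfl, hsf, h4⟩ := h
  · exact discr_eq_of_emod_four_eq_one h2 hs hd hsf h4
  · refine discr_eq_of_emod_four_ne_one (s := s / 2) h2 ?_ (fun h => hd ?_) hsf h4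
    · rw [div_pow, hs]; push_cast; ring
    · exact IsSquare.mul ⟨2, rfl⟩ h

theorem exists_sq_eq_sqrtFieldC (d : ℤ) : ∃ s : sqrtFieldC d, s ^ 2 = d := by
  obtain ⟨z, hz⟩ := IsAlgClosed.exists_pow_nat_eq (d : ℂ) zero_lt_two
  exact ⟨⟨z, IntermediateField.subset_adjoin ℚ _ hz⟩, Subtype.ext (by simpa using hz)⟩

theorem sqrtFieldC_eq_adjoin_simple {d : ℤ} {z : ℂ} (hz : z ^ 2 = d) :
    sqrtFieldC d = IntermediateField.adjoin ℚ {z} := by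
  apply le_antisymm
  · refine IntermediateField.adjoin_le_iff.mpr fun w hw => ?_
    have hw' : w ^ 2 = z ^ 2 := by rw [hz]; exact hw
    have hmem := IntermediateField.mem_adjoin_simple_self ℚ z
    rcases sq_eq_sq_iff_eq_or_eq_neg.mp hw' with rfl | rfl
    · exact hmem
    · exact neg_mem hmem
  · refine IntermediateField.adjoin_le_iff.mpr ?_
    rintro _ rfl
    exact IntermediateField.subset_adjoin ℚ _ hz

theorem isIntegral_of_sq_eq_intCast {d : ℤ} {z : ℂ} (hz : z ^ 2 = d) : IsIntegral ℚ z :=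
  ⟨Polynomial.X ^ 2 - Polynomial.C (d : ℚ), by monicity!, by
    simp only [Polynomial.eval₂_sub, Polynomial.eval₂_X_pow, Polynomial.eval₂_C, hz]
    simp⟩

theorem numberField_sqrtFieldC_s13 (d : ℤ) : NumberField (sqrtFieldC d) := by
  obtain ⟨z, hz⟩ := IsAlgClosed.exists_pow_nat_eq (d : ℂ) zero_lt_two
  rw [sqrtFieldC_eq_adjoin_simple hz]
  have := IntermediateField.adjoin.finiteDimensional (isIntegral_of_sq_eq_intCast hz)
  exact ⟨⟩

theorem finrank_sqrtFieldC_eq_two_iff (d : ℤ) :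
    finrank ℚ (sqrtFieldC d) = 2 ↔ ¬ IsSquare d := by
  obtain ⟨z, hz⟩ := IsAlgClosed.exists_pow_nat_eq (d : ℂ) zero_lt_two
  rw [sqrtFieldC_eq_adjoin_simple hz]
  constructor
  · rintro h ⟨a, rfl⟩
    have hza : z ^ 2 = (a : ℂ) ^ 2 := by rw [hz]; push_cast; ring
    have hbot : IntermediateField.adjoin ℚ {z} = ⊥ := by
      rw [IntermediateField.adjoin_simple_eq_bot_iff, IntermediateField.mem_bot]
      rcases sq_eq_sq_iff_eq_or_eq_neg.mp hza with rfl | rfl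
      · exact ⟨a, by simp⟩
      · exact ⟨-a, by simp⟩
    rw [hbot, IntermediateField.finrank_bot] at h
    omega
  · intro hd
    rw [IntermediateField.adjoin.finrank (isIntegral_of_sq_eq_intCast hz)]
    have hmon : (Polynomial.X ^ 2 - Polynomial.C (d : ℚ)).Monic := by monicity!
    have hdeg : (Polynomial.X ^ 2 - Polynomial.C (d : ℚ)).natDegree = 2 := by compute_degree!
    have hirr : Irreducible (Polynomial.X ^ 2 - Polynomial.C (d : ℚ)) := by
      refine Polynomial.irreducible_of_degree_le_three_of_not_isRoot (by rw [hdeg]; decide) ?_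
      intro q hq
      apply hd
      rw [← Rat.isSquare_intCast_iff]
      refine ⟨q, ?_⟩
      have : q ^ 2 - d = 0 := by simpa using hq
      linear_combination -this
    rw [← minpoly.eq_of_irreducible_of_monic hirr (by simp [hz]) hmon, hdeg]

theorem Nat.dvd_of_sq_dvd_sq_mul_squarefree {a b d : ℕ} (hb : b ≠ 0) (ha : Squarefree a)
    (h : d ^ 2 ∣ b ^ 2 * a) : d ∣ b := by
  have hd : d ≠ 0 := by
    rintro rfl
    simp [hb, ha.ne_zero] at h
  rw [← Nat.factorization_le_iff_dvd hd hb]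
  have h' := (Nat.factorization_le_iff_dvd (pow_ne_zero 2 hd)
    (mul_ne_zero (pow_ne_zero 2 hb) ha.ne_zero)).mpr h
  intro p
  have h1 := h' p
  have h2 := ha.natFactorization_le_one p
  rw [Nat.factorization_mul (pow_ne_zero 2 hb) ha.ne_zero] at h1
  simp [Nat.factorization_pow] at h1
  omega

theorem sum_moebius_sq_dvd {n N : ℕ} (hn : n ≠ 0) (hN : n ≤ N) :
    ∑ d ∈ Finset.Ioc 0 N with d ^ 2 ∣ n, ArithmeticFunction.moebius d =
      if Squarefree n then 1 else 0 := by
  obtain ⟨a, b, rfl, ha⟩ := Nat.sq_mul_squarefree n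
  have hb : b ≠ 0 := by rintro rfl; simp at hn
  have hset : {d ∈ Finset.Ioc 0 N | d ^ 2 ∣ b ^ 2 * a} = b.divisors := by
    ext d
    simp only [Finset.mem_filter, Finset.mem_Ioc, Nat.mem_divisors]
    constructor
    · rintro ⟨-, h⟩
      exact ⟨Nat.dvd_of_sq_dvd_sq_mul_squarefree hb ha h, hb⟩
    · rintro ⟨h, -⟩
      have h2 : d ^ 2 ∣ b ^ 2 * a := (pow_dvd_pow_of_dvd h 2).mul_right a
      refine ⟨⟨Nat.pos_of_dvd_of_pos h (Nat.pos_of_ne_zero hb), ?_⟩, h2⟩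
      exact ((Nat.le_self_pow two_ne_zero d).trans
        (Nat.le_of_dvd (Nat.pos_of_ne_zero hn) h2)).trans hN
  rw [hset]
  have := congrArg (fun f => f b) ArithmeticFunction.moebius_mul_coe_zeta
  simp only [ArithmeticFunction.one_apply, ArithmeticFunction.coe_mul_zeta_apply] at this
  rw [this]
  congr 1
  rw [eq_iff_iff]
  constructor
  · rintro rfl; simpa using ha
  · intro h
    exact Nat.isUnit_iff.mp (h b ⟨a, by ring⟩)

open Classical in
/-- The number of positive integers `n ≤ x` satisfying `P`. -/
noncomputable def countUpTo (P : ℕ → Prop) (x : ℝ) : ℝ :=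
  ∑ n ∈ Finset.Ioc 0 ⌊x⌋₊, if P n then 1 else 0

theorem countUpTo_squarefree (x : ℝ) : countUpTo Squarefree x =
    ∑' d : ℕ, (ArithmeticFunction.moebius d : ℝ) * (⌊x / (d ^ 2 : ℕ)⌋₊ : ℝ) := by
  classical
  rw [tsum_eq_sum (s := Finset.Ioc 0 ⌊x⌋₊)]
  · have h1 : ∀ n ∈ Finset.Ioc 0 ⌊x⌋₊, (if Squarefree n then (1 : ℝ) else 0) =
        ∑ d ∈ Finset.Ioc 0 ⌊x⌋₊, if d ^ 2 ∣ n then (ArithmeticFunction.moebius d : ℝ) else 0 := by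
      intro n hn
      rw [Finset.mem_Ioc] at hn
      rw [← Finset.sum_filter]
      have := sum_moebius_sq_dvd hn.1.ne' hn.2
      exact_mod_cast congrArg (Int.cast : ℤ → ℝ) this.symm
    have h2 : countUpTo Squarefree x = ∑ n ∈ Finset.Ioc 0 ⌊x⌋₊,
        if Squarefree n then (1 : ℝ) else 0 := by
      unfold countUpTo; congr!
    rw [h2, Finset.sum_congr rfl h1, Finset.sum_comm]
    refine Finset.sum_congr rfl fun d _ => ?_
    rw [← Finset.sum_filter, Finset.sum_const, Nat.Ioc_filter_dvd_card_eq_div,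
      Nat.floor_div_natCast, nsmul_eq_mul, mul_comm]
  · intro d hd
    rw [Finset.mem_Ioc, not_and_or, not_lt, Nat.le_zero, not_le] at hd
    rw [Nat.floor_div_natCast]
    rcases hd with rfl | hd
    · simp
    · rw [Nat.div_eq_of_lt (hd.trans_le (Nat.le_self_pow two_ne_zero d))]; simp

theorem tsum_moebius_div_sq :
    ∑' d : ℕ, (ArithmeticFunction.moebius d : ℝ) * ((d ^ 2 : ℕ) : ℝ)⁻¹ = 6 / Real.pi ^ 2 := by
  have h2 : (1 : ℝ) < (2 : ℂ).re := by norm_num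
  have h := LSeries_one_mul_Lseries_moebius h2
  rw [LSeries_one_eq_riemannZeta h2, riemannZeta_two] at h
  have hL : LSeries (fun n => (ArithmeticFunction.moebius n : ℂ)) 2 =
      ((∑' d : ℕ, (ArithmeticFunction.moebius d : ℝ) * ((d ^ 2 : ℕ) : ℝ)⁻¹ : ℝ) : ℂ) := by
    rw [LSeries, Complex.ofReal_tsum]
    refine tsum_congr fun d => ?_
    rw [LSeries.term_def]
    split_ifs with hd
    · simp [hd]
    · push_cast
      rw [div_eq_mul_inv]
      norm_cast
  rw [hL] at h
  have h' : Real.pi ^ 2 / 6 *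
      ∑' d : ℕ, (ArithmeticFunction.moebius d : ℝ) * ((d ^ 2 : ℕ) : ℝ)⁻¹ = 1 := by
    exact_mod_cast h
  have hpi := Real.pi_ne_zero
  field_simp at h' ⊢
  linarith

/-- The set of positive integers satisfying `P` has natural density `c`. -/
def HasDensity (P : ℕ → Prop) (c : ℝ) : Prop :=
  Tendsto (fun x : ℝ => countUpTo P x / x) atTop (𝓝 c)

theorem hasDensity_squarefree : HasDensity Squarefree (6 / Real.pi ^ 2) := by
  rw [HasDensity, ← tsum_moebius_div_sq]
  simp_rw [countUpTo_squarefree, ← tsum_div_const]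
  refine tendsto_tsum_of_dominated_convergence (bound := fun d : ℕ => ((d ^ 2 : ℕ) : ℝ)⁻¹) ?_ ?_ ?_
  · simp
  · intro d
    simp_rw [mul_div_assoc]
    refine Tendsto.const_mul _ ?_
    have := tendsto_nat_floor_mul_div_atTop (R := ℝ) (a := ((d ^ 2 : ℕ) : ℝ)⁻¹) (by positivity)
    simpa only [div_eq_inv_mul] using this
  · filter_upwards [eventually_gt_atTop 0] with x hx d
    rw [norm_div, norm_mul, Real.norm_of_nonneg hx.le, div_le_iff₀ hx]
    have h1 : ‖(ArithmeticFunction.moebius d : ℝ)‖ ≤ 1 := by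
      rw [Real.norm_eq_abs]
      exact_mod_cast ArithmeticFunction.abs_moebius_le_one
    have h2 : (⌊x / (d ^ 2 : ℕ)⌋₊ : ℝ) ≤ ((d ^ 2 : ℕ) : ℝ)⁻¹ * x := by
      rw [← div_eq_inv_mul]
      exact Nat.floor_le (by positivity)
    rw [Real.norm_of_nonneg (Nat.cast_nonneg _)]
    calc _ ≤ 1 * (⌊x / (d ^ 2 : ℕ)⌋₊ : ℝ) := by gcongr
      _ ≤ _ := by rw [one_mul]; exact h2

theorem countUpTo_nonneg (P : ℕ → Prop) (x : ℝ) : 0 ≤ countUpTo P x :=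
  Finset.sum_nonneg fun n _ => by split_ifs <;> norm_num

theorem countUpTo_le (P : ℕ → Prop) {x : ℝ} (hx : 0 ≤ x) : countUpTo P x ≤ x := by
  calc countUpTo P x ≤ ∑ n ∈ Finset.Ioc 0 ⌊x⌋₊, (1 : ℝ) :=
        Finset.sum_le_sum fun n _ => by split_ifs <;> norm_num
    _ = ⌊x⌋₊ := by simp
    _ ≤ x := Nat.floor_le hx

open Classical in
theorem countUpTo_congr {P R : ℕ → Prop} (h : ∀ n, 0 < n → (P n ↔ R n)) (x : ℝ) :
    countUpTo P x = countUpTo R x :=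
  Finset.sum_congr rfl fun n hn => if_congr (h n (Finset.mem_Ioc.mp hn).1) rfl rfl

open Classical in
theorem countUpTo_eq_card (P : ℕ → Prop) (x : ℝ) :
    countUpTo P x = (((Finset.Ioc 0 ⌊x⌋₊).filter P).card : ℝ) := by
  rw [Finset.card_eq_sum_ones, Finset.sum_filter, countUpTo]
  push_cast
  rfl

theorem countUpTo_dvd_and_div (P : ℕ → Prop) {k : ℕ} (hk : 0 < k) (x : ℝ) :
    countUpTo (fun n => k ∣ n ∧ P (n / k)) x = countUpTo P (x / k) := by
  classical
  rw [countUpTo_eq_card, countUpTo_eq_card, Nat.floor_div_natCast, Nat.cast_inj]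
  symm
  refine Finset.card_bij (fun n _ => k * n) ?_ ?_ ?_
  · intro n hn
    simp only [Finset.mem_filter, Finset.mem_Ioc] at hn ⊢
    obtain ⟨⟨h1, h2⟩, h3⟩ := hn
    refine ⟨⟨Nat.mul_pos hk h1, ?_⟩, dvd_mul_right _ _, by rwa [Nat.mul_div_cancel_left _ hk]⟩
    rw [mul_comm]; exact (Nat.le_div_iff_mul_le hk).mp h2
  · intro a _ b _ h
    exact Nat.eq_of_mul_eq_mul_left hk h
  · intro n hn
    simp only [Finset.mem_filter, Finset.mem_Ioc] at hn ⊢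
    obtain ⟨⟨h1, h2⟩, ⟨j, rfl⟩, h3⟩ := hn
    rw [Nat.mul_div_cancel_left _ hk] at h3
    refine ⟨j, ⟨⟨Nat.pos_of_mul_pos_left h1, ?_⟩, h3⟩, rfl⟩
    rw [Nat.le_div_iff_mul_le hk, mul_comm]; exact h2

theorem HasDensity.dvd_and_div {P : ℕ → Prop} {c : ℝ} (h : HasDensity P c) {k : ℕ} (hk : 0 < k) :
    HasDensity (fun n => k ∣ n ∧ P (n / k)) (c / k) := by
  have hk' : (0 : ℝ) < k := by exact_mod_cast hk
  have := (Tendsto.comp h (tendsto_id.atTop_div_const hk')).div_const (k : ℝ)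
  refine this.congr fun x => ?_
  simp only [Function.comp, id, countUpTo_dvd_and_div P hk]
  field_simp

theorem HasDensity.congr {P R : ℕ → Prop} {c : ℝ} (h : HasDensity P c)
    (hPR : ∀ n, 0 < n → (P n ↔ R n)) : HasDensity R c :=
  Tendsto.congr (fun x => by rw [countUpTo_congr hPR]) h

/-- If `f` grows at most linearly and `f(x) + f(x/p) ~ c x`, then `f(x) ~ c p / (p + 1) x`. -/
theorem tendsto_div_of_add_comp_div {f : ℝ → ℝ} {c p : ℝ} (hp : 2 ≤ p) (hf0 : ∀ x, 0 ≤ f x)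
    (hf1 : ∀ x, 0 ≤ x → f x ≤ x)
    (h : Tendsto (fun x => (f x + f (x / p)) / x) atTop (𝓝 c)) :
    Tendsto (fun x => f x / x) atTop (𝓝 (c * (p / (p + 1)))) := by
  set c' := c * (p / (p + 1)) with hc'
  have hcc : c = c' + c' / p := by rw [hc']; field_simp
  set M := 1 + |c'|
  have hbase : ∀ᶠ x in atTop, |f x / x - c'| ≤ M := by
    filter_upwards [eventually_gt_atTop 0] with x hx
    have h1 : |f x / x| ≤ 1 := by
      rw [abs_of_nonneg (div_nonneg (hf0 x) hx.le), div_le_one hx]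
      exact hf1 x hx.le
    exact (abs_sub _ _).trans (by simpa [M] using h1)
  have hstep {ε B : ℝ} (hε : 0 < ε) (hB : ∀ᶠ x in atTop, |f x / x - c'| ≤ B) :
      ∀ᶠ x in atTop, |f x / x - c'| ≤ B / 2 + ε := by
    have hdiv : Tendsto (fun x : ℝ => x / p) atTop atTop :=
      tendsto_id.atTop_div_const (by linarith)
    filter_upwards [hdiv.eventually hB, eventually_gt_atTop 0,
      (Metric.tendsto_nhds.mp h) ε hε] with x h1 hx h2
    rw [Real.dist_eq] at h2
    have e : f x / x - c' = ((f x + f (x / p)) / x - c) - (f (x / p) / (x / p) - c') / p := by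
      rw [hcc]; field_simp; ring
    rw [e]
    refine (abs_sub _ _).trans ?_
    rw [abs_div, abs_of_pos (show 0 < p by linarith)]
    have : |f (x / p) / (x / p) - c'| / p ≤ B / 2 :=
      div_le_div₀ ((abs_nonneg _).trans h1) h1 two_pos hp
    linarith
  have hall {ε : ℝ} (hε : 0 < ε) (k : ℕ) :
      ∀ᶠ x in atTop, |f x / x - c'| ≤ M / 2 ^ k + 2 * ε := by
    induction k with
    | zero => filter_upwards [hbase] with x hx; simp; linarith
    | succ k ih =>
      filter_upwards [hstep hε ih] with x hx
      refine hx.trans (le_of_eq ?_)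
      rw [pow_succ]; ring
  rw [Metric.tendsto_nhds]
  intro η hη
  obtain ⟨k, hk⟩ := exists_pow_lt_of_lt_one (show 0 < η / 2 / M by positivity)
    (show (1 / 2 : ℝ) < 1 by norm_num)
  have hk' : M / 2 ^ k < η / 2 := by
    rw [lt_div_iff₀ (by positivity), one_div, inv_pow] at hk
    rw [div_eq_inv_mul]; exact hk
  filter_upwards [hall (show 0 < η / 4 by positivity) k] with x hx
  rw [Real.dist_eq]; linarith

theorem hasDensity_squarefree_coprime_mul {q p : ℕ} {c : ℝ} (hp : p.Prime) (hpq : p.Coprime q)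
    (h : HasDensity (fun n => Squarefree n ∧ n.Coprime q) c) :
    HasDensity (fun n => Squarefree n ∧ n.Coprime (q * p)) (c * (p / (p + 1))) := by
  classical
  refine tendsto_div_of_add_comp_div (by exact_mod_cast hp.two_le) (countUpTo_nonneg _)
    (fun x => countUpTo_le _) (Tendsto.congr (fun x => ?_) h)
  rw [← countUpTo_dvd_and_div _ hp.pos]
  congr 1
  simp only [countUpTo]
  rw [← Finset.sum_add_distrib]
  refine Finset.sum_congr rfl fun n hn => ?_
  by_cases hpn : p ∣ n
  · obtain ⟨j, rfl⟩ := hpn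
    have h1 : ¬ (p * j).Coprime (q * p) := fun h =>
      hp.one_lt.ne' (Nat.eq_one_of_dvd_coprimes h (dvd_mul_right _ _) (dvd_mul_left _ _))
    have h2 : (Squarefree (p * j) ∧ (p * j).Coprime q) ↔ (Squarefree j ∧ j.Coprime (q * p)) := by
      rw [Nat.squarefree_mul_iff, Nat.coprime_mul_iff_left, Nat.coprime_mul_iff_right,
        Nat.coprime_comm (m := p) (n := j)]
      simp only [hp.prime.squarefree, true_and]
      tauto
    simp [h1, h2, Nat.mul_div_cancel_left _ hp.pos]
  · have h1 : n.Coprime p := Nat.Coprime.symm ((Nat.Prime.coprime_iff_not_dvd hp).mpr hpn)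
    have h2 : n.Coprime (q * p) ↔ n.Coprime q := by
      rw [Nat.coprime_mul_iff_right]; exact and_iff_left h1
    simp [hpn, h2]

theorem hasDensity_odd_squarefree :
    HasDensity (fun n => Squarefree n ∧ n.Coprime 2) (6 / Real.pi ^ 2 * (2 / 3)) := by
  have := hasDensity_squarefree_coprime_mul (q := 1) Nat.prime_two (by norm_num)
    (hasDensity_squarefree.congr (by simp))
  convert this using 2
  norm_num

theorem hasDensity_odd_squarefree_dvd {ℓ : ℕ} (hℓ : ℓ.Prime) (h2 : ℓ ≠ 2) :
    HasDensity (fun n => (Squarefree n ∧ n.Coprime 2) ∧ ℓ ∣ n)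
      (6 / Real.pi ^ 2 * (2 / 3) / (ℓ + 1)) := by
  have hco : ℓ.Coprime 2 := (Nat.coprime_primes hℓ Nat.prime_two).mpr h2
  have h := (hasDensity_squarefree_coprime_mul hℓ hco hasDensity_odd_squarefree).dvd_and_div hℓ.pos
  have hl : (ℓ : ℝ) ≠ 0 := by exact_mod_cast hℓ.ne_zero
  convert h.congr (R := fun n => (Squarefree n ∧ n.Coprime 2) ∧ ℓ ∣ n) ?_ using 1
  · field_simp
  · intro n _
    refine ⟨?_, ?_⟩
    · rintro ⟨⟨j, rfl⟩, h⟩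
      rw [Nat.mul_div_cancel_left _ hℓ.pos, Nat.coprime_mul_iff_right] at h
      refine ⟨⟨Nat.squarefree_mul_iff.mpr ⟨h.2.2.symm, hℓ.prime.squarefree, h.1⟩,
        Nat.coprime_mul_iff_left.mpr ⟨hco, h.2.1⟩⟩, dvd_mul_right _ _⟩
    · rintro ⟨⟨hs, hc⟩, ⟨j, rfl⟩⟩
      rw [Nat.squarefree_mul_iff] at hs
      rw [Nat.coprime_mul_iff_left] at hc
      rw [Nat.mul_div_cancel_left _ hℓ.pos, Nat.coprime_mul_iff_right]
      exact ⟨dvd_mul_right _ _, hs.2.2, hc.2, hs.1.symm⟩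

theorem isFundDiscr_of_odd {n : ℕ} (hn : n % 2 = 1) :
    (IsFundDiscr n ↔ Squarefree n ∧ n % 4 = 1) ∧
      (IsFundDiscr (-n) ↔ Squarefree n ∧ n % 4 = 3) := by
  have hs : Squarefree (-(n : ℤ)) ↔ Squarefree n := by
    rw [← Int.squarefree_natAbs]; simp
  have hs' : Squarefree (n : ℤ) ↔ Squarefree n := by
    rw [← Int.squarefree_natAbs]; simp
  constructor
  · constructor
    · rintro (⟨h, h4⟩ | ⟨m, h, -⟩)
      · exact ⟨hs'.mp h, by omega⟩
      · omega
    · rintro ⟨h, h4⟩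
      exact .inl ⟨hs'.mpr h, by omega⟩
  · constructor
    · rintro (⟨h, h4⟩ | ⟨m, h, -⟩)
      · exact ⟨hs.mp h, by omega⟩
      · omega
    · rintro ⟨h, h4⟩
      exact .inl ⟨hs.mpr h, by omega⟩

theorem isFundDiscr_four_mul (k : ℕ) :
    (IsFundDiscr (4 * k : ℕ) ↔ Squarefree k ∧ k % 4 ≠ 1) ∧
      (IsFundDiscr (-(4 * k : ℕ)) ↔ Squarefree k ∧ k % 4 ≠ 3) := by
  have hs : Squarefree (-(k : ℤ)) ↔ Squarefree k := by
    rw [← Int.squarefree_natAbs]; simp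
  have hs' : Squarefree (k : ℤ) ↔ Squarefree k := by
    rw [← Int.squarefree_natAbs]; simp
  constructor
  · constructor
    · rintro (⟨h, h4⟩ | ⟨m, h, h1, h4⟩)
      · omega
      · obtain rfl : m = k := by omega
        exact ⟨hs'.mp h1, by omega⟩
    · rintro ⟨h, h4⟩
      exact .inr ⟨k, by push_cast; ring, hs'.mpr h, by omega⟩
  · constructor
    · rintro (⟨h, h4⟩ | ⟨m, h, h1, h4⟩)
      · omega
      · obtain rfl : m = -k := by omega
        exact ⟨hs.mp h1, by omega⟩
    · rintro ⟨h, h4⟩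
      exact .inr ⟨-k, by push_cast; ring, hs.mpr h, by omega⟩

theorem not_isFundDiscr_of_emod_four_eq_two {d : ℤ} (h : d % 4 = 2) : ¬ IsFundDiscr d := by
  rintro (⟨-, h4⟩ | ⟨m, hm, -⟩) <;> omega

open Classical in
theorem fundDiscr_indicator_add (n : ℕ) :
    ((if IsFundDiscr n then 1 else 0) + (if IsFundDiscr (-n) then 1 else 0) : ℝ) =
      (if Squarefree n ∧ n.Coprime 2 then 1 else 0) +
        (if 4 ∣ n ∧ (Squarefree (n / 4) ∧ (n / 4).Coprime 2) then 1 else 0) +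
        2 * (if 8 ∣ n ∧ (Squarefree (n / 8) ∧ (n / 8).Coprime 2) then 1 else 0) := by
  simp only [Nat.coprime_two_right, Nat.odd_iff]
  obtain h | h | h : n % 2 = 1 ∨ n % 4 = 2 ∨ n % 4 = 0 := by omega
  · have h4 : ¬ 4 ∣ n := by omega
    have h8 : ¬ 8 ∣ n := by omega
    rw [(isFundDiscr_of_odd h).1, (isFundDiscr_of_odd h).2]
    obtain h' | h' : n % 4 = 1 ∨ n % 4 = 3 := by omega
    all_goals by_cases hs : Squarefree n <;> simp [h, h', h4, h8, hs]
  · have h4 : ¬ 4 ∣ n := by omega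
    have h8 : ¬ 8 ∣ n := by omega
    have h2 : ¬ n % 2 = 1 := by omega
    simp [h4, h8, h2, not_isFundDiscr_of_emod_four_eq_two (show (n : ℤ) % 4 = 2 by omega),
      not_isFundDiscr_of_emod_four_eq_two (show -(n : ℤ) % 4 = 2 by omega)]
  · obtain ⟨k, rfl⟩ : 4 ∣ n := Nat.dvd_of_mod_eq_zero h
    have h2 : ¬ 4 * k % 2 = 1 := by omega
    rw [(isFundDiscr_four_mul k).1, (isFundDiscr_four_mul k).2,
      Nat.mul_div_cancel_left _ (by norm_num : 0 < 4)]
    obtain hk | hk | hk : k % 4 = 1 ∨ k % 4 = 3 ∨ k % 2 = 0 := by omega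
    · have h8 : ¬ 8 ∣ 4 * k := by omega
      have hk2 : k % 2 = 1 := by omega
      simp [h2, h8, hk, hk2]
    · have h8 : ¬ 8 ∣ 4 * k := by omega
      have hk2 : k % 2 = 1 := by omega
      simp [h2, h8, hk, hk2]
    · obtain ⟨j, rfl⟩ : 2 ∣ k := Nat.dvd_of_mod_eq_zero hk
      have h8 : 8 ∣ 4 * (2 * j) := ⟨j, by ring⟩
      have e : 4 * (2 * j) / 8 = j := by omega
      have h1 : ¬ (2 * j) % 4 = 1 := by omega
      have h3 : ¬ (2 * j) % 4 = 3 := by omega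
      have hsq : Squarefree (2 * j) ↔ Squarefree j ∧ j % 2 = 1 := by
        rw [Nat.squarefree_mul_iff, Nat.coprime_two_left, Nat.odd_iff]
        simp only [Nat.prime_two.prime.squarefree, true_and]
        tauto
      simp only [e, h8, hsq, h1, h3, h2, ne_eq]
      by_cases hj : Squarefree j ∧ j % 2 = 1 <;> simp [hj]
      norm_num

theorem ncard_fundDiscr_dvd (ℓ : ℕ) (x : ℝ) :
    ({d : ℤ | |(d : ℝ)| ≤ x ∧ IsFundDiscr d ∧ (ℓ : ℤ) ∣ d}.ncard : ℝ) =
      countUpTo (fun n => IsFundDiscr n ∧ ℓ ∣ n) x +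
        countUpTo (fun n => IsFundDiscr (-n) ∧ ℓ ∣ n) x := by
  classical
  rw [countUpTo_eq_card, countUpTo_eq_card]
  set A := (Finset.Ioc 0 ⌊x⌋₊).filter (fun n : ℕ => IsFundDiscr n ∧ ℓ ∣ n)
  set B := (Finset.Ioc 0 ⌊x⌋₊).filter (fun n : ℕ => IsFundDiscr (-n) ∧ ℓ ∣ n)
  have hinj : Function.Injective (fun n : ℕ => -(n : ℤ)) := fun a b h => by simpa using h
  have hset : {d : ℤ | |(d : ℝ)| ≤ x ∧ IsFundDiscr d ∧ (ℓ : ℤ) ∣ d} =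
      Set.image (fun n : ℕ => (n : ℤ)) A ∪ Set.image (fun n : ℕ => -(n : ℤ)) B := by
    ext d
    simp only [Set.mem_ofPred_eq, Set.mem_union, Set.mem_image, A, B, Finset.coe_filter,
      Finset.mem_Ioc]
    constructor
    · rintro ⟨hx, hd, hl⟩
      have h0 : d ≠ 0 := by
        rintro rfl
        obtain ⟨-, h⟩ | ⟨m, hm, hs, -⟩ := hd
        · simp at h
        · exact hs.ne_zero (by omega)
      have hfl : d.natAbs ≤ ⌊x⌋₊ := Nat.le_floor (by rwa [Nat.cast_natAbs, Int.cast_abs])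
      obtain h | h := lt_or_gt_of_ne h0
      · refine .inr ⟨d.natAbs, ⟨⟨by omega, hfl⟩, ?_, Int.natCast_dvd.mp hl⟩, by omega⟩
        rwa [show -(d.natAbs : ℤ) = d by omega]
      · refine .inl ⟨d.natAbs, ⟨⟨by omega, hfl⟩, ?_, Int.natCast_dvd.mp hl⟩, by omega⟩
        rwa [show (d.natAbs : ℤ) = d by omega]
    · rintro (⟨n, ⟨⟨h0, hn⟩, hd, hl⟩, rfl⟩ | ⟨n, ⟨⟨h0, hn⟩, hd, hl⟩, rfl⟩)
      · refine ⟨?_, hd, Int.natCast_dvd_natCast.mpr hl⟩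
        simpa using (Nat.le_floor_iff' h0.ne').mp hn
      · refine ⟨?_, hd, (Int.natCast_dvd_natCast.mpr hl).neg_right⟩
        simpa using (Nat.le_floor_iff' h0.ne').mp hn
  have hdisj : Disjoint (Set.image (fun n : ℕ => (n : ℤ)) A)
      (Set.image (fun n : ℕ => -(n : ℤ)) B) := by
    rw [Set.disjoint_left]
    rintro _ ⟨a, ha, rfl⟩ ⟨b, hb, hab⟩
    simp only [A, B, Finset.coe_filter, Set.mem_ofPred_eq, Finset.mem_Ioc] at ha hb hab
    omega
  rw [hset, Set.ncard_union_eq hdisj (A.finite_toSet.image _) (B.finite_toSet.image _),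
    Set.ncard_image_of_injective _ Nat.cast_injective, Set.ncard_image_of_injective _ hinj,
    Set.ncard_coe_finset, Set.ncard_coe_finset, Nat.cast_add]
  congr!

theorem countUpTo_fundDiscr_add (ℓ : ℕ) (x : ℝ) :
    countUpTo (fun n => IsFundDiscr n ∧ ℓ ∣ n) x +
        countUpTo (fun n => IsFundDiscr (-n) ∧ ℓ ∣ n) x =
      countUpTo (fun n => (Squarefree n ∧ n.Coprime 2) ∧ ℓ ∣ n) x +
        countUpTo (fun n => (4 ∣ n ∧ (Squarefree (n / 4) ∧ (n / 4).Coprime 2)) ∧ ℓ ∣ n) x +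
        2 * countUpTo (fun n => (8 ∣ n ∧ (Squarefree (n / 8) ∧ (n / 8).Coprime 2)) ∧ ℓ ∣ n) x := by
  classical
  simp only [countUpTo]
  rw [Finset.mul_sum, ← Finset.sum_add_distrib, ← Finset.sum_add_distrib,
    ← Finset.sum_add_distrib]
  refine Finset.sum_congr rfl fun n _ => ?_
  by_cases hl : ℓ ∣ n
  · have := fundDiscr_indicator_add n
    simp only [hl, and_true]
    exact this
  · simp [hl]

theorem tendsto_ncard_fundDiscr_dvd {ℓ : ℕ} {a b c : ℝ}
    (ha : HasDensity (fun n => (Squarefree n ∧ n.Coprime 2) ∧ ℓ ∣ n) a)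
    (hb : HasDensity (fun n => (4 ∣ n ∧ (Squarefree (n / 4) ∧ (n / 4).Coprime 2)) ∧ ℓ ∣ n) b)
    (hc : HasDensity (fun n => (8 ∣ n ∧ (Squarefree (n / 8) ∧ (n / 8).Coprime 2)) ∧ ℓ ∣ n) c) :
    Tendsto (fun x : ℝ =>
      ({d : ℤ | |(d : ℝ)| ≤ x ∧ IsFundDiscr d ∧ (ℓ : ℤ) ∣ d}.ncard : ℝ) / x) atTop
      (𝓝 (a + b + 2 * c)) := by
  refine ((Tendsto.add ha hb).add (Tendsto.const_mul 2 hc)).congr fun x => ?_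
  rw [ncard_fundDiscr_dvd, countUpTo_fundDiscr_add]
  ring

theorem hasDensity_false : HasDensity (fun _ => False) 0 := by
  simp [HasDensity, countUpTo]

theorem tendsto_ncard_fundDiscr_prime_dvd {ℓ : ℕ} (hℓ : ℓ.Prime) :
    Tendsto (fun x : ℝ =>
      ({d : ℤ | |(d : ℝ)| ≤ x ∧ IsFundDiscr d ∧ (ℓ : ℤ) ∣ d}.ncard : ℝ) / x) atTop
      (𝓝 (1 / ((ℓ : ℝ) + 1) * (6 / Real.pi ^ 2))) := by
  by_cases h2 : ℓ = 2
  · subst h2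
    convert tendsto_ncard_fundDiscr_dvd
      (hasDensity_false.congr (R := fun n => (Squarefree n ∧ n.Coprime 2) ∧ 2 ∣ n) ?_)
      ((hasDensity_odd_squarefree.dvd_and_div (show 0 < 4 by norm_num)).congr ?_)
      ((hasDensity_odd_squarefree.dvd_and_div (show 0 < 8 by norm_num)).congr ?_) using 2
    · push_cast; ring
    · intro n _
      simp only [Nat.coprime_two_right, Nat.odd_iff, false_iff]
      rintro ⟨⟨-, h⟩, h'⟩
      omega
    · intro n _
      exact ⟨fun h => ⟨h, (by norm_num : 2 ∣ 4).trans h.1⟩, fun h => h.1⟩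
    · intro n _
      exact ⟨fun h => ⟨h, (by norm_num : 2 ∣ 8).trans h.1⟩, fun h => h.1⟩
  · have hd := hasDensity_odd_squarefree_dvd hℓ h2
    have hdvd {k n : ℕ} (hk : k.Coprime ℓ) (hk0 : 0 < k) :
        (k ∣ n ∧ (Squarefree (n / k) ∧ (n / k).Coprime 2) ∧ ℓ ∣ n / k) ↔
          (k ∣ n ∧ (Squarefree (n / k) ∧ (n / k).Coprime 2)) ∧ ℓ ∣ n := by
      rw [← and_assoc, and_congr_right_iff]
      rintro ⟨⟨j, rfl⟩, -⟩
      rw [Nat.mul_div_cancel_left _ hk0, hk.symm.dvd_mul_left]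
    have hco : (2 : ℕ).Coprime ℓ := (Nat.coprime_primes Nat.prime_two hℓ).mpr (Ne.symm h2)
    convert tendsto_ncard_fundDiscr_dvd hd
      ((hd.dvd_and_div (show 0 < 4 by norm_num)).congr fun n _ =>
        hdvd (hco.pow_left 2) (by norm_num))
      ((hd.dvd_and_div (show 0 < 8 by norm_num)).congr fun n _ =>
        hdvd (hco.pow_left 3) (by norm_num)) using 2
    push_cast; ring

theorem mem_discr_ramified_iff {ℓ : ℕ} (hℓ : ℓ.Prime) (d : ℤ) :
    (∃ _ : NumberField ↥(sqrtFieldC d),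
        Module.finrank ℚ ↥(sqrtFieldC d) = 2 ∧
        NumberField.discr ↥(sqrtFieldC d) = d ∧
        RamifiesInC (sqrtFieldC d) ℓ) ↔ IsFundDiscr d ∧ (ℓ : ℤ) ∣ d := by
  obtain ⟨s, hs⟩ := exists_sq_eq_sqrtFieldC d
  constructor
  · rintro ⟨_, h2, hd, hr⟩
    have hr' := (ramifies_iff_dvd_discr h2 hℓ).mp hr
    have hf := isFundDiscr_discr h2 hs ((finrank_sqrtFieldC_eq_two_iff d).mp h2)
    rw [hd] at hr' hf
    exact ⟨hf, hr'⟩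
  · rintro ⟨hf, hl⟩
    have hd1 : d ≠ 1 := by
      rintro rfl
      exact hℓ.one_lt.ne' (by simpa using Int.eq_one_of_dvd_one (by positivity) hl)
    have hsq := hf.not_isSquare hd1
    have h2 := (finrank_sqrtFieldC_eq_two_iff d).mpr hsq
    have := numberField_sqrtFieldC_s13 d
    have hd := hf.discr_eq h2 hs hsq
    exact ⟨this, h2, hd, (ramifies_iff_dvd_discr h2 hℓ).mpr (hd.symm ▸ hl)⟩

end

/-- For a rational prime `ℓ`, the number of quadratic fields (counted by their
discriminants `d`) with `|Δ_k| ≤ x` in which `ℓ` ramifies is asymptotic to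
`(1/(ℓ+1))·(6/π²)·x` as `x → ∞`. -/
theorem count_quadratic_fields_with_ramified_prime
    (ℓ : ℕ) (hℓ : ℓ.Prime) :
    Filter.Tendsto
      (fun x : ℝ =>
        ({d : ℤ | |(d : ℝ)| ≤ x ∧
            ∃ _ : NumberField ↥(sqrtFieldC d),
              Module.finrank ℚ ↥(sqrtFieldC d) = 2 ∧
              NumberField.discr ↥(sqrtFieldC d) = d ∧
              RamifiesInC (sqrtFieldC d) ℓ}.ncard : ℝ) / x)
      Filter.atTop (nhds ((1 / ((ℓ : ℝ) + 1)) * (6 / Real.pi ^ 2))) := by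
  simp_rw [mem_discr_ramified_iff hℓ]
  exact tendsto_ncard_fundDiscr_prime_dvd hℓ
end
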